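/- arXiv:2007.05383 — 2 statements merged into one kernel-verified Lean document; each statement's English description precedes it below -/
import Mathlib

section
/- Let K be a number field and G a finite group, and suppose that G admits a generic extension over K in the following field-level sense: there exist m ∈ ℕ and a finite Galois extension Ẽ of the rational function field K(x₁,…,x_m) with Galois group isomorphic to G such that, for every field extension Ω of K and every finite Galois field extension M of Ω whose Galois group is isomorphic to a subgroup of G, M is a specialization of Ẽ/K(x₁,…,x_m) over Ω. Then there exist a finite Galois field extension E of the rational function field F = K(x,y) in two variables over K with Galois group isomorphic to G, and a finite set T of primes of K, such that for every prime v of K not in T and every finite Galois field extension L of K_v whose Galois group is isomorphic to a subgroup of G, the extension L of K_v is a specialization of E/F over K_v. -/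
open scoped TensorProduct
open IsDedekindDomain NumberField

set_option synthInstance.maxHeartbeats 1000000
set_option maxHeartbeats 2000000
/-- `M/Ω` is a specialization of the finite Galois field extension `E/F` over `Ω`. -/
def IsSpecialization (K F E Ω M : Type) [Field K] [Field F] [Field E] [Field Ω] [Field M]
    [Algebra K F] [Algebra F E] [Algebra K Ω] [Algebra Ω M] : Prop :=
  ∃ A : Subalgebra K F, A.FG ∧ (∀ x : F, IsIntegral A x → x ∈ A) ∧ IsFractionRing A F ∧
    ∃ ψ : A →ₐ[K] Ω,
      letI : Algebra A E := ((algebraMap F E).comp (algebraMap A F)).toAlgebra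
      letI : Algebra A Ω := ψ.toRingHom.toAlgebra
      IsReduced (Ω ⊗[A] (integralClosure A E)) ∧
      ∃ m : Ideal (Ω ⊗[A] (integralClosure A E)), m.IsMaximal ∧
        Nonempty (((Ω ⊗[A] (integralClosure A E)) ⧸ m) ≃ₐ[Ω] M)

/-- Finiteness of integral closure: over a field of characteristic zero, the integral closure of a
finitely generated domain in its field of fractions is finitely generated. -/
theorem Subalgebra.fg_restrictScalars_integralClosure {K F : Type*} [Field K] [CharZero K] [Field F]
    [Algebra K F] (A : Subalgebra K F) (hA : A.FG) [IsFractionRing A F] :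
    ((integralClosure A F).restrictScalars K).FG := by
  have : Algebra.FiniteType K A := A.fg_iff_finiteType.mp hA
  obtain ⟨s, g, hg, hfin⟩ := exists_finite_inj_algHom_of_fg K A
  let P := MvPolynomial (Fin s) K
  let φ : P →ₐ[K] F := A.val.comp g
  have hφ : Function.Injective φ := Subtype.val_injective.comp hg
  let : Algebra P A := g.toRingHom.toAlgebra
  let : Algebra P F := φ.toRingHom.toAlgebra
  have : IsScalarTower P A F := IsScalarTower.of_algebraMap_eq fun _ => rfl
  have : IsScalarTower K P F := IsScalarTower.of_algebraMap_eq fun x => (φ.commutes x).symm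
  have : Module.Finite P A := hfin
  have : IsDomain P := inferInstance
  have : FaithfulSMul P F := (faithfulSMul_iff_algebraMap_injective P F).mpr hφ
  have : FaithfulSMul P A := (faithfulSMul_iff_algebraMap_injective P A).mpr hg
  let := FractionRing.liftAlgebra P F
  have : IsScalarTower P (FractionRing P) F := inferInstance
  have : CharZero (FractionRing P) :=
    charZero_of_injective_algebraMap (algebraMap K (FractionRing P)).injective
  have : FiniteDimensional (FractionRing P) F := .of_isLocalization P A (nonZeroDivisors P)
  have : Module.Finite P (integralClosure P F) :=
    IsIntegralClosure.finite P (FractionRing P) F (integralClosure P F)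
  have hfg : ((integralClosure P F).restrictScalars K).FG := by
    rw [Subalgebra.fg_iff_finiteType]
    have : Algebra.FiniteType K (integralClosure P F) :=
      Algebra.FiniteType.trans (S := P) inferInstance inferInstance
    exact this
  have : Algebra.IsIntegral P A := inferInstance
  convert hfg using 1
  ext x
  simp only [Subalgebra.mem_restrictScalars, mem_integralClosure_iff]
  exact ⟨fun h => isIntegral_trans (R := P) x h, fun h => h.tower_top⟩

/-- Base change of a monogenic algebra `A[X]/(q)` along `A → Ω`, when `q` becomes separable. -/
theorem tensorProduct_monogenic_of_separable {A B Ω M : Type} [CommRing A] [CommRing B]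
    [Algebra A B]
    [Field Ω] [Algebra A Ω] [Field M] [Algebra Ω M] (θ : B) (hθ : Algebra.adjoin A {θ} = ⊤)
    (q : Polynomial A) (hker : ∀ p : Polynomial A, Polynomial.aeval θ p = 0 ↔ q ∣ p)
    (hsep : (q.map (algebraMap A Ω)).Separable) (β : M)
    (hβ : Polynomial.aeval β (q.map (algebraMap A Ω)) = 0)
    (hadj : Algebra.adjoin Ω {β} = ⊤) :
    IsReduced (Ω ⊗[A] B) ∧ ∃ m : Ideal (Ω ⊗[A] B), m.IsMaximal ∧
      Nonempty (((Ω ⊗[A] B) ⧸ m) ≃ₐ[Ω] M) := by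
  open Polynomial in
  have hsurjB : Function.Surjective (aeval θ : A[X] →ₐ[A] B) := by
    rw [← AlgHom.range_eq_top, ← Algebra.adjoin_singleton_eq_range_aeval, hθ]
  have hmapeq : ∀ p : A[X], aeval ((1 : Ω) ⊗ₜ[A] θ) (p.map (algebraMap A Ω))
      = (1 : Ω) ⊗ₜ[A] (aeval θ p) := by
    intro p
    rw [aeval_map_algebraMap]
    exact aeval_algHom_apply (Algebra.TensorProduct.includeRight : B →ₐ[A] Ω ⊗[A] B) θ p
  constructor
  · let Φ : Polynomial Ω →ₐ[Ω] Ω ⊗[A] B := aeval ((1 : Ω) ⊗ₜ[A] θ)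
    have hΦ : Function.Surjective Φ := by
      intro z
      induction z with
      | zero => exact ⟨0, map_zero _⟩
      | add x y hx hy =>
        obtain ⟨a, rfl⟩ := hx
        obtain ⟨b, rfl⟩ := hy
        exact ⟨a + b, map_add _ _ _⟩
      | tmul ω b =>
        obtain ⟨p, rfl⟩ := hsurjB b
        refine ⟨ω • p.map (algebraMap A Ω), ?_⟩
        rw [map_smul, hmapeq, TensorProduct.smul_tmul', smul_eq_mul, mul_one]
    have hq : q.map (algebraMap A Ω) ∈ RingHom.ker Φ := by
      rw [RingHom.mem_ker]
      change aeval ((1 : Ω) ⊗ₜ[A] θ) (q.map (algebraMap A Ω)) = 0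
      rw [hmapeq, (hker q).2 dvd_rfl, TensorProduct.tmul_zero]
    obtain ⟨g, hg⟩ := (IsPrincipalIdealRing.principal (RingHom.ker Φ)).principal
    have hgd : g ∣ q.map (algebraMap A Ω) := by
      rw [hg] at hq
      exact Ideal.mem_span_singleton.mp hq
    have hrad : (RingHom.ker Φ).IsRadical := by
      rw [hg]
      exact isRadical_iff_span_singleton.mp (hsep.squarefree.squarefree_of_dvd hgd).isRadical
    have : IsReduced (Polynomial Ω ⧸ RingHom.ker Φ) := Ideal.isRadical_iff_quotient_reduced _
        |>.mp hrad
    exact isReduced_of_injective (Ideal.quotientKerAlgEquivOfSurjective hΦ).symm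
      (Ideal.quotientKerAlgEquivOfSurjective hΦ).symm.injective
  · let : Algebra A M := ((algebraMap Ω M).comp (algebraMap A Ω)).toAlgebra
    have : IsScalarTower A Ω M := IsScalarTower.of_algebraMap_eq fun _ => rfl
    rw [aeval_map_algebraMap] at hβ
    let e := Ideal.quotientKerAlgEquivOfSurjective hsurjB
    let ι₀ : (A[X] ⧸ RingHom.ker (aeval θ : A[X] →ₐ[A] B)) →ₐ[A] M :=
      Ideal.Quotient.liftₐ _ (aeval β) (by
        intro p hp
        obtain ⟨r, rfl⟩ := (hker p).1 hp
        rw [map_mul, hβ, zero_mul])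
    let ι : B →ₐ[A] M := ι₀.comp e.symm.toAlgHom
    have hι : ι θ = β := by
      have h1 : e.symm θ = Ideal.Quotient.mk _ X := by
        rw [AlgEquiv.symm_apply_eq]
        simp [e]
      change ι₀ (e.symm θ) = β
      rw [h1]
      exact aeval_X β
    let Ψ : Ω ⊗[A] B →ₐ[Ω] M := Algebra.TensorProduct.lift (Algebra.ofId Ω M) ι
      (fun _ _ => Commute.all _ _)
    have hΨ : Function.Surjective Ψ := by
      rw [← AlgHom.range_eq_top, eq_top_iff, ← hadj, Algebra.adjoin_le_iff]
      rintro _ rfl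
      exact ⟨1 ⊗ₜ θ, by simp [Ψ, hι]⟩
    exact ⟨RingHom.ker Ψ, RingHom.ker_isMaximal_of_surjective Ψ hΨ,
      ⟨Ideal.quotientKerAlgEquivOfSurjective hΨ⟩⟩

/-- If the minimal polynomial of a generator is coprime to its derivative already over the
integrally closed ring `A`, then the generator generates the integral closure of `A`. -/
theorem integralClosure_monogenic_of_isCoprime_derivative {A F E : Type*} [CommRing A] [IsDomain A]
    [IsIntegrallyClosed A] [Field F] [Algebra A F] [IsFractionRing A F] [Field E] [Algebra F E]
    [Algebra A E] [IsScalarTower A F E] [FiniteDimensional F E] [Algebra.IsSeparable F E]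
    (q : Polynomial A) (hq : q.Monic) (hdeg : q.natDegree = Module.finrank F E)
    (hcop : IsCoprime q (Polynomial.derivative q)) (θ : integralClosure A E)
    (hθ : Polynomial.aeval θ q = 0) (hgen : IntermediateField.adjoin F {(θ : E)} = ⊤) :
    Algebra.adjoin A {θ} = ⊤ ∧ ∀ p : Polynomial A, Polynomial.aeval θ p = 0 ↔ q ∣ p := by
  open Polynomial in
  have hcoe : ∀ p : A[X], ((aeval θ p : integralClosure A E) : E) = aeval (θ : E) p := fun p =>
    (aeval_algHom_apply (integralClosure A E).val θ p).symm
  have hθE : aeval (θ : E) q = 0 := by rw [← hcoe, hθ]; rfl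
  have hθint : IsIntegral F (θ : E) := Algebra.IsIntegral.isIntegral _
  have hAF : Function.Injective (algebraMap A F) := FaithfulSMul.algebraMap_injective A F
  have hmin : minpoly F (θ : E) = q.map (algebraMap A F) := by
    symm
    have hd : minpoly F (θ : E) ∣ q.map (algebraMap A F) :=
      minpoly.dvd _ _ (by rw [aeval_map_algebraMap]; exact hθE)
    refine (eq_of_monic_of_dvd_of_natDegree_le (minpoly.monic hθint) (hq.map _) hd ?_)
    rw [hq.natDegree_map, hdeg, ← IntermediateField.adjoin.finrank hθint, hgen,
      IntermediateField.finrank_top']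
  have hker : ∀ p : A[X], aeval θ p = 0 ↔ q ∣ p := by
    intro p
    constructor
    · intro hp
      rw [← modByMonic_eq_zero_iff_dvd hq]
      have h1 : aeval (θ : E) (p %ₘ q) = 0 := by
        have h2 : aeval (θ : E) p = 0 := by rw [← hcoe, hp]; rfl
        rw [modByMonic_eq_sub_mul_div, map_sub, map_mul, h2, hθE, zero_mul, sub_zero]
      by_contra hne
      have h3 : minpoly F (θ : E) ∣ (p %ₘ q).map (algebraMap A F) :=
        minpoly.dvd _ _ (by rw [aeval_map_algebraMap]; exact h1)
      rw [hmin, map_dvd_map _ hAF hq] at h3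
      exact hne ((modByMonic_eq_self_iff hq).2 (degree_modByMonic_lt p hq) ▸
        (modByMonic_eq_zero_iff_dvd hq).2 h3)
    · rintro ⟨r, rfl⟩
      rw [map_mul, hθ, zero_mul]
  refine ⟨?_, hker⟩
  let pb₀ := IntermediateField.adjoin.powerBasis hθint
  let pb : PowerBasis F E := pb₀.map ((IntermediateField.equivOfEq hgen).trans
    IntermediateField.topEquiv)
  have hpb : pb.gen = (θ : E) := by
    simp only [pb, pb₀, PowerBasis.map_gen, IntermediateField.adjoin.powerBasis_gen]
    rfl
  obtain ⟨u, w, huw⟩ := hcop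
  have hw : aeval (θ : E) w * aeval (θ : E) (derivative q) = 1 := by
    have := congrArg (aeval (θ : E)) huw
    rwa [map_add, map_mul, map_mul, hθE, mul_zero, zero_add, map_one] at this
  have hN : Algebra.norm F (aeval (θ : E) w) * Algebra.norm F (aeval (θ : E) (derivative q)) =
      1 := by
    rw [← map_mul, hw, map_one]
  have hwint : IsIntegral A (aeval (θ : E) w) := by
    rw [← hcoe]
    exact (aeval θ w).2
  obtain ⟨a, ha⟩ := IsIntegrallyClosed.isIntegral_iff.1 (Algebra.isIntegral_norm F hwint)
  have hdisc := Algebra.discr_powerBasis_eq_norm F pb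
  rw [hpb, hmin, derivative_map, aeval_map_algebraMap] at hdisc
  rw [eq_top_iff]
  rintro z -
  have hz := Algebra.discr_mul_isIntegral_mem_adjoin (R := A) F (B := pb) (hpb ▸ θ.2) z.2
  rw [hpb] at hz
  have hz2 : (z : E) ∈ Algebra.adjoin A {(θ : E)} := by
    generalize hk : Module.finrank F E * (Module.finrank F E - 1) / 2 = k at hdisc
    have h5 : (((-1) ^ k * a : A)) • (Algebra.discr F pb.basis • (z : E)) = z := by
      rw [← algebraMap_smul F, smul_smul, map_mul, ha, hdisc, map_pow, map_neg, map_one]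
      have : (-1 : F) ^ k * (-1) ^ k = 1 := by rw [← mul_pow]; simp
      calc _ = (((-1 : F) ^ k * (-1) ^ k) * (Algebra.norm F (aeval (θ : E) w) *
          Algebra.norm F (aeval (θ : E) (derivative q)))) • (z : E) := by congr 1; ring
        _ = z := by rw [this, hN, one_mul, one_smul]
    rw [← h5]
    exact Subalgebra.smul_mem _ hz _
  rw [Algebra.adjoin_singleton_eq_range_aeval] at hz2 ⊢
  obtain ⟨p, hp⟩ := hz2
  exact ⟨p, Subtype.ext ((hcoe p).trans hp)⟩

theorem isFractionRing_of_adjoin_eq_top {K F : Type*} [Field K] [Field F] [Algebra K F]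
    (A : Subalgebra K F) (S : Set F) (hS : S ⊆ A) (h : IntermediateField.adjoin K S = ⊤) :
    IsFractionRing A F := by
  refine IsFractionRing.of_field A F fun z => ?_
  have hz : z ∈ IntermediateField.adjoin K S := h ▸ IntermediateField.mem_top
  obtain ⟨r, hr, s, hs, rfl⟩ := IntermediateField.mem_adjoin_iff_div.1 hz
  have hle : Algebra.adjoin K S ≤ A := Algebra.adjoin_le hS
  exact ⟨⟨r, hle hr⟩, ⟨s, hle hs⟩, rfl⟩

theorem Polynomial.exists_map_inclusion_eq {K F : Type*} [Field K] [Field F] [Algebra K F]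
    {A R : Subalgebra K F} (h : A ≤ R) (p : Polynomial R) (hp : ∀ n, (p.coeff n : F) ∈ A) :
    ∃ p' : Polynomial A, p'.map (Subalgebra.inclusion h).toRingHom = p := by
  have : p ∈ Polynomial.lifts (Subalgebra.inclusion h).toRingHom := by
    rw [Polynomial.lifts_iff_coeff_lifts]
    exact fun n => ⟨⟨p.coeff n, hp n⟩, rfl⟩
  exact this

theorem Polynomial.isCoprime_derivative_of_separable_map {R Ω : Type*} [CommRing R] [IsDomain R]
    [CharZero R] [Field Ω] [CharZero Ω] (φ : R →+* Ω) (hφ : ∀ r, φ r ≠ 0 → IsUnit r)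
    (q : Polynomial R) (hq : q.Monic) (hsep : (q.map φ).Separable) :
    IsCoprime q (Polynomial.derivative q) := by
  rw [← Polynomial.isUnit_resultant_iff_isCoprime hq]
  apply hφ
  rw [← Polynomial.resultant_map_map]
  have h1 : q.natDegree = (q.map φ).natDegree := (hq.natDegree_map φ).symm
  have h2 : (Polynomial.derivative q).natDegree =
      ((Polynomial.derivative q).map φ).natDegree := by
    rw [Polynomial.natDegree_derivative, ← Polynomial.derivative_map,
      Polynomial.natDegree_derivative, h1]
  rw [h1, h2]
  apply Polynomial.resultant_ne_zero
  rw [← Polynomial.derivative_map]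
  exact hsep

/-- A criterion for being a specialization: it suffices to have a residue map on a (large)
integrally closed ring under which the minimal polynomial of a generator stays separable. -/
theorem IsSpecialization.of_root {K F E Ω M : Type} [Field K] [CharZero K] [Field F] [Field E]
    [Field Ω] [Field M] [Algebra K F] [Algebra F E] [Algebra K Ω] [Algebra Ω M]
    [FiniteDimensional F E] (R : Subalgebra K F) (hR : ∀ x : F, IsIntegral R x → x ∈ R)
    (φ : R →ₐ[K] Ω) (hφ : ∀ r, φ r ≠ 0 → IsUnit r) (S : Finset F) (hS : (S : Set F) ⊆ R)
    (htop : IntermediateField.adjoin K (S : Set F) = ⊤) (θ : E)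
    (hgen : IntermediateField.adjoin F {θ} = ⊤) (q : Polynomial R) (hq : q.Monic)
    (hdeg : q.natDegree = Module.finrank F E)
    (hθ : Polynomial.eval₂ ((algebraMap F E).comp (algebraMap R F)) θ q = 0)
    (hsep : (q.map φ.toRingHom).Separable) (β : M)
    (hβ : Polynomial.aeval β (q.map φ.toRingHom) = 0) (hadj : Algebra.adjoin Ω {β} = ⊤) :
    IsSpecialization K F E Ω M := by
  have : CharZero F := charZero_of_injective_algebraMap (algebraMap K F).injective
  have : CharZero Ω := charZero_of_injective_algebraMap (algebraMap K Ω).injective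
  have : CharZero R := charZero_of_injective_algebraMap (algebraMap K R).injective
  obtain ⟨u, w, huw⟩ :=
    Polynomial.isCoprime_derivative_of_separable_map φ.toRingHom hφ q hq hsep
  classical
  let S' : Finset F := S ∪ q.coeffs.image (algebraMap R F) ∪ u.coeffs.image (algebraMap R F) ∪
    w.coeffs.image (algebraMap R F)
  have hS' : (S' : Set F) ⊆ R := by
    intro x hx
    simp only [S', Finset.coe_union, Finset.coe_image, Set.mem_union, Set.mem_image] at hx
    rcases hx with ((hx | ⟨y, -, rfl⟩) | ⟨y, -, rfl⟩) | ⟨y, -, rfl⟩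
    · exact hS hx
    all_goals exact y.2
  let A₀ : Subalgebra K F := Algebra.adjoin K (S' : Set F)
  have hSA₀ : (S' : Set F) ⊆ A₀ := Algebra.subset_adjoin
  have hA₀R : A₀ ≤ R := Algebra.adjoin_le hS'
  have hfr₀ : IsFractionRing A₀ F := by
    refine isFractionRing_of_adjoin_eq_top A₀ (S : Set F) (fun x hx => hSA₀ ?_) htop
    simp only [S', Finset.coe_union, Set.mem_union]
    exact Or.inl (Or.inl (Or.inl hx))
  have hfg : A₀.FG := ⟨S', rfl⟩
  let A : Subalgebra K F := (integralClosure A₀ F).restrictScalars K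
  have hA₀A : A₀ ≤ A := fun x hx => (isIntegral_algebraMap (R := A₀) (A := F) (x := ⟨x, hx⟩) :)
  have hAint : ∀ x : F, IsIntegral A x → x ∈ A := by
    intro x hx
    exact isIntegral_trans (R := A₀) (A := integralClosure A₀ F) x hx
  have hAR : A ≤ R := by
    intro x hx
    apply hR
    let := (Subalgebra.inclusion hA₀R).toRingHom.toAlgebra
    have : IsScalarTower A₀ R F := IsScalarTower.of_algebraMap_eq fun _ => rfl
    exact IsIntegral.tower_top (R := A₀) hx
  have hfr : IsFractionRing A F := by
    refine isFractionRing_of_adjoin_eq_top A (S : Set F) (fun x hx => hA₀A (hSA₀ ?_)) htop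
    simp only [S', Finset.coe_union, Set.mem_union]
    exact Or.inl (Or.inl (Or.inl hx))
  have hcoef : ∀ p : Polynomial R, p.coeffs.image (algebraMap R F) ⊆ S' →
      ∀ n, (p.coeff n : F) ∈ A := by
    intro p hp n
    by_cases h0 : p.coeff n = 0
    · rw [h0]; exact A.zero_mem
    · exact hA₀A (hSA₀ (hp (Finset.mem_image_of_mem _ (Polynomial.coeff_mem_coeffs h0))))
  obtain ⟨q', hq'⟩ := Polynomial.exists_map_inclusion_eq hAR q (hcoef q (by grind))
  obtain ⟨u', hu'⟩ := Polynomial.exists_map_inclusion_eq hAR u (hcoef u (by grind))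
  obtain ⟨w', hw'⟩ := Polynomial.exists_map_inclusion_eq hAR w (hcoef w (by grind))
  have hinj : Function.Injective (Subalgebra.inclusion hAR).toRingHom :=
    Subalgebra.inclusion_injective hAR
  have hq'm : q'.Monic := Polynomial.monic_of_injective hinj (hq' ▸ hq)
  have hq'deg : q'.natDegree = Module.finrank F E := by
    rw [← hdeg, ← hq', hq'm.natDegree_map]
  have hcop : IsCoprime q' (Polynomial.derivative q') := by
    refine ⟨u', w', Polynomial.map_injective _ hinj ?_⟩
    rw [Polynomial.map_add, Polynomial.map_mul, Polynomial.map_mul, ← Polynomial.derivative_map,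
      hu', hw', hq', huw, Polynomial.map_one]
  let ψ : A →ₐ[K] Ω := φ.comp (Subalgebra.inclusion hAR)
  refine ⟨A, Subalgebra.fg_restrictScalars_integralClosure A₀ hfg, hAint, hfr, ψ, ?_⟩
  let : Algebra A E := ((algebraMap F E).comp (algebraMap A F)).toAlgebra
  let : Algebra A Ω := ψ.toRingHom.toAlgebra
  have : @IsScalarTower A F E Algebra.toSMul Algebra.toSMul Algebra.toSMul :=
    IsScalarTower.of_algebraMap_eq fun _ => rfl
  have hic : IsIntegrallyClosed A := (isIntegrallyClosed_iff F).2
    fun {x} hx => ⟨⟨x, hAint x hx⟩, rfl⟩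
  have hθ' : Polynomial.aeval θ q' = 0 := by
    rw [← hq', Polynomial.eval₂_map] at hθ
    exact hθ
  have hθint : IsIntegral A θ := ⟨q', hq'm, hθ'⟩
  let θ' : integralClosure A E := ⟨θ, hθint⟩
  have hθ'' : Polynomial.aeval θ' q' = 0 := by
    apply Subtype.ext
    exact (Polynomial.aeval_algHom_apply (integralClosure A E).val θ' q').symm.trans hθ'
  obtain ⟨h1, h2⟩ := integralClosure_monogenic_of_isCoprime_derivative q' hq'm hq'deg hcop θ'
      hθ'' hgen
  have hqmap : q'.map (algebraMap A Ω) = q.map φ.toRingHom := by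
    rw [← hq', Polynomial.map_map]; rfl
  exact tensorProduct_monogenic_of_separable θ' h1 q' h2 (hqmap ▸ hsep) β (hqmap ▸ hβ) hadj

theorem PowerSeries.exists_isRoot_of_simple_root {R : Type*} [CommRing R]
    (P : Polynomial (PowerSeries R)) (hP : P.Monic) (r : R)
    (h0 : (P.map PowerSeries.constantCoeff).eval r = 0)
    (h1 : IsUnit ((P.map PowerSeries.constantCoeff).derivative.eval r)) :
    ∃ θ : PowerSeries R, P.IsRoot θ ∧ PowerSeries.constantCoeff θ = r := by
  have key : ∀ p : Polynomial (PowerSeries R), PowerSeries.constantCoeff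
      (p.eval (PowerSeries.C r)) =
      (p.map PowerSeries.constantCoeff).eval r := by
    intro p
    rw [← Polynomial.eval_map_apply, PowerSeries.constantCoeff_C]
  obtain ⟨θ, hθ, hθ'⟩ := HenselianRing.is_henselian (I := Ideal.span {(PowerSeries.X :
      PowerSeries R)})
    P hP (PowerSeries.C r)
    (by rw [Ideal.mem_span_singleton, PowerSeries.X_dvd_iff, key, h0])
    (IsUnit.map _ (by
      rw [PowerSeries.isUnit_iff_constantCoeff, key, ← Polynomial.derivative_map]; exact h1))
  refine ⟨θ, hθ, ?_⟩
  rw [Ideal.mem_span_singleton, PowerSeries.X_dvd_iff, map_sub, PowerSeries.constantCoeff_C,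
    sub_eq_zero] at hθ'
  exact hθ'

theorem PowerSeries.exists_eq_prod_of_simple_roots {R : Type*} [CommRing R] [IsDomain R]
    (P : Polynomial (PowerSeries R)) (hP : P.Monic) (s : Finset R) (hs : s.card = P.natDegree)
    (h0 : ∀ r ∈ s, (P.map PowerSeries.constantCoeff).eval r = 0)
    (h1 : ∀ r ∈ s, IsUnit ((P.map PowerSeries.constantCoeff).derivative.eval r)) :
    ∃ θ : R → PowerSeries R, P = ∏ r ∈ s, (Polynomial.X - Polynomial.C (θ r)) := by
  classical
  have : ∀ r, ∃ θ : PowerSeries R, r ∈ s → P.IsRoot θ ∧ PowerSeries.constantCoeff θ = r := by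
    intro r
    by_cases hr : r ∈ s
    · obtain ⟨θ, hθ⟩ := PowerSeries.exists_isRoot_of_simple_root P hP r (h0 r hr) (h1 r hr)
      exact ⟨θ, fun _ => hθ⟩
    · exact ⟨0, fun h => absurd h hr⟩
  choose θ hθ using this
  refine ⟨θ, ?_⟩
  have hinj : Set.InjOn θ s := by
    intro a ha b hb hab
    rw [← (hθ a ha).2, ← (hθ b hb).2, hab]
  have hle : (s.val.map θ) ≤ P.roots := by
    rw [← Finset.image_val_of_injOn hinj, Finset.val_le_iff_val_subset]
    intro x hx
    rw [Finset.mem_val, Finset.mem_image] at hx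
    obtain ⟨a, ha, rfl⟩ := hx
    exact (Polynomial.mem_roots hP.ne_zero).2 (hθ a ha).1
  have hcard : P.roots.card ≤ (s.val.map θ).card := by
    rw [Multiset.card_map, Finset.card_val, hs]
    exact Polynomial.card_roots' P
  have heq := Multiset.eq_of_le_of_card_le hle hcard
  have := Polynomial.prod_multiset_X_sub_C_of_monic_of_roots_card_eq hP
    (by rw [← heq, Multiset.card_map, Finset.card_val, hs])
  rw [← this, ← heq, Multiset.map_map]
  rfl

theorem Polynomial.coeff_coeff_swap {D : Type*} [CommRing D] (p : Polynomial (Polynomial D))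
    (j k : ℕ) : ((Polynomial.Bivariate.swap p).coeff k).coeff j = (p.coeff j).coeff k := by
  induction p using Polynomial.induction_on' with
  | add p q hp hq => simp [hp, hq]
  | monomial n a =>
    induction a using Polynomial.induction_on' with
    | add p q hp hq => simp only [map_add, Polynomial.coeff_add, hp, hq]
    | monomial m r =>
      rw [Polynomial.Bivariate.swap_monomial_monomial]
      simp only [Polynomial.coeff_monomial]
      split_ifs <;> simp_all [Polynomial.coeff_monomial]

theorem Polynomial.natDegree_swap_le_iff {D : Type*} [CommRing D] (p : Polynomial (Polynomial D))
    (N : ℕ) : (Polynomial.Bivariate.swap p).natDegree ≤ N ↔ ∀ j, (p.coeff j).natDegree ≤ N := by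
  simp only [Polynomial.natDegree_le_iff_coeff_eq_zero]
  constructor
  · intro h j k hk
    rw [← Polynomial.coeff_coeff_swap, h k hk, Polynomial.coeff_zero]
  · intro h k hk
    ext j
    rw [Polynomial.coeff_coeff_swap, h j k hk, Polynomial.coeff_zero]

/-- Factors of a bivariate polynomial have smaller degree in the coefficient variable. -/
theorem Polynomial.natDegree_coeff_le_of_mul {D : Type*} [CommRing D] [IsDomain D]
    (G H : Polynomial (Polynomial D)) (h0 : G * H ≠ 0) (N : ℕ)
    (hN : ∀ j, ((G * H).coeff j).natDegree ≤ N) (j : ℕ) : (G.coeff j).natDegree ≤ N := by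
  revert j
  rw [← Polynomial.natDegree_swap_le_iff] at hN ⊢
  have hne : Polynomial.Bivariate.swap (G * H) ≠ 0 := by simpa using h0
  rw [map_mul] at hN hne
  rw [Polynomial.natDegree_mul (left_ne_zero_of_mul hne) (right_ne_zero_of_mul hne)] at hN
  omega

theorem Polynomial.eq_prod_subset_of_mul_eq {D ι : Type*} [CommRing D] [IsDomain D]
    (s : Finset ι) (θ : ι → D) (G H : Polynomial D) (hG : G.Monic)
    (h : G * H = ∏ r ∈ s, (Polynomial.X - Polynomial.C (θ r))) :
    ∃ t ⊆ s, G = ∏ r ∈ t, (Polynomial.X - Polynomial.C (θ r)) := by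
  classical
  obtain ⟨t, u, b, c, htu, -, h1, h2, -⟩ := mul_eq_mul_prime_prod (x := G) (y := H)
    (a := 1) (s := s) (p := fun r => Polynomial.X - Polynomial.C (θ r))
    (fun i _ => Polynomial.prime_X_sub_C (θ i)) (by rw [one_mul]; exact h)
  refine ⟨t, htu ▸ Finset.subset_union_left, ?_⟩
  have hb : IsUnit b := IsUnit.of_mul_eq_one _ h1.symm
  have hm : (∏ r ∈ t, (Polynomial.X - Polynomial.C (θ r))).Monic :=
    Polynomial.monic_prod_of_monic _ _ fun i _ => Polynomial.monic_X_sub_C _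
  have hbm : b.Monic := Polynomial.Monic.of_mul_monic_right hm (h2 ▸ hG)
  rw [h2, hbm.eq_one_of_isUnit hb, one_mul]

theorem MvPolynomial.exists_eval_algebraMap_ne_zero {σ K C : Type*} [Finite σ] [Field K]
    [Infinite K]
    [Field C] [Algebra K C] (p : MvPolynomial σ C) (hp : p ≠ 0) :
    ∃ d : σ → K, MvPolynomial.eval (fun i => algebraMap K C (d i)) p ≠ 0 := by
  by_contra! h
  refine hp (MvPolynomial.funext_set (fun _ => Set.range (algebraMap K C))
    (fun _ => Set.infinite_range_of_injective (algebraMap K C).injective) fun x hx => ?_)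
  choose d hd using fun i => hx i trivial
  rw [map_zero, ← h d]
  congr 2
  funext i
  exact (hd i).symm

/-- The substitution `x ↦ a + t d`. -/
noncomputable def lineHom {σ C : Type*} [CommRing C] (a d : σ → C) :
    MvPolynomial σ C →+* Polynomial C :=
  MvPolynomial.eval₂Hom Polynomial.C
    (fun i => Polynomial.C (a i) + Polynomial.C (d i) * Polynomial.X)

theorem Polynomial.exists_map_coe_eq_of_coeff_eq_zero {R : Type*} [CommRing R] [Nontrivial R]
    (g : Polynomial (PowerSeries R)) (hg : g.Monic) (N : ℕ)
    (h : ∀ j k, N < k → PowerSeries.coeff k (g.coeff j) = 0) :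
    ∃ g' : Polynomial (Polynomial R), g'.map Polynomial.coeToPowerSeries.ringHom = g ∧
      g'.natDegree = g.natDegree ∧ g'.Monic := by
  have : g ∈ Polynomial.lifts (Polynomial.coeToPowerSeries.ringHom (R := R)) := by
    rw [Polynomial.lifts_iff_coeff_lifts]
    intro j
    refine ⟨PowerSeries.trunc (N + 1) (g.coeff j), ?_⟩
    ext k
    rw [Polynomial.coeToPowerSeries.ringHom_apply, Polynomial.coeff_coe, PowerSeries.coeff_trunc]
    split_ifs with hk
    · rfl
    · exact (h j k (by omega)).symm
  exact Polynomial.lifts_and_natDegree_eq_and_monic this hg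

/-- An elementary Bertini theorem: an irreducible cover of affine space stays irreducible on
a suitable line through a given point over which it is unramified. -/
theorem Polynomial.exists_irreducible_map_lineHom {σ K C : Type*} [Finite σ] [Field K] [Infinite K]
    [Field C] [IsAlgClosed C] [Algebra K C] (f : Polynomial (MvPolynomial σ C)) (hf : f.Monic)
    (hirr : Irreducible f) (a : σ → C) (hsep : (f.map (MvPolynomial.eval a)).Separable) :
    ∃ d : σ → K, Irreducible (f.map (lineHom a fun i => algebraMap K C (d i))) := by
  classical
  let Λ : (MvPolynomial σ C) →+* Polynomial (MvPolynomial σ C) :=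
      MvPolynomial.eval₂Hom (Polynomial.C.comp MvPolynomial.C)
    (fun i => Polynomial.C (MvPolynomial.C (a i)) + Polynomial.C (MvPolynomial.X i) * Polynomial.X)
  let co : Polynomial (MvPolynomial σ C) →+* PowerSeries (MvPolynomial σ C) :=
      Polynomial.coeToPowerSeries.ringHom
  have hco : Function.Injective co := Polynomial.coe_injective (MvPolynomial σ C)
  let Q : Polynomial (Polynomial (MvPolynomial σ C)) := f.map Λ
  have hQ : Q.Monic := hf.map Λ
  let P : Polynomial (PowerSeries (MvPolynomial σ C)) := Q.map co
  have hP : P.Monic := hQ.map co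
  have hfa : (f.map (MvPolynomial.eval a)).Monic := hf.map _
  have hPc : P.map PowerSeries.constantCoeff =
      (f.map (MvPolynomial.eval a)).map (MvPolynomial.C (σ := σ)) := by
    simp only [P, Q, Polynomial.map_map]
    congr 1
    apply MvPolynomial.ringHom_ext
    · intro r
      simp [Λ, co]
    · intro i
      simp [Λ, co]
  have hCinj : Function.Injective (MvPolynomial.C (σ := σ) (R := C)) := MvPolynomial.C_injective σ C
  let s : Finset (MvPolynomial σ C) := (f.map (MvPolynomial.eval a)).roots.toFinset.image
      (MvPolynomial.C (σ := σ))
  have hscard : s.card = P.natDegree := by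
    rw [Finset.card_image_of_injective _ hCinj,
      Multiset.toFinset_card_of_nodup (Polynomial.nodup_roots hsep),
      IsAlgClosed.card_roots_eq_natDegree, hf.natDegree_map, hQ.natDegree_map co,
      hf.natDegree_map Λ]
  have hroot : ∀ r ∈ s, ∃ c, (f.map (MvPolynomial.eval a)).eval c = 0 ∧ MvPolynomial.C c = r := by
    intro r hr
    obtain ⟨c, hc, rfl⟩ := Finset.mem_image.1 hr
    rw [Multiset.mem_toFinset, Polynomial.mem_roots hfa.ne_zero] at hc
    exact ⟨c, hc, rfl⟩
  obtain ⟨θ, hθ⟩ := PowerSeries.exists_eq_prod_of_simple_roots P hP s hscard (by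
      intro r hr
      obtain ⟨c, hc, rfl⟩ := hroot r hr
      rw [hPc, Polynomial.eval_map_apply, hc, map_zero]) (by
      intro r hr
      obtain ⟨c, hc, rfl⟩ := hroot r hr
      rw [hPc, Polynomial.derivative_map, Polynomial.eval_map_apply]
      refine IsUnit.map _ (IsUnit.mk0 _ fun h => ?_)
      exact hsep.eval₂_derivative_ne_zero (RingHom.id C) hc h)
  let g : Finset (MvPolynomial σ C) → Polynomial (PowerSeries (MvPolynomial σ C)) := fun t =>
    ∏ r ∈ t, (Polynomial.X - Polynomial.C (θ r))
  have hgm : ∀ t, (g t).Monic := fun t =>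
    Polynomial.monic_prod_of_monic _ _ fun i _ => Polynomial.monic_X_sub_C _
  have hgd : ∀ t, (g t).natDegree = t.card := fun t => by
    simp [g, Polynomial.natDegree_prod_of_monic _ (fun r => Polynomial.X - Polynomial.C (θ r))
      fun i _ => Polynomial.monic_X_sub_C _]
  have hn : s.card = f.natDegree := by
    rw [hscard, hQ.natDegree_map co, hf.natDegree_map Λ]
  let N := (Polynomial.Bivariate.swap Q).natDegree
  have hN : ∀ j, (Q.coeff j).natDegree ≤ N := (Polynomial.natDegree_swap_le_iff Q N).1 le_rfl
  -- no proper partial product has polynomial coefficients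
  have hkey : ∀ t ∈ s.powerset, t.Nonempty → t ≠ s →
      ∃ j k, N < k ∧ PowerSeries.coeff k ((g t).coeff j) ≠ 0 := by
    intro t ht hne hts
    rw [Finset.mem_powerset] at ht
    by_contra! hcon
    obtain ⟨g', hg', hg'd, hg'm⟩ :=
      Polynomial.exists_map_coe_eq_of_coeff_eq_zero (g t) (hgm t) N hcon
    have hdvd : g' ∣ Q := by
      rw [← Polynomial.map_dvd_map co hco hg'm]
      change Polynomial.map co g' ∣ P
      rw [hg', hθ]
      exact Finset.prod_dvd_prod_of_subset _ _ _ ht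
    let τ : Polynomial (MvPolynomial σ C) →+* (MvPolynomial σ C) := (MvPolynomial.aeval (R := C)
      (fun i => (MvPolynomial.X i - MvPolynomial.C (a i) : (MvPolynomial σ C)))).toRingHom.comp
          (Polynomial.evalRingHom 1)
    have hτ : Q.map τ = f := by
      simp only [Q, Polynomial.map_map]
      conv_rhs => rw [← Polynomial.map_id (p := f)]
      congr 1
      apply MvPolynomial.ringHom_ext
      · intro r
        simp [Λ, τ, MvPolynomial.algebraMap_eq]
      · intro i
        simp [Λ, τ, MvPolynomial.algebraMap_eq]
    have hdvd' : g'.map τ ∣ f := hτ ▸ Polynomial.map_dvd τ hdvd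
    have hdeg : (g'.map τ).natDegree = t.card := by rw [hg'm.natDegree_map, hg'd, hgd]
    have hlt : t.card < f.natDegree := hn ▸ Finset.card_lt_card (ht.ssubset_of_ne hts)
    obtain ⟨h', hh'⟩ := hdvd'
    have hg'm' := hg'm.map τ
    have hh'm : h'.Monic := hg'm'.of_mul_monic_left (hh' ▸ hf)
    have hd2 : f.natDegree = (g'.map τ).natDegree + h'.natDegree := by
      rw [hh', hg'm'.natDegree_mul hh'm]
    have hpos := hne.card_pos
    rcases hirr.isUnit_or_isUnit hh' with hu | hu
    · have := hg'm'.eq_one_of_isUnit hu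
      rw [this, Polynomial.natDegree_one] at hdeg
      omega
    · have := hh'm.eq_one_of_isUnit hu
      rw [this, Polynomial.natDegree_one] at hd2
      omega
  have hkey' : ∀ t : Finset (MvPolynomial σ C), ∃ c : (MvPolynomial σ C), c ≠ 0 ∧
      (t ∈ s.powerset → t.Nonempty → t ≠ s →
      ∃ j k, N < k ∧ PowerSeries.coeff k ((g t).coeff j) = c) := by
    intro t
    by_cases h : t ∈ s.powerset ∧ t.Nonempty ∧ t ≠ s
    · obtain ⟨j, k, hk, hc⟩ := hkey t h.1 h.2.1 h.2.2
      exact ⟨_, hc, fun _ _ _ => ⟨j, k, hk, rfl⟩⟩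
    · exact ⟨1, one_ne_zero, fun h1 h2 h3 => absurd ⟨h1, h2, h3⟩ h⟩
  choose c hc0 hc using hkey'
  obtain ⟨d, hd⟩ := MvPolynomial.exists_eval_algebraMap_ne_zero (K := K)
    (∏ t ∈ s.powerset, c t) (Finset.prod_ne_zero_iff.2 fun t _ => hc0 t)
  refine ⟨d, ?_⟩
  let ev : (MvPolynomial σ C) →+* C := MvPolynomial.eval fun i => algebraMap K C (d i)
  have hline : f.map (lineHom a fun i => algebraMap K C (d i)) =
      Q.map (Polynomial.mapRingHom ev) := by
    simp only [Q, Polynomial.map_map]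
    congr 1
    apply MvPolynomial.ringHom_ext
    · intro r
      simp [Λ, ev, lineHom]
    · intro i
      simp [Λ, ev, lineHom]
  set L := f.map (lineHom a fun i => algebraMap K C (d i)) with hL
  have hLm : L.Monic := hf.map _
  have hLd : L.natDegree = f.natDegree := hf.natDegree_map _
  have hL1 : L ≠ 1 := by
    intro h
    rw [h, Polynomial.natDegree_one] at hLd
    exact hirr.ne_one (hf.natDegree_eq_zero.1 hLd.symm)
  rw [hLm.irreducible_iff_lt_natDegree_lt hL1]
  rintro G hG hGd ⟨H, hGH⟩
  rw [Finset.mem_Ioc] at hGd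
  have hLc : ∀ j, ((G * H).coeff j).natDegree ≤ N := by
    intro j
    rw [← hGH, hline, Polynomial.coeff_map]
    exact (Polynomial.natDegree_map_le).trans (hN j)
  have hGc := Polynomial.natDegree_coeff_le_of_mul G H (hGH ▸ hLm.ne_zero) N hLc
  let co' : Polynomial C →+* PowerSeries C := Polynomial.coeToPowerSeries.ringHom
  have hcomm : co'.comp (Polynomial.mapRingHom ev) = (PowerSeries.map ev).comp co := by
    apply RingHom.ext
    intro p
    ext k
    simp [co, co']
  have hfac : G.map co' * H.map co' =
      ∏ r ∈ s, (Polynomial.X - Polynomial.C (PowerSeries.map ev (θ r))) := by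
    rw [← Polynomial.map_mul, ← hGH, hline, Polynomial.map_map, hcomm, ← Polynomial.map_map]
    change P.map _ = _
    rw [hθ, Polynomial.map_prod]
    simp
  obtain ⟨t, hts, ht⟩ := Polynomial.eq_prod_subset_of_mul_eq s _ _ _ (hG.map co') hfac
  have hGg : G.map co' = (g t).map (PowerSeries.map ev) := by
    rw [ht, Polynomial.map_prod]
    simp
  have hGdt : G.natDegree = t.card := by
    rw [← hgd, ← (hgm t).natDegree_map (PowerSeries.map ev), ← hGg, hG.natDegree_map]
  obtain ⟨j, k, hk, hck⟩ := hc t (Finset.mem_powerset.2 hts)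
    (Finset.card_pos.1 (by omega)) (by rintro rfl; omega)
  rw [map_prod, Finset.prod_ne_zero_iff] at hd
  refine hd t (Finset.mem_powerset.2 hts) ?_
  have h1 : PowerSeries.coeff k ((G.map co').coeff j) = 0 := by
    rw [Polynomial.coeff_map]
    change PowerSeries.coeff k ((G.coeff j : Polynomial C) : PowerSeries C) = 0
    rw [Polynomial.coeff_coe]
    exact Polynomial.coeff_eq_zero_of_natDegree_lt ((hGc j).trans_lt hk)
  rw [hGg, Polynomial.coeff_map, PowerSeries.coeff_map, hck] at h1
  exact h1

theorem Polynomial.Monic.resultant_derivative_map {R S : Type*} [CommRing R] [Field S] [CharZero S]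
    [IsDomain R] [CharZero R] {f : Polynomial R} (hf : f.Monic) (φ : R →+* S) :
    Polynomial.resultant (f.map φ) (Polynomial.derivative (f.map φ)) =
      φ (Polynomial.resultant f (Polynomial.derivative f)) := by
  rw [← Polynomial.resultant_map_map, Polynomial.natDegree_derivative,
    Polynomial.natDegree_derivative, hf.natDegree_map, Polynomial.derivative_map]

/-- Some rational point avoids the discriminant. -/
theorem Polynomial.exists_separable_map_eval {σ K C : Type*} [Finite σ] [Field K] [Infinite K]
    [Field C] [CharZero C] [Algebra K C] (f : Polynomial (MvPolynomial σ C)) (hf : f.Monic)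
    (hirr : Irreducible f) :
    ∃ a : σ → K, (f.map (MvPolynomial.eval fun i => algebraMap K C (a i))).Separable := by
  have hinj : Function.Injective (algebraMap (MvPolynomial σ C) (FractionRing (MvPolynomial σ
      C))) := IsFractionRing.injective _ _
  have : CharZero (FractionRing (MvPolynomial σ C)) :=
    charZero_of_injective_algebraMap (R := C) (algebraMap C (FractionRing (MvPolynomial σ
        C))).injective
  have hirr' := (hf.irreducible_iff_irreducible_map_fraction_map (K :=
      FractionRing (MvPolynomial σ C))).1 hirr
  have hsep : IsCoprime _ _ := hirr'.separable
  have hres := Polynomial.resultant_ne_zero _ _ hsep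
  rw [hf.resultant_derivative_map] at hres
  obtain ⟨a, ha⟩ := MvPolynomial.exists_eval_algebraMap_ne_zero (K := K)
    (Polynomial.resultant f (Polynomial.derivative f)) (fun h => hres (by rw [h, map_zero]))
  refine ⟨a, ?_⟩
  rw [← hf.resultant_derivative_map] at ha
  exact (Polynomial.isUnit_resultant_iff_isCoprime (hf.map _)).1 (IsUnit.mk0 _ ha)

/-- If `K` is algebraically closed in `E`, a monic irreducible polynomial over `K` stays
irreducible over `E`. -/
theorem Polynomial.Monic.irreducible_map_of_isIntegrallyClosedIn {K E : Type*} [Field K] [Field E]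
    [Algebra K E] [IsIntegrallyClosedIn K E] {p : Polynomial K} (hp : p.Monic)
    (hirr : Irreducible p) : Irreducible (p.map (algebraMap K E)) := by
  have lift : ∀ g : Polynomial E, g.Monic → g ∣ p.map (algebraMap K E) →
      ∃ g' : Polynomial K, g'.Monic ∧ g'.map (algebraMap K E) = g := by
    intro g hg hd
    have h1 := integralClosure.mem_lifts_of_monic_of_dvd_map E hp hg hd
    have h2 : g ∈ Polynomial.lifts (algebraMap K E) := by
      rw [Polynomial.lifts_iff_coeff_lifts] at h1 ⊢
      intro n
      obtain ⟨y, hy⟩ := h1 n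
      obtain ⟨z, hz⟩ := IsIntegrallyClosedIn.isIntegral_iff.1 y.2
      exact ⟨z, hz.trans hy⟩
    obtain ⟨g', h, -, h'⟩ := Polynomial.lifts_and_degree_eq_and_monic h2 hg
    exact ⟨g', h', h⟩
  have hne : p.map (algebraMap K E) ≠ 1 := by
    intro h
    rw [← Polynomial.map_one (algebraMap K E)] at h
    exact hirr.ne_one (Polynomial.map_injective _ (algebraMap K E).injective h)
  rw [(hp.map _).irreducible_iff_natDegree' ]
  refine ⟨hne, fun f g hf hg hfg hdeg => ?_⟩
  obtain ⟨f', hf', rfl⟩ := lift f hf ⟨g, hfg.symm⟩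
  obtain ⟨g', hg', rfl⟩ := lift g hg ⟨f'.map _, by rw [← hfg, mul_comm]⟩
  rw [Polynomial.natDegree_map, Polynomial.natDegree_map] at hdeg
  rw [← Polynomial.map_mul] at hfg
  exact ((hp.irreducible_iff_natDegree').1 hirr).2 f' g' hf' hg'
    (Polynomial.map_injective _ (algebraMap K E).injective hfg) hdeg

/-- If `K` is algebraically closed in `E`, then `E` is linearly disjoint from any algebraic
extension of `K`. -/
theorem IsIntegrallyClosedIn.linearDisjoint {K E C L : Type*} [Field K] [CharZero K] [Field E]
    [Field C] [Field L] [Algebra K E] [Algebra K C] [Algebra K L] [IsIntegrallyClosedIn K E]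
    [Algebra.IsAlgebraic K C] (fa : E →ₐ[K] L) (fb : C →ₐ[K] L) :
    fa.fieldRange.LinearDisjoint fb.fieldRange := by
  have hA : IsIntegrallyClosedIn K fa.fieldRange := by
    have e : E ≃ₐ[K] fa.fieldRange := AlgEquiv.ofInjectiveField fa
    rw [isIntegrallyClosedIn_iff]
    refine ⟨(algebraMap K _).injective, fun {x} hx => ?_⟩
    obtain ⟨y, hy⟩ := IsIntegrallyClosedIn.isIntegral_iff.1 (hx.map e.symm)
    exact ⟨y, by rw [← e.apply_symm_apply x, ← hy, e.commutes]⟩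
  have hB : Algebra.IsAlgebraic K fb.fieldRange :=
    (AlgEquiv.ofInjectiveField fb).isAlgebraic
  rw [IntermediateField.linearDisjoint_iff']
  have : Algebra.IsIntegral K fb.fieldRange.toSubalgebra :=
    inferInstanceAs (Algebra.IsIntegral K fb.fieldRange)
  refine Subalgebra.LinearDisjoint.of_linearDisjoint_finite_right _ _ fun B hB hfin => ?_
  let B' : IntermediateField K L := Subalgebra.toIntermediateField' B
    (Algebra.IsIntegral.isField_iff_isField (algebraMap K B).injective |>.1 (Field.toIsField K))
  have hfin' : FiniteDimensional K B' := hfin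
  obtain ⟨β, hβ⟩ := Field.exists_primitive_element K B'
  change fa.fieldRange.toSubalgebra.LinearDisjoint B'.toSubalgebra
  rw [← IntermediateField.linearDisjoint_iff']
  let pb := Field.powerBasisOfFiniteOfSeparable K B'
  refine IntermediateField.LinearDisjoint.of_basis_right pb.basis ?_
  have hθint : IsIntegral K (pb.gen : L) := (Algebra.IsIntegral.isIntegral pb.gen).map B'.val
  have h1 := ((minpoly.monic hθint).irreducible_map_of_isIntegrallyClosedIn
    (E := fa.fieldRange) (minpoly.irreducible hθint))
  have h2 := minpoly.eq_of_irreducible_of_monic h1 (x := (pb.gen : L)) (by simp)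
    ((minpoly.monic hθint).map _)
  have h3 : (minpoly fa.fieldRange (pb.gen : L)).natDegree = pb.dim := by
    rw [← h2, Polynomial.natDegree_map, ← pb.natDegree_minpoly]
    congr 1
    exact (minpoly.algebraMap_eq (algebraMap B' L).injective pb.gen)
  have h4 := linearIndependent_pow (K := fa.fieldRange) (pb.gen : L)
  have h5 : B'.val ∘ pb.basis = fun i : Fin pb.dim => (pb.gen : L) ^ (i : ℕ) := by
    ext i; simp
  rw [h5]
  exact h3 ▸ h4

/-- If `K` is algebraically closed in `E` and `C` is algebraic over `K`, then `E ⊗[K] C` is a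
field. -/
theorem IsIntegrallyClosedIn.isField_tensorProduct (K E C : Type*) [Field K] [CharZero K] [Field E]
    [Field C] [Algebra K E] [Algebra K C] [IsIntegrallyClosedIn K E]
    [Algebra.IsAlgebraic K C] : IsField (E ⊗[K] C) :=
  IntermediateField.LinearDisjoint.isField_of_forall K E C
    fun _ _ _ fa fb => IsIntegrallyClosedIn.linearDisjoint fa fb

/-- If `θ : E` satisfies no monic equation over `A` of degree less than that of `f`, and `K` is
algebraically closed in `E`, then `f` is irreducible over `C ⊗[K] A` for any algebraic
extension `C` of `K`. -/
theorem IsIntegrallyClosedIn.irreducible_map_includeRight {K C A E : Type*} [Field K] [CharZero K]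
    [Field C] [Field E] [CommRing A] [Algebra K C] [Algebra.IsAlgebraic K C] [Algebra K A]
    [Algebra K E] [Algebra A E] [IsScalarTower K A E] [IsIntegrallyClosedIn K E]
    [IsDomain (C ⊗[K] A)] (f : Polynomial A) (hf : f.Monic) (hf0 : f.natDegree ≠ 0) (θ : E)
    (hθ : Polynomial.aeval θ f = 0)
    (hmin : ∀ g : Polynomial A, g.Monic → Polynomial.aeval θ g = 0 → f.natDegree ≤ g.natDegree) :
    Irreducible (f.map (Algebra.TensorProduct.includeRight : A →ₐ[K] C ⊗[K] A).toRingHom) := by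
  have hdom : IsDomain (C ⊗[K] E) := by
    have := (IsIntegrallyClosedIn.isField_tensorProduct K E C).isDomain
    exact (Algebra.TensorProduct.comm K C E).toMulEquiv.isDomain
  obtain ⟨l, hl⟩ : ∃ l : C →ₗ[K] K, l 1 = 1 := by
    obtain ⟨l, hl⟩ := LinearMap.exists_leftInverse_of_injective (Algebra.linearMap K C)
      (LinearMap.ker_eq_bot.2 (algebraMap K C).injective)
    exact ⟨l, by simpa using LinearMap.congr_fun hl 1⟩
  let lA : C ⊗[K] A →ₗ[K] A := (TensorProduct.lid K A).toLinearMap ∘ₗ l.rTensor A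
  let lE : C ⊗[K] E →ₗ[K] E := (TensorProduct.lid K E).toLinearMap ∘ₗ l.rTensor E
  let ev : C ⊗[K] A →ₐ[K] C ⊗[K] E :=
    Algebra.TensorProduct.map (AlgHom.id K C) (IsScalarTower.toAlgHom K A E)
  have hcompat : ∀ s u, lE (ev s * (1 ⊗ₜ u)) = algebraMap A E (lA s) * u := by
    intro s u
    induction s with
    | zero => simp
    | add x y hx hy => simp only [map_add, add_mul, hx, hy]
    | tmul c a =>
      simp [ev, lE, lA, Algebra.smul_def, mul_assoc, ← IsScalarTower.algebraMap_apply K A E]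
  have key : ∀ g : Polynomial (C ⊗[K] A), g.Monic → g.natDegree < f.natDegree →
      Polynomial.eval₂ ev.toRingHom (1 ⊗ₜ θ) g ≠ 0 := by
    intro g hg hlt h0
    let G : Polynomial A := ∑ i ∈ Finset.range (g.natDegree + 1),
        Polynomial.monomial i (lA (g.coeff i))
    have hlA1 : lA 1 = 1 := by simp [lA, Algebra.TensorProduct.one_def, hl]
    have hG : G.Monic ∧ G.natDegree ≤ g.natDegree := by
      have hdeg : G.natDegree ≤ g.natDegree := by
        refine Polynomial.natDegree_sum_le_of_forall_le _ _ fun i hi => ?_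
        exact (Polynomial.natDegree_monomial_le _).trans (Nat.lt_succ_iff.1 (Finset.mem_range.1 hi))
      refine ⟨Polynomial.monic_of_natDegree_le_of_coeff_eq_one _ hdeg ?_, hdeg⟩
      simp [G, Polynomial.coeff_monomial, hg.coeff_natDegree, hlA1]
    have hG0 : Polynomial.aeval θ G = 0 := by
      have h1 := congrArg lE h0
      rw [Polynomial.eval₂_eq_sum_range, map_sum, map_zero] at h1
      rw [← h1, map_sum]
      refine Finset.sum_congr rfl fun i _ => ?_
      rw [Algebra.TensorProduct.tmul_pow, one_pow, Polynomial.aeval_monomial]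
      exact (hcompat _ _).symm
    exact absurd (hmin G hG.1 hG0) (by omega)
  have hf' := hf.map (Algebra.TensorProduct.includeRight : A →ₐ[K] C ⊗[K] A).toRingHom
  have hnd : (f.map (Algebra.TensorProduct.includeRight : A →ₐ[K] C ⊗[K] A).toRingHom).natDegree
      = f.natDegree := hf.natDegree_map _
  have h0 : Polynomial.eval₂ ev.toRingHom (1 ⊗ₜ θ)
      (f.map (Algebra.TensorProduct.includeRight : A →ₐ[K] C ⊗[K] A).toRingHom) = 0 := by
    rw [Polynomial.eval₂_map]
    have : ev.toRingHom.comp (Algebra.TensorProduct.includeRight : A →ₐ[K] C ⊗[K] A).toRingHom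
        = (Algebra.TensorProduct.includeRight : E →ₐ[K] C ⊗[K] E).toRingHom.comp (algebraMap A E)
            := by
      ext a; simp [ev]
    rw [this]
    have h2 := Polynomial.hom_eval₂ f (algebraMap A E)
      (Algebra.TensorProduct.includeRight : E →ₐ[K] C ⊗[K] E).toRingHom θ
    rw [← Polynomial.aeval_def, hθ, map_zero] at h2
    exact h2.symm
  rw [hf'.irreducible_iff_natDegree']
  refine ⟨fun h => hf0 (by rw [← hnd, h, Polynomial.natDegree_one]), fun g h hg hh hgh hd => ?_⟩
  rw [hnd, Finset.mem_Ioc] at hd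
  rw [← hgh, Polynomial.eval₂_mul] at h0
  have hsum : g.natDegree + h.natDegree = f.natDegree := by
    rw [← hnd, ← hgh, hg.natDegree_mul hh]
  rcases mul_eq_zero.1 h0 with h0 | h0
  · exact key g hg (by omega) h0
  · exact key h hh (by omega) h0

/-- The version of `IsIntegrallyClosedIn.irreducible_map_includeRight` for polynomial rings. -/
theorem IsIntegrallyClosedIn.irreducible_map_mvPolynomial {K C σ E : Type*} [Field K] [CharZero K]
    [Field C] [Field E] [Algebra K C] [Algebra.IsAlgebraic K C]
    [Algebra K E] [Algebra (MvPolynomial σ K) E] [IsScalarTower K (MvPolynomial σ K) E]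
    [IsIntegrallyClosedIn K E]
    (f : Polynomial (MvPolynomial σ K)) (hf : f.Monic) (hf0 : f.natDegree ≠ 0) (θ : E)
    (hθ : Polynomial.aeval θ f = 0)
    (hmin : ∀ g : Polynomial (MvPolynomial σ K), g.Monic → Polynomial.aeval θ g = 0 →
      f.natDegree ≤ g.natDegree) :
    Irreducible (f.map (MvPolynomial.map (algebraMap K C))) := by
  let e := MvPolynomial.algebraTensorAlgEquiv (σ := σ) K C
  have : IsDomain (C ⊗[K] MvPolynomial σ K) := e.toMulEquiv.isDomain
  have h := IsIntegrallyClosedIn.irreducible_map_includeRight (K := K) (C := C) f hf hf0 θ hθ hmin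
  convert (MulEquiv.irreducible_iff (Polynomial.mapEquiv e.toRingEquiv)).2 h using 1
  rw [Polynomial.mapEquiv_apply, Polynomial.map_map]
  congr 1
  ext <;> simp [e]

theorem isIntegrallyClosedIn_of_isUnit {K A L : Type*} [Field K] [CommRing A]
    [IsIntegrallyClosed A] [Field L] [Algebra K A] [Algebra A L] [Algebra K L]
    [IsScalarTower K A L] [IsFractionRing A L] (h : ∀ a : A, IsUnit a → ∃ c, algebraMap K A c = a) :
    IsIntegrallyClosedIn K L := by
  rw [isIntegrallyClosedIn_iff]
  refine ⟨(algebraMap K L).injective, fun {x} hx => ?_⟩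
  rcases eq_or_ne x 0 with rfl | hx0
  · exact ⟨0, map_zero _⟩
  have hx' : IsIntegral K x⁻¹ := hx.inv
  obtain ⟨a, rfl⟩ := IsIntegrallyClosed.isIntegral_iff.1 (hx.tower_top (A := A))
  obtain ⟨b, hb⟩ := IsIntegrallyClosed.isIntegral_iff.1 (hx'.tower_top (A := A))
  have hab : a * b = 1 := by
    apply IsFractionRing.injective A L
    rw [map_mul, hb, map_one, mul_inv_cancel₀ hx0]
  obtain ⟨c, hc⟩ := h a (.of_mul_eq_one _ hab)
  exact ⟨c, by rw [← hc, IsScalarTower.algebraMap_apply K A L]⟩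

instance MvPolynomial.isIntegrallyClosedIn_fractionRing (K σ : Type*) [Field K] :
    IsIntegrallyClosedIn K (FractionRing (MvPolynomial σ K)) :=
  isIntegrallyClosedIn_of_isUnit (A := MvPolynomial σ K) fun a ha => by
    obtain ⟨c, -, hc⟩ := MvPolynomial.isUnit_iff_eq_C_of_isReduced.1 ha
    exact ⟨c, hc.symm⟩

/-- Every finite group is the Galois group of an extension `M/Ω` of overfields of `K` such that
`K` is algebraically closed in `M`. -/
theorem exists_isGalois_mulEquiv_isIntegrallyClosedIn (K G : Type) [Field K] [Group G] [Finite G] :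
    ∃ (M : Type) (_ : Field M) (_ : Algebra K M) (Ω : IntermediateField K M),
      FiniteDimensional Ω M ∧ IsGalois Ω M ∧ Nonempty ((M ≃ₐ[Ω] M) ≃* G) ∧
      IsIntegrallyClosedIn K M := by
  let ρ₀ : G →* (MvPolynomial G K ≃ₐ[K] MvPolynomial G K) :=
    { toFun := fun g => MvPolynomial.renameEquiv K (Equiv.mulLeft g)
      map_one' := by
        apply AlgEquiv.coe_toAlgHom_injective
        ext; simp
      map_mul' := fun g h => by
        apply AlgEquiv.coe_toAlgHom_injective
        ext; simp [mul_assoc] }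
  let ρ := (IsFractionRing.fieldEquivOfAlgEquivHom K (FractionRing (MvPolynomial G K))).comp ρ₀
  let : MulSemiringAction G (FractionRing (MvPolynomial G K)) :=
    MulSemiringAction.compHom _ ρ
  have hsmul : ∀ g x, g • x = ρ g x := fun _ _ => rfl
  have : SMulCommClass G K (FractionRing (MvPolynomial G K)) :=
    ⟨fun g c x => by rw [hsmul, hsmul, map_smul]⟩
  have hρ : Function.Injective ρ := by
    intro g h hgh
    have h1 := DFunLike.congr_fun (IsFractionRing.fieldEquivOfAlgEquivHom_injective K
      (MvPolynomial G K) K (FractionRing (MvPolynomial G K)) hgh) (MvPolynomial.X 1)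
    simpa [ρ₀] using h1
  have : FaithfulSMul G (FractionRing (MvPolynomial G K)) :=
    ⟨fun {g h} hgh => hρ (AlgEquiv.ext hgh)⟩
  let Ω : IntermediateField K (FractionRing (MvPolynomial G K)) := FixedPoints.intermediateField G
  have hgal : IsGaloisGroup G Ω (FractionRing (MvPolynomial G K)) :=
    { faithful := inferInstance
      commutes := ⟨fun g c x => by
        change g • ((c : FractionRing (MvPolynomial G K)) * x) = c * g • x
        rw [smul_mul', c.2 g]⟩
      isInvariant := ⟨fun b hb => ⟨⟨b, hb⟩, rfl⟩⟩ }
  exact ⟨_, _, _, Ω, IsGaloisGroup.finiteDimensional G _ _, IsGaloisGroup.isGalois G _ _,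
    ⟨(IsGaloisGroup.mulEquivAlgEquiv G _ _).symm⟩, inferInstance⟩

/-- If `E/F` specializes to `M/Ω` with `K` algebraically closed in `M`, then `K` is algebraically
closed in `E`. -/
theorem IsSpecialization.isIntegrallyClosedIn {K F E Ω M : Type} [Field K] [Field F]
    [Field E] [Field Ω] [Field M] [Algebra K F] [Algebra F E] [Algebra K Ω] [Algebra Ω M]
    [Algebra K E] [IsScalarTower K F E] [Algebra K M] [IsScalarTower K Ω M]
    (h : IsSpecialization K F E Ω M) [IsIntegrallyClosedIn K M] : IsIntegrallyClosedIn K E := by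
  obtain ⟨A, -, -, -, ψ, -, m, -, ⟨e⟩⟩ := h
  let : Algebra A E := ((algebraMap F E).comp (algebraMap A F)).toAlgebra
  let : Algebra A Ω := ψ.toRingHom.toAlgebra
  have : @IsScalarTower K A E Algebra.toSMul Algebra.toSMul Algebra.toSMul :=
    IsScalarTower.of_algebraMap_eq (R := K) (S := A) (A := E) fun x => by
      rw [IsScalarTower.algebraMap_apply K F E]; rfl
  rw [isIntegrallyClosedIn_iff]
  refine ⟨(algebraMap K E).injective, fun {x} hx => ?_⟩
  let b : integralClosure A E := ⟨x, hx.tower_top⟩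
  let χ : integralClosure A E →+* M := e.toRingEquiv.toRingHom.comp
    ((Ideal.Quotient.mk m).comp
      (Algebra.TensorProduct.includeRight : _ →ₐ[A] Ω ⊗[A] (integralClosure A E)).toRingHom)
  have hχ : ∀ c : K, χ (algebraMap A _ (algebraMap K A c)) = algebraMap K M c := by
    intro c
    have h1 : (Algebra.TensorProduct.includeRight : _ →ₐ[A] Ω ⊗[A] (integralClosure A E))
        (algebraMap A _ (algebraMap K A c)) = algebraMap Ω _ (algebraMap K Ω c) := by
      rw [AlgHom.commutes, IsScalarTower.algebraMap_apply A Ω (Ω ⊗[A] (integralClosure A E))]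
      congr 1
      exact ψ.commutes c
    change e (Ideal.Quotient.mk m (Algebra.TensorProduct.includeRight _)) = _
    rw [h1]
    rw [IsScalarTower.algebraMap_apply K Ω M, ← e.commutes]
    rfl
  have hb : Polynomial.eval₂ ((algebraMap A (integralClosure A E)).comp (algebraMap K A)) b
      (minpoly K x) = 0 := by
    apply Subtype.val_injective
    have := Polynomial.hom_eval₂ (minpoly K x)
      ((algebraMap A (integralClosure A E)).comp (algebraMap K A))
      (integralClosure A E).val.toRingHom b
    refine this.trans ?_
    have h2 := minpoly.aeval K x
    rw [Polynomial.aeval_def, IsScalarTower.algebraMap_eq K A E] at h2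
    exact h2
  have hroot : Polynomial.aeval (χ b) (minpoly K x) = 0 := by
    have h3 := Polynomial.hom_eval₂ (minpoly K x)
      ((algebraMap A (integralClosure A E)).comp (algebraMap K A)) χ b
    rw [hb, map_zero] at h3
    rw [h3, Polynomial.aeval_def]
    congr 1
    ext c
    exact (hχ c).symm
  obtain ⟨c, hc⟩ := IsIntegrallyClosedIn.isIntegral_iff.1
    (show IsIntegral K (χ b) from ⟨_, minpoly.monic hx, hroot⟩)
  rw [← hc, Polynomial.aeval_algebraMap_apply, map_eq_zero] at hroot
  have hdeg := Polynomial.degree_eq_one_of_irreducible_of_root (minpoly.irreducible hx)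
    (by simpa using hroot)
  exact minpoly.mem_range_of_degree_eq_one K x hdeg

theorem Polynomial.eq_zero_of_eval₂_eq_zero_of_irreducible {F L : Type*} [Field F] [CommRing L]
    [Nontrivial L] (ι : F →+* L) {q s : Polynomial F} (hirr : Irreducible q) {θ : L}
    (hq : q.eval₂ ι θ = 0) (hs : s.eval₂ ι θ = 0) (hdeg : s.degree < q.degree) : s = 0 := by
  rcases hirr.isCoprime_or_dvd s with ⟨a, b, hab⟩ | h
  · have := congrArg (Polynomial.eval₂ ι θ) hab
    simp [Polynomial.eval₂_add, Polynomial.eval₂_mul, hq, hs] at this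
  · by_contra hs0
    exact absurd (Polynomial.degree_le_of_dvd h hs0) (not_le.2 hdeg)

open Polynomial in
/-- If a generator of `E/K(t)` has a minimal polynomial which is irreducible over `C[t]`, with `C`
an algebraic closure of `K`, then `K` is algebraically closed in `E`. -/
theorem isIntegrallyClosedIn_of_irreducible_map_algebraicClosure {K E : Type*} [Field K] [Field E]
    [Algebra (FractionRing K[X]) E] [Algebra K E] [IsScalarTower K (FractionRing K[X]) E]
    [FiniteDimensional (FractionRing K[X]) E] (f : Polynomial K[X]) (hf : f.Monic)
    (hirr : Irreducible (f.map (Polynomial.mapRingHom (algebraMap K (AlgebraicClosure K)))))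
    (θ : E) (hθ : f.eval₂ ((algebraMap (FractionRing K[X]) E).comp (algebraMap K[X] _)) θ = 0)
    (hdeg : f.natDegree = Module.finrank (FractionRing K[X]) E) :
    IsIntegrallyClosedIn K E := by
  let D := AlgebraicClosure K
  let Ψ := AlgebraicClosure E
  have : FaithfulSMul K Ψ := inferInstance
  let j : D →ₐ[K] Ψ := IsAlgClosed.lift
  let t : Ψ := algebraMap E Ψ (algebraMap (FractionRing K[X]) E (algebraMap K[X] _ X))
  -- the embedding of `C(t)`
  have ht : Transcendental K t := by
    rw [transcendental_iff_injective]
    have : ((aeval t : K[X] →ₐ[K] Ψ) : K[X] →+* Ψ) = (algebraMap E Ψ).comp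
        ((algebraMap (FractionRing K[X]) E).comp (algebraMap K[X] _)) := by
      apply Polynomial.ringHom_ext
      · intro c
        simp only [RingHom.coe_coe, aeval_C, RingHom.comp_apply]
        rw [IsScalarTower.algebraMap_apply K E Ψ, IsScalarTower.algebraMap_apply K
            (FractionRing K[X]) E,
          IsScalarTower.algebraMap_apply K K[X] (FractionRing K[X])]
        rfl
      · simp [t]
    change Function.Injective ((aeval t : K[X] →ₐ[K] Ψ) : K[X] →+* Ψ)
    rw [this]
    rw [RingHom.coe_comp, RingHom.coe_comp]
    exact (algebraMap E Ψ).injective.comp ((algebraMap _ E).injective.comp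
      (IsFractionRing.injective K[X] (FractionRing K[X])))
  let χ : D[X] →+* Ψ := eval₂RingHom j.toRingHom t
  have hχ : Function.Injective χ := by
    let : Algebra D Ψ := j.toRingHom.toAlgebra
    have : IsScalarTower K D Ψ := .of_algebraMap_eq fun x => (j.commutes x).symm
    have h1 : Transcendental D t := by
      intro h
      exact ht (h.restrictScalars K)
    exact (transcendental_iff_injective.1 h1)
  let ι : FractionRing D[X] →+* Ψ := IsFractionRing.lift hχ
  have hmapinj : Function.Injective (mapRingHom (algebraMap K D)) :=
    Polynomial.map_injective _ (algebraMap K D).injective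
  let κ : FractionRing K[X] →+* FractionRing D[X] :=
    IsFractionRing.lift (g := (algebraMap D[X] (FractionRing D[X])).comp
      (mapRingHom (algebraMap K D)))
      (by rw [RingHom.coe_comp]; exact (IsFractionRing.injective D[X] _).comp hmapinj)
  have hκ : ∀ p : K[X], κ (algebraMap _ _ p) = algebraMap _ _ (p.map (algebraMap K D)) := fun p =>
    IsFractionRing.lift_algebraMap _ _
  have hι : ∀ p : D[X], ι (algebraMap _ _ p) = χ p := fun p => IsFractionRing.lift_algebraMap _ _
  have hικ : ι.comp κ = (algebraMap E Ψ).comp (algebraMap (FractionRing K[X]) E) := by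
    apply IsLocalization.ringHom_ext (nonZeroDivisors K[X])
    apply Polynomial.ringHom_ext
    · intro c
      simp only [RingHom.comp_apply, hκ, hι, map_C]
      have h1 : (algebraMap K[X] (FractionRing K[X])) (C c) = algebraMap K _ c := by
        rw [IsScalarTower.algebraMap_apply K K[X] (FractionRing K[X])]; rfl
      rw [h1, ← IsScalarTower.algebraMap_apply K (FractionRing K[X]) E,
        ← IsScalarTower.algebraMap_apply K E Ψ, ← j.commutes]
      simp [χ]
    · simp only [RingHom.comp_apply, hκ, hι, map_X]
      simp [χ, t]
  have hθC : ((f.map (mapRingHom (algebraMap K D))).map (algebraMap D[X] (FractionRing D[X]))).eval₂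
      ι (algebraMap E Ψ θ) = 0 := by
    have h1 := congrArg (algebraMap E Ψ) hθ
    rw [hom_eval₂, map_zero, ← RingHom.comp_assoc, ← hικ] at h1
    rw [eval₂_map, eval₂_map, ← h1]
    congr 1
    exact RingHom.ext fun p => by simp [hκ]
  have hirr' : Irreducible ((f.map (mapRingHom (algebraMap K D))).map
      (algebraMap D[X] (FractionRing D[X]))) :=
    ((hf.map _).irreducible_iff_irreducible_map_fraction_map).1 hirr
  have hirrK : Irreducible (f.map (algebraMap K[X] (FractionRing K[X]))) :=
    (hf.irreducible_iff_irreducible_map_fraction_map).1 (hf.irreducible_of_irreducible_map _ _ hirr)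
  have hθint : IsIntegral (FractionRing K[X]) θ := Algebra.IsIntegral.isIntegral θ
  have hmin : f.map (algebraMap K[X] (FractionRing K[X])) = minpoly (FractionRing K[X]) θ :=
    minpoly.eq_of_irreducible_of_monic hirrK (by rw [aeval_def, eval₂_map]; exact hθ) (hf.map _)
  have hgen : IntermediateField.adjoin (FractionRing K[X]) {θ} = ⊤ := by
    rw [Field.primitive_element_iff_minpoly_natDegree_eq, ← hmin, hf.natDegree_map, hdeg]
  rw [isIntegrallyClosedIn_iff]
  refine ⟨(algebraMap K E).injective, fun {α} hα => ?_⟩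
  obtain ⟨r, hr, hrdeg⟩ : ∃ r : Polynomial (FractionRing K[X]), aeval θ r = α ∧
      r.degree < f.degree := by
    have h1 : α ∈ IntermediateField.adjoin (FractionRing K[X]) {θ} :=
        hgen ▸ IntermediateField.mem_top
    rw [← IntermediateField.mem_toSubalgebra,
      IntermediateField.adjoin_simple_toSubalgebra_of_isAlgebraic hθint.isAlgebraic,
      Algebra.adjoin_singleton_eq_range_aeval] at h1
    obtain ⟨r, hr⟩ := h1
    refine ⟨r %ₘ (f.map (algebraMap K[X] _)), ?_, ?_⟩
    · rw [Polynomial.aeval_modByMonic_eq_self_of_root (by rw [hmin, minpoly.aeval])]; exact hr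
    · rw [← hf.degree_map (algebraMap K[X] (FractionRing K[X]))]
      exact Polynomial.degree_modByMonic_lt _ (hf.map _)
  obtain ⟨c, hc⟩ : ∃ c : D, j c = algebraMap E Ψ α := by
    let : Algebra D Ψ := j.toRingHom.toAlgebra
    have : IsScalarTower K D Ψ := .of_algebraMap_eq fun x => (j.commutes x).symm
    have hα' : IsIntegral D (algebraMap E Ψ α) := (hα.map (IsScalarTower.toAlgHom K E Ψ)).tower_top
    exact minpoly.mem_range_of_degree_eq_one D _
      (IsAlgClosed.degree_eq_one_of_irreducible D (minpoly.irreducible hα'))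
  have hs := Polynomial.eq_zero_of_eval₂_eq_zero_of_irreducible ι hirr' hθC
    (s := r.map κ - C (algebraMap D[X] (FractionRing D[X]) (C c))) (by
      rw [eval₂_sub, eval₂_map, hικ, eval₂_C, hι]
      have h1 := congrArg (algebraMap E Ψ) hr
      rw [aeval_def, hom_eval₂] at h1
      rw [h1, ← hc]
      simp [χ]) (by
      rw [(hf.map _).degree_map, hf.degree_map]
      refine (degree_sub_le _ _).trans_lt (max_lt ((degree_map_le).trans_lt hrdeg) ?_)
      refine (degree_C_le).trans_lt ?_
      rw [degree_eq_natDegree hf.ne_zero, hdeg]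
      exact_mod_cast Module.finrank_pos)
  have hr0 : r = C (r.coeff 0) := by
    apply Polynomial.map_injective κ κ.injective
    rw [sub_eq_zero] at hs
    have := congrArg (fun p => p.coeff 0) hs
    simp only [coeff_map, coeff_C_zero] at this
    rw [hs, map_C, this]
  have hα1 : α = algebraMap (FractionRing K[X]) E (r.coeff 0) := by
    rw [← hr]; conv_lhs => rw [hr0]
    simp
  have : IsIntegrallyClosedIn K (FractionRing K[X]) :=
    isIntegrallyClosedIn_of_isUnit (A := K[X]) fun a ha => by
      obtain ⟨c, -, hc⟩ := Polynomial.isUnit_iff.1 ha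
      exact ⟨c, hc⟩
  rw [hα1, isIntegral_algebraMap_iff (algebraMap (FractionRing K[X]) E).injective] at hα
  obtain ⟨y, hy⟩ := IsIntegrallyClosedIn.isIntegral_iff.1 hα
  exact ⟨y, by rw [hα1, ← hy, ← IsScalarTower.algebraMap_apply]⟩

open Pointwise in
/-- Hilbert-style specialization: if a group `G` acts on `B` with invariants `A`, and the
polynomial of a generator stays irreducible along `φ : A →+* R`, then `G` is a Galois group over
the fraction field of `R`. -/
theorem exists_isGalois_of_isInvariant_of_irreducible_map {A B R G : Type} [CommRing A]
    [CommRing B] [Algebra A B] [FaithfulSMul A B] [Group G] [Finite G] [MulSemiringAction G B]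
    [SMulCommClass G A B] [Algebra.IsInvariant A B G] [CommRing R] [IsDomain R] [CharZero R]
    (φ : A →+* R) (hφ : Function.Surjective φ) (θ : B) (f : Polynomial A) (hf : f.Monic)
    (hθ : Polynomial.aeval θ f = 0)
    (hirr : Irreducible ((f.map φ).map (algebraMap R (FractionRing R))))
    (hdeg : f.natDegree = Nat.card G) :
    ∃ (E : Type) (_ : Field E) (_ : Algebra (FractionRing R) E) (θ₁ : E),
      FiniteDimensional (FractionRing R) E ∧ IsGalois (FractionRing R) E ∧
      Nonempty ((E ≃ₐ[FractionRing R] E) ≃* G) ∧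
      (f.map φ).eval₂ ((algebraMap (FractionRing R) E).comp (algebraMap R _)) θ₁ = 0 ∧
      f.natDegree = Module.finrank (FractionRing R) E := by
  let P := RingHom.ker φ
  have hP : P.IsPrime := RingHom.ker_isPrime φ
  have : Algebra.IsIntegral A B := Algebra.IsInvariant.isIntegral A B G
  obtain ⟨⟨Q, hQ, hQP⟩⟩ := Ideal.nonempty_primesOver (S := B) P
  let e : (A ⧸ P) ≃+* R := RingHom.quotientKerEquivOfSurjective hφ
  have he : ∀ a : A, e (Ideal.Quotient.mk P a) = φ a := fun a =>
    RingHom.quotientKerEquivOfSurjective_apply_mk hφ a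
  let : Algebra (A ⧸ P) (FractionRing R) :=
    ((algebraMap R (FractionRing R)).comp e.toRingHom).toAlgebra
  have halg : ∀ x : A ⧸ P, algebraMap (A ⧸ P) (FractionRing R) x = algebraMap R _ (e x) :=
    fun x => rfl
  have : FaithfulSMul (A ⧸ P) (FractionRing R) :=
    (faithfulSMul_iff_algebraMap_injective _ _).2 fun x y hxy =>
      e.injective (IsFractionRing.injective R (FractionRing R) hxy)
  have hfr : IsFractionRing (A ⧸ P) (FractionRing R) := by
    refine IsFractionRing.of_field _ _ fun z => ?_
    obtain ⟨x, y, hy, rfl⟩ := IsFractionRing.div_surjective R z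
    exact ⟨e.symm x, e.symm y, by simp [halg]⟩
  let E := FractionRing (B ⧸ Q)
  let : Algebra (FractionRing R) E :=
    (IsFractionRing.lift (A := A ⧸ P) (K := FractionRing R) (g := algebraMap (A ⧸ P) E)
      (FaithfulSMul.algebraMap_injective _ _)).toAlgebra
  have hst : IsScalarTower (A ⧸ P) (FractionRing R) E := by
    refine .of_algebraMap_eq fun x => ?_
    rw [RingHom.algebraMap_toAlgebra (IsFractionRing.lift _)]
    exact (IsFractionRing.lift_algebraMap _ _).symm
  have : CharZero (FractionRing R) := inferInstance
  have hn : Normal (FractionRing R) E := Ideal.IsFractionRing.normal G P Q _ _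
  have hfin : FiniteDimensional (FractionRing R) E :=
    Ideal.IsFractionRing.finite_of_isInvariant G P Q _ _
  have hgal : IsGalois (FractionRing R) E := {}
  let θ₁ : E := algebraMap (B ⧸ Q) E (Ideal.Quotient.mk Q θ)
  have hroot : (f.map φ).eval₂ ((algebraMap (FractionRing R) E).comp (algebraMap R _)) θ₁ = 0 := by
    have h1 := congrArg (algebraMap (B ⧸ Q) E) (congrArg (Ideal.Quotient.mk Q) hθ)
    rw [Polynomial.aeval_def, Polynomial.hom_eval₂, Polynomial.hom_eval₂, map_zero, map_zero] at h1
    rw [Polynomial.eval₂_map, ← h1]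
    congr 1
    refine RingHom.ext fun a => ?_
    simp only [RingHom.comp_apply]
    rw [← he a, ← halg, ← IsScalarTower.algebraMap_apply (A ⧸ P) (FractionRing R) E,
      IsScalarTower.algebraMap_apply (A ⧸ P) (B ⧸ Q) E]
    rfl
  have hmin : (f.map φ).map (algebraMap R (FractionRing R)) = minpoly (FractionRing R) θ₁ :=
    minpoly.eq_of_irreducible_of_monic hirr
      (by rw [Polynomial.aeval_def, Polynomial.eval₂_map]; exact hroot) ((hf.map _).map _)
  have hle : Nat.card G ≤ Module.finrank (FractionRing R) E := by
    rw [← hdeg, ← hf.natDegree_map φ, ← (hf.map φ).natDegree_map (algebraMap R (FractionRing R)),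
      hmin]
    exact minpoly.natDegree_le θ₁
  have hcard : Nat.card (E ≃ₐ[FractionRing R] E) = Module.finrank (FractionRing R) E :=
    IsGalois.card_aut_eq_finrank _ _
  let s := IsFractionRing.stabilizerHom G P Q (FractionRing R) E
  have hs : Function.Surjective s := IsFractionRing.stabilizerHom_surjective G P Q _ _
  have h1 : Nat.card (E ≃ₐ[FractionRing R] E) ≤ Nat.card (MulAction.stabilizer G Q) :=
    Nat.card_le_card_of_surjective s hs
  have h2 : Nat.card (MulAction.stabilizer G Q) ≤ Nat.card G := Subgroup.card_le_card_group _
  have htop : MulAction.stabilizer G Q = ⊤ := Subgroup.eq_top_of_card_eq _ (by omega)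
  have hbij : Function.Bijective s := hs.bijective_of_nat_card_le (by omega)
  refine ⟨E, inferInstance, inferInstance, θ₁, hfin, hgal, ⟨(MulEquiv.ofBijective s hbij).symm.trans
    ((MulEquiv.subgroupCongr htop).trans Subgroup.topEquiv)⟩, hroot, by omega⟩

theorem lineHom_surjective {σ K : Type*} [Field K] (a d : σ → K) {i : σ} (hi : d i ≠ 0) :
    Function.Surjective (lineHom a d) := by
  intro p
  refine ⟨Polynomial.aeval (MvPolynomial.C (d i)⁻¹ * (MvPolynomial.X i - MvPolynomial.C (a i))) p,
    ?_⟩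
  have : (lineHom a d).comp ((Polynomial.aeval (MvPolynomial.C (d i)⁻¹ *
      (MvPolynomial.X i - MvPolynomial.C (a i))) : Polynomial K →ₐ[K] MvPolynomial σ K) :
      Polynomial K →+* MvPolynomial σ K) = RingHom.id _ := by
    apply Polynomial.ringHom_ext
    · intro c
      simp [lineHom, MvPolynomial.algebraMap_eq]
    · have : Polynomial.C (d i)⁻¹ * Polynomial.C (d i) = 1 := by
        rw [← Polynomial.C_mul, inv_mul_cancel₀ hi, Polynomial.C_1]
      simp only [RingHom.comp_apply, lineHom, RingHom.coe_coe, Polynomial.aeval_X, map_mul, map_sub,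
        MvPolynomial.eval₂Hom_C, MvPolynomial.eval₂Hom_X', RingHom.id_apply]
      linear_combination Polynomial.X * this
  exact congrArg (fun h : Polynomial K →+* Polynomial K => h p) this

theorem lineHom_comp_map {σ K C : Type*} [CommRing K] [CommRing C] [Algebra K C] (a d : σ → K) :
    (lineHom (fun i => algebraMap K C (a i)) fun i => algebraMap K C (d i)).comp
      (MvPolynomial.map (algebraMap K C)) =
    (Polynomial.mapRingHom (algebraMap K C)).comp (lineHom a d) := by
  apply MvPolynomial.ringHom_ext
  · intro c; simp [lineHom]
  · intro i; simp [lineHom]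

theorem not_irreducible_map_lineHom_zero {σ C : Type*} [Field C] [IsAlgClosed C]
    (f : Polynomial (MvPolynomial σ C)) (hf : f.Monic) (h2 : 2 ≤ f.natDegree) (a : σ → C) :
    ¬ Irreducible (f.map (lineHom a fun _ => 0)) := by
  intro hirr
  have h1 : (lineHom a fun _ => 0) = Polynomial.C.comp (MvPolynomial.eval a) := by
    apply MvPolynomial.ringHom_ext
    · intro c; simp [lineHom]
    · intro i; simp [lineHom]
  rw [h1, ← Polynomial.map_map] at hirr
  have hirr' := (hf.map (MvPolynomial.eval a)).irreducible_of_irreducible_map _ _ hirr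
  have := IsAlgClosed.degree_eq_one_of_irreducible C hirr'
  rw [hf.degree_map, Polynomial.degree_eq_natDegree hf.ne_zero] at this
  have : f.natDegree = 1 := by exact_mod_cast this
  omega

open Polynomial in
/-- A regular Galois extension of a rational function field specializes to a regular Galois
extension of `K(t)` with the same group. -/
theorem exists_isGalois_isIntegrallyClosedIn_fractionRing {K F₀ E₀ : Type} [Field K] [CharZero K]
    [Field F₀] [Field E₀] [Algebra K F₀] [Algebra F₀ E₀] [Algebra K E₀] [IsScalarTower K F₀ E₀]
    {m : ℕ} (x : Fin m → F₀) (hx : AlgebraicIndependent K x)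
    (htop : IntermediateField.adjoin K (Set.range x) = ⊤) [FiniteDimensional F₀ E₀] [IsGalois F₀ E₀]
    [IsIntegrallyClosedIn K E₀] :
    ∃ (E₁ : Type) (_ : Field E₁) (_ : Algebra (FractionRing K[X]) E₁) (_ : Algebra K E₁)
      (_ : IsScalarTower K (FractionRing K[X]) E₁),
      FiniteDimensional (FractionRing K[X]) E₁ ∧ IsGalois (FractionRing K[X]) E₁ ∧
      Nonempty ((E₁ ≃ₐ[FractionRing K[X]] E₁) ≃* (E₀ ≃ₐ[F₀] E₀)) ∧ IsIntegrallyClosedIn K E₁ := by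
  let A := MvPolynomial (Fin m) K
  let : Algebra A F₀ := (MvPolynomial.aeval x).toAlgebra
  have halg : ∀ p : A, algebraMap A F₀ p = MvPolynomial.aeval x p := fun _ => rfl
  have : IsScalarTower K A F₀ := .of_algebraMap_eq fun c => by
    rw [halg]; exact ((MvPolynomial.aeval x).commutes c).symm
  have : FaithfulSMul A F₀ := (faithfulSMul_iff_algebraMap_injective _ _).2 hx
  have : IsFractionRing A F₀ := by
    refine IsFractionRing.of_field _ _ fun z => ?_
    obtain ⟨r, s, h⟩ := (IntermediateField.mem_adjoin_range_iff (F := K) x z).1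
      (htop ▸ IntermediateField.mem_top)
    exact ⟨r, s, h⟩
  let : Algebra A E₀ := ((algebraMap F₀ E₀).comp (algebraMap A F₀)).toAlgebra
  have : IsScalarTower A F₀ E₀ := .of_algebraMap_eq fun _ => rfl
  have : IsScalarTower K A E₀ := .of_algebraMap_eq fun c => by
    rw [IsScalarTower.algebraMap_apply A F₀ E₀, ← IsScalarTower.algebraMap_apply K A F₀,
      ← IsScalarTower.algebraMap_apply]
  let B := integralClosure A E₀
  have : Algebra.IsAlgebraic A F₀ := IsLocalization.isAlgebraic F₀ (nonZeroDivisors A)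
  have : Algebra.IsAlgebraic A E₀ := Algebra.IsAlgebraic.trans A F₀ E₀
  -- an integral primitive element
  obtain ⟨α, hα⟩ := Field.exists_primitive_element F₀ E₀
  obtain ⟨y, hy0, hy⟩ := IsAlgebraic.exists_integral_multiple (Algebra.IsAlgebraic.isAlgebraic
      (R := A) α)
  have hgen : IntermediateField.adjoin F₀ {y • α} = ⊤ := by
    rw [eq_top_iff, ← hα, IntermediateField.adjoin_simple_le_iff]
    have h1 : algebraMap A F₀ y ≠ 0 := by simpa using hy0
    have h2 : α = (algebraMap A F₀ y)⁻¹ • (y • α) := by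
      rw [← algebraMap_smul F₀ y α, smul_smul, inv_mul_cancel₀ h1, one_smul]
    exact (congrArg (· ∈ IntermediateField.adjoin F₀ {y • α}) h2).mpr <|
        (IntermediateField.adjoin F₀ {y • α}).smul_mem (IntermediateField.mem_adjoin_simple_self
            F₀ (y • α))
  generalize y • α = θ at hy hgen
  let f : Polynomial A := minpoly A θ
  have hf : f.Monic := minpoly.monic hy
  have hfθ : aeval θ f = 0 := minpoly.aeval A θ
  have hfdeg : f.natDegree = Nat.card (E₀ ≃ₐ[F₀] E₀) := by
    rw [IsGalois.card_aut_eq_finrank, ← (Field.primitive_element_iff_minpoly_natDegree_eq F₀ θ).1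
      hgen, minpoly.isIntegrallyClosed_eq_field_fractions' F₀ hy, hf.natDegree_map]
  have hinf : Infinite K := inferInstance
  have hfr : IsIntegrallyClosedIn K (FractionRing K[X]) :=
    isIntegrallyClosedIn_of_isUnit (A := K[X]) fun a ha => by
      obtain ⟨c, -, hc⟩ := Polynomial.isUnit_iff.1 ha
      exact ⟨c, hc⟩
  rcases lt_or_ge (Nat.card (E₀ ≃ₐ[F₀] E₀)) 2 with hlt | h2
  · have h1 : Subsingleton (E₀ ≃ₐ[F₀] E₀) :=
      Finite.card_le_one_iff_subsingleton.1 (by omega)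
    refine ⟨FractionRing K[X], inferInstance, inferInstance, inferInstance, inferInstance,
      inferInstance, inferInstance, ⟨⟨⟨1, 1, fun g => ?_, fun g => Subsingleton.elim _ _⟩,
        fun _ _ => Subsingleton.elim _ _⟩⟩, hfr⟩
    exact AlgEquiv.ext fun z => (g.commutes z).symm
  let C := AlgebraicClosure K
  let fC := f.map (MvPolynomial.map (algebraMap K C))
  have hfC : fC.Monic := hf.map _
  have hirr : Irreducible fC := IsIntegrallyClosedIn.irreducible_map_mvPolynomial f hf (by omega) θ
    hfθ fun g hg hgθ => natDegree_le_natDegree (minpoly.min A θ hg hgθ)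
  obtain ⟨a, ha⟩ := Polynomial.exists_separable_map_eval (K := K) fC hfC hirr
  obtain ⟨d, hd⟩ := Polynomial.exists_irreducible_map_lineHom (K := K) fC hfC hirr _ ha
  have hd0 : ∃ i, d i ≠ 0 := by
    by_contra! h
    refine not_irreducible_map_lineHom_zero fC hfC ?_ (fun i => algebraMap K C (a i)) ?_
    · rw [hf.natDegree_map]; omega
    · simpa [h] using hd
  obtain ⟨i, hi⟩ := hd0
  let φ : A →+* K[X] := lineHom a d
  have hirrC : Irreducible ((f.map φ).map (mapRingHom (algebraMap K C))) := by
    rw [Polynomial.map_map] at hd ⊢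
    rwa [← lineHom_comp_map a d]
  have hirrF : Irreducible ((f.map φ).map (algebraMap K[X] (FractionRing K[X]))) :=
    (hf.map φ).irreducible_iff_irreducible_map_fraction_map.1
      ((hf.map φ).irreducible_of_irreducible_map _ _ hirrC)
  have : IsFractionRing B E₀ := integralClosure.isFractionRing_of_finite_extension F₀ E₀
  have : FaithfulSMul A E₀ := .trans A F₀ E₀
  have : FaithfulSMul A B := (faithfulSMul_iff_algebraMap_injective _ _).2 fun u v huv =>
    FaithfulSMul.algebraMap_injective A E₀ (congrArg Subtype.val huv)
  have : Algebra.IsInvariant A B (B ≃ₐ[A] B) := Algebra.isInvariant_of_isGalois' A F₀ E₀ B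
  have : Finite (B ≃ₐ[A] B) := Finite.of_equiv _ (galRestrict A F₀ E₀ B).toEquiv
  obtain ⟨E₁, _, _, θ₁, hfin, hgal, ⟨e⟩, hroot, hrank⟩ :=
    exists_isGalois_of_isInvariant_of_irreducible_map (A := A) (B := B) (G := B ≃ₐ[A] B) φ
      (lineHom_surjective a d hi) ⟨θ, hy⟩ f hf
      (by
        apply Subtype.val_injective
        have := (Polynomial.aeval_algebraMap_apply E₀ (⟨θ, hy⟩ : B) f).symm
        exact this.trans hfθ) hirrF
      (hfdeg.trans (Nat.card_congr (galRestrict A F₀ E₀ B).toEquiv))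
  let : Algebra K E₁ := ((algebraMap (FractionRing K[X]) E₁).comp
    (algebraMap K (FractionRing K[X]))).toAlgebra
  have : IsScalarTower K (FractionRing K[X]) E₁ := .of_algebraMap_eq fun _ => rfl
  refine ⟨E₁, inferInstance, inferInstance, inferInstance, inferInstance, hfin, hgal,
    ⟨e.trans (galRestrict A F₀ E₀ B).symm⟩, ?_⟩
  exact isIntegrallyClosedIn_of_irreducible_map_algebraicClosure (f.map φ) (hf.map φ) hirrC θ₁ hroot
    (by rw [hf.natDegree_map, hrank])

open Polynomial in
/-- If `K` is dense in the complete nonarchimedean field `k` of characteristic zero, then every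
finite extension of `k` is generated by an element algebraic over `K`. -/
theorem exists_adjoin_eq_top_of_denseRange {K k L : Type*} [Field K] [NontriviallyNormedField k]
    [CompleteSpace k] [CharZero k] [IsUltrametricDist k] [Algebra K k]
    (hi : DenseRange (algebraMap K k)) [Field L] [Algebra k L] [FiniteDimensional k L] :
    ∃ α : L, (∃ g : K[X], g.Monic ∧ aeval α (g.map (algebraMap K k)) = 0) ∧
      IntermediateField.adjoin k {α} = ⊤ := by
  obtain ⟨θ, hθ⟩ := Field.exists_primitive_element k L
  let F := AlgebraicClosure L
  have : Algebra.IsAlgebraic k F := Algebra.IsAlgebraic.trans k L F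
  let : NormedField F := spectralNorm.normedField k F
  let : NormedAlgebra k F := spectralNorm.normedAlgebra k F
  have hθint : IsIntegral k θ := Algebra.IsIntegral.isIntegral θ
  let f := minpoly k θ
  have hf : f.Monic := minpoly.monic hθint
  have hfirr : Irreducible f := minpoly.irreducible hθint
  let a : F := algebraMap L F θ
  have hmin : minpoly k a = f := minpoly.algebraMap_eq (algebraMap L F).injective θ
  have ha : aeval a f = 0 := by rw [← hmin]; exact minpoly.aeval k a
  have hfdeg : f.natDegree ≠ 0 := hfirr.natDegree_pos.ne'
  have hsplit (p : k[X]) : (p.map (algebraMap k F)).Splits := IsAlgClosed.splits _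
  obtain ⟨δ, hδ, hsep⟩ : ∃ δ : ℝ, 0 < δ ∧ ∀ a' : F, IsConjRoot k a a' → a ≠ a' → δ ≤ ‖a - a'‖ := by
    classical
    let S : Finset F := {x ∈ (f.rootSet F).toFinset | x ≠ a}
    have hS : ∀ a' : F, IsConjRoot k a a' → a ≠ a' → a' ∈ S := by
      intro a' h1 h2
      rw [isConjRoot_iff_mem_minpoly_rootSet (Algebra.IsIntegral.isIntegral a), hmin] at h1
      simp only [S, Finset.mem_filter, Set.mem_toFinset]
      exact ⟨h1, h2.symm⟩
    rcases S.eq_empty_or_nonempty with h0 | h0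
    · exact ⟨1, one_pos, fun a' h1 h2 => by simpa [h0] using hS a' h1 h2⟩
    · obtain ⟨x, hx, hmin⟩ := S.exists_min_image (fun x => ‖a - x‖) h0
      refine ⟨‖a - x‖, ?_, fun a' h1 h2 => hmin a' (hS a' h1 h2)⟩
      rw [norm_pos_iff, sub_ne_zero]
      exact (Finset.mem_filter.1 hx).2.symm
  have hε : (δ / (max ‖a‖ 1)) ^ f.natDegree / (f.natDegree + 1) > 0 := by positivity
  obtain ⟨g, gmon, gdeg, gcoeff⟩ :=
    exists_monic_and_natDegree_eq_and_norm_map_algebraMap_coeff_sub_lt hi hf hε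
  obtain ⟨b, hb, hab⟩ := exists_aroots_norm_sub_lt_of_norm_coeff_sub_lt
      hε ha hf (gmon.map _) (gdeg ▸ (g.natDegree_map _)) gcoeff (hsplit _)
  replace hab : ‖a - b‖ < δ := by
    rw [← Real.rpow_natCast, ← mul_comm_div, div_self, one_mul,
        ← Real.rpow_mul (div_pos hδ (by positivity)).le, mul_inv_cancel₀] at hab
    · simpa [mul_assoc, div_mul_cancel₀ _ (by positivity : (max ‖a‖ 1) > 0).ne'] using hab
    · simp [hfdeg]
    · positivity
  simp only [Polynomial.mem_roots', ne_eq, Polynomial.map_eq_zero, Polynomial.IsRoot.def,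
    Polynomial.eval_map_algebraMap] at hb
  have hbint : IsIntegral k b := ⟨g.map _, gmon.map _, hb.2⟩
  have hab' : a ∈ IntermediateField.adjoin k {b} :=
    IsKrasner.krasner (minpoly.irreducible (Algebra.IsIntegral.isIntegral a)).separable
      (hsplit _) hbint fun a' h1 h2 => hab.trans_le (hsep a' h1 h2)
  have : FiniteDimensional k (IntermediateField.adjoin k {b}) :=
    IntermediateField.adjoin.finiteDimensional hbint
  have hle : IntermediateField.adjoin k {a} ≤ IntermediateField.adjoin k {b} :=
    IntermediateField.adjoin_simple_le_iff.2 hab'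
  have heq : IntermediateField.adjoin k {a} = IntermediateField.adjoin k {b} := by
    apply IntermediateField.eq_of_le_of_finrank_le hle
    rw [IntermediateField.adjoin.finrank hbint,
      IntermediateField.adjoin.finrank (Algebra.IsIntegral.isIntegral a), hmin, gdeg,
      ← gmon.natDegree_map (algebraMap K k)]
    exact natDegree_le_natDegree (minpoly.min k b (gmon.map _) hb.2)
  have hmap : IntermediateField.adjoin k {a} = (⊤ : IntermediateField k L).map
      (IsScalarTower.toAlgHom k L F) := by
    rw [← hθ, IntermediateField.adjoin_map, Set.image_singleton]; rfl
  have hbmem : b ∈ (⊤ : IntermediateField k L).map (IsScalarTower.toAlgHom k L F) := by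
    rw [← hmap, heq]; exact IntermediateField.mem_adjoin_simple_self k b
  obtain ⟨α, -, hα⟩ := hbmem
  replace hα : algebraMap L F α = b := hα
  refine ⟨α, ⟨g, gmon, ?_⟩, ?_⟩
  · apply (algebraMap L F).injective
    rw [map_zero, ← hb.2, ← hα, aeval_algebraMap_apply]
  · apply IntermediateField.map_injective (IsScalarTower.toAlgHom k L F)
    rw [← hmap, heq, IntermediateField.adjoin_map, Set.image_singleton]
    exact congrArg (fun z => IntermediateField.adjoin k {z}) hα

open scoped Valued in
theorem HeightOneSpectrum.exists_adjoin_eq_top_adicCompletion {K : Type*} [Field K] [NumberField K]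
    (v : HeightOneSpectrum (𝓞 K)) (L : Type*) [Field L] [Algebra (v.adicCompletion K) L]
    [FiniteDimensional (v.adicCompletion K) L] :
    ∃ α : L, (∃ g : Polynomial K, g.Monic ∧
        Polynomial.aeval α (g.map (algebraMap K (v.adicCompletion K))) = 0) ∧
      IntermediateField.adjoin (v.adicCompletion K) {α} = ⊤ := by
  have : CharZero (v.adicCompletion K) := charZero_of_injective_algebraMap
    (algebraMap K (v.adicCompletion K)).injective
  let : NontriviallyNormedField (v.adicCompletion K) := inferInstance
  exact exists_adjoin_eq_top_of_denseRange (v.denseRange_algebraMap K)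

theorem exists_sub_notMem_of_finite {K J : Type*} [Field K] [CharZero K] [Finite J] {D : Set K}
    (hD : D.Finite) : ∃ c : J → K, ∀ i j, i ≠ j → c i - c j ∉ D := by
  obtain ⟨N, ⟨e⟩⟩ := Finite.exists_equiv_fin J
  have hfin : (⋃ i : J, ⋃ j : J, (fun d : K => d / (((e i : ℕ) : K) - ((e j : ℕ) : K))) ''
      D).Finite :=
    Set.finite_iUnion fun i => Set.finite_iUnion fun j => hD.image _
  obtain ⟨t, ht⟩ := hfin.exists_notMem
  refine ⟨fun i => t * ((e i : ℕ) : K), fun i j hij hmem => ht ?_⟩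
  have hne : ((e i : ℕ) : K) - ((e j : ℕ) : K) ≠ 0 := by
    rw [sub_ne_zero, Ne, Nat.cast_inj]
    exact fun h => hij (e.injective (Fin.ext h))
  refine Set.mem_iUnion.2 ⟨i, Set.mem_iUnion.2 ⟨j, _, hmem, ?_⟩⟩
  field_simp

theorem IsGalois.adjoin_simple_eq_top_iff_injective {k L : Type*} [Field k] [Field L] [Algebra k L]
    [FiniteDimensional k L] [IsGalois k L] (x : L) :
    IntermediateField.adjoin k {x} = ⊤ ↔ Function.Injective fun h : L ≃ₐ[k] L => h x := by
  rw [Field.primitive_element_iff_algHom_eq_of_eval' k L (fun y => Normal.splits inferInstance y)]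
  constructor
  · intro h σ τ hst
    have := @h σ.toAlgHom τ.toAlgHom hst
    exact AlgEquiv.ext fun z => DFunLike.congr_fun this z
  · intro h σ τ hst
    have := @h (AlgEquiv.ofBijective σ (Algebra.IsAlgebraic.algHom_bijective σ))
      (AlgEquiv.ofBijective τ (Algebra.IsAlgebraic.algHom_bijective τ)) hst
    exact AlgHom.ext fun z => DFunLike.congr_fun this z

/-- A Galois extension `L/k` with a generator algebraic over `K` comes from a finite extension of
`K` inside `L`, which contains the values of an injective equivariant family. -/
theorem exists_equivariant_family {K k L G : Type*} [Field K] [CharZero K] [Field k] [Field L]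
    [Algebra K k] [Algebra k L] [Algebra K L] [IsScalarTower K k L] [FiniteDimensional k L]
    [IsGalois k L] [Group G] [Finite G] (f : (L ≃ₐ[k] L) →* G) (hf : Function.Injective f) (α : L)
    (hα : IsIntegral K α) (hgen : IntermediateField.adjoin k {α} = ⊤) :
    ∃ ℓ : IntermediateField K L, FiniteDimensional K ℓ ∧
      (∀ h : L ≃ₐ[k] L, ∀ x ∈ ℓ, h x ∈ ℓ) ∧
      ∃ η : G → L, (∀ g, η g ∈ ℓ) ∧ (∀ h g, h (η g) = η (f h * g)) ∧ Function.Injective η ∧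
        ∀ g, IntermediateField.adjoin k {η g} = ⊤ := by
  let ℓ := IntermediateField.adjoin K (Set.range fun h : L ≃ₐ[k] L => h α)
  have hmem : ∀ h : L ≃ₐ[k] L, h α ∈ ℓ := fun h => IntermediateField.subset_adjoin _ _ ⟨h, rfl⟩
  have hαinj := (IsGalois.adjoin_simple_eq_top_iff_injective α).1 hgen
  refine ⟨ℓ, IntermediateField.finiteDimensional_adjoin ?_, fun h x hx => ?_, ?_⟩
  · rintro _ ⟨h, rfl⟩
    exact hα.map (h.toAlgHom.restrictScalars K)
  · have : ℓ ≤ ℓ.comap (h.toAlgHom.restrictScalars K) := by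
      rw [IntermediateField.adjoin_le_iff]
      rintro _ ⟨h', rfl⟩
      exact hmem (h * h')
    exact this hx
  · let s := QuotientGroup.rightRel f.range
    let r : G → G := fun g => (Quotient.mk s g).out
    have hr : ∀ g, ∃ h, f h = g * (r g)⁻¹ := fun g => by
      have h1 : s (r g) g := Quotient.exact (Quotient.out_eq _)
      rw [QuotientGroup.rightRel_apply] at h1
      exact h1
    choose p hp using hr
    have hrf : ∀ h g, Quotient.mk s (f h * g) = Quotient.mk s g := fun h g => by
      apply Quotient.sound
      change s _ _
      rw [QuotientGroup.rightRel_apply]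
      exact ⟨h⁻¹, by simp⟩
    have hpf : ∀ h g, p (f h * g) = h * p g := fun h g => by
      apply hf
      rw [hp, map_mul, hp]
      simp only [r, hrf]
      group
    have hDfin : {c : K | ∃ h h' : L ≃ₐ[k] L, algebraMap K L c = h α - h' α}.Finite := by
      have : (Set.range fun z : (L ≃ₐ[k] L) × (L ≃ₐ[k] L) => z.1 α - z.2 α).Finite :=
        Set.finite_range _
      refine (this.preimage ((algebraMap K L).injective.injOn)).subset ?_
      rintro c ⟨h, h', hc⟩
      exact ⟨(h, h'), hc.symm⟩
    obtain ⟨c, hc⟩ := exists_sub_notMem_of_finite (J := Quotient s) hDfin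
    let η : G → L := fun g => p g α + algebraMap K L (c (Quotient.mk s g))
    have heq : ∀ h g, h (η g) = η (f h * g) := fun h g => by
      simp only [η, hrf, hpf, map_add, AlgEquiv.mul_apply]
      rw [IsScalarTower.algebraMap_apply K k L, h.commutes]
    have hinj : Function.Injective η := by
      intro g g' hgg
      have hq : Quotient.mk s g = Quotient.mk s g' := by
        by_contra hne
        refine hc _ _ hne ⟨p g', p g, ?_⟩
        rw [map_sub]
        linear_combination hgg
      have h1 : p g = p g' := hαinj (by simpa [η, hq] using hgg)
      have h2 := hp g
      have h3 := hp g'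
      have h4 : r g = r g' := by simp only [r, hq]
      rw [h1, h3, h4] at h2
      exact (mul_right_cancel h2).symm
    refine ⟨η, fun g => add_mem (hmem _) (ℓ.algebraMap_mem _), heq, hinj, fun g => ?_⟩
    rw [IsGalois.adjoin_simple_eq_top_iff_injective]
    intro h h' hh
    simp only [heq] at hh
    exact hf (mul_right_cancel (hinj hh))

/-- The matrix of the conjugates of a basis, embedded in an extension field, is invertible. -/
theorem IsGalois.isUnit_matrix_apply_basis {F E Y : Type*} [Field F] [Field E] [Field Y]
    [Algebra F E] [Algebra F Y] [FiniteDimensional F E] [IsGalois F E] (i : E →ₐ[F] Y)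
    [DecidableEq (E ≃ₐ[F] E)] (b : Module.Basis (E ≃ₐ[F] E) F E) :
    IsUnit (Matrix.of fun g σ : E ≃ₐ[F] E => i (g (b σ))) := by
  rw [← Matrix.linearIndependent_rows_iff_isUnit, Fintype.linearIndependent_iff]
  intro c hc
  have hli := linearIndependent_monoidHom E Y
  have hli' : LinearIndependent Y
      (fun g : E ≃ₐ[F] E => (((i.comp g.toAlgHom : E →ₐ[F] Y) : E →* Y) : E → Y)) := by
    refine hli.comp (fun g : E ≃ₐ[F] E => ((i.comp g.toAlgHom : E →ₐ[F] Y) : E →* Y)) ?_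
    intro g g' h
    ext x
    have := DFunLike.congr_fun h x
    exact i.injective this
  rw [Fintype.linearIndependent_iff] at hli'
  refine hli' c ?_
  funext x
  simp only [Finset.sum_apply, Pi.smul_apply, smul_eq_mul, Pi.zero_apply]
  rw [← b.sum_repr x]
  simp only [MonoidHom.coe_coe, map_sum, map_smul, Finset.mul_sum]
  rw [Finset.sum_comm]
  refine Finset.sum_eq_zero fun σ _ => ?_
  have hσ := congrFun hc σ
  simp only [Finset.sum_apply, Pi.smul_apply, smul_eq_mul, Pi.zero_apply, Matrix.of_apply,
    Matrix.row] at hσ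
  have : ∀ g : E ≃ₐ[F] E, c g * (b.repr x σ • i.comp g.toAlgHom (b σ)) =
      b.repr x σ • (c g * i (g (b σ))) := fun g => by
    rw [mul_smul_comm]; rfl
  simp only [this, ← Finset.smul_sum]
  rw [hσ, smul_zero]

/-- Interpolation of an equivariant family in a finite extension `Y/F` by the conjugates of a single
polynomial at a point fixed by the given automorphisms. -/
theorem exists_polynomial_eval_eq_equivariant {F E Y H : Type*} [Field F] [CharZero F] [Field E]
    [Field Y] [Algebra F E] [Algebra F Y] [FiniteDimensional F E] [IsGalois F E]
    [FiniteDimensional F Y] (i : E →ₐ[F] Y) (f : H → (E ≃ₐ[F] E)) (ρ : H → (Y →ₐ[F] Y))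
    (hρ : ∀ h x, ρ h (i x) = i (f h x)) (u : (E ≃ₐ[F] E) → Y)
    (hu : ∀ h g, ρ h (u g) = u (f h * g)) :
    ∃ (ζ : Y) (θ : Polynomial E), (∀ h, ρ h ζ = ζ) ∧
      ∀ g : E ≃ₐ[F] E,
        (θ.map (g : E →+* E)).eval₂ (i : E →+* Y) ζ = u g := by
  classical
  set b := IsGalois.normalBasis F E
  have hM := IsGalois.isUnit_matrix_apply_basis i b
  set M : Matrix (E ≃ₐ[F] E) (E ≃ₐ[F] E) Y := Matrix.of fun g σ => i (g (b σ)) with hMdef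
  obtain ⟨z, hz⟩ := (Matrix.mulVec_surjective_iff_isUnit.2 hM) u
  have hinj := Matrix.mulVec_injective_iff_isUnit.2 hM
  have hz' : ∀ g, ∑ σ, i (g (b σ)) * z σ = u g := fun g => congrFun hz g
  have hfix : ∀ h σ, ρ h (z σ) = z σ := by
    intro h
    suffices hs : (fun σ => ρ h (z σ)) = z from fun σ => congrFun hs σ
    refine hinj ?_
    rw [hz]
    funext g
    change ∑ σ, i (g (b σ)) * ρ h (z σ) = u g
    have h1 := congrArg (ρ h) (hz' ((f h)⁻¹ * g))
    rw [hu, mul_inv_cancel_left, map_sum] at h1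
    rw [← h1]
    refine Finset.sum_congr rfl fun σ _ => ?_
    rw [map_mul, hρ, ← AlgEquiv.mul_apply, mul_inv_cancel_left]
  let Z : IntermediateField F Y :=
    (⨅ h, AlgHom.equalizer (ρ h) (AlgHom.id F Y)).toIntermediateField' (by
      exact Subalgebra.isField_of_algebraic _)
  have hZ : ∀ x, x ∈ Z ↔ ∀ h, ρ h x = x := fun x => by
    change x ∈ (⨅ h, AlgHom.equalizer (ρ h) (AlgHom.id F Y)) ↔ _
    simp [Algebra.mem_iInf, AlgHom.mem_equalizer]
  obtain ⟨ζ, hζ⟩ := Field.exists_primitive_element F Z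
  have hw : ∀ σ, ∃ w : Polynomial F, Polynomial.aeval (ζ : Y) w = z σ := by
    intro σ
    have h1 : (⟨z σ, (hZ _).2 fun h => hfix h σ⟩ : Z) ∈ IntermediateField.adjoin F {ζ} := by
      rw [hζ]; trivial
    rw [← IntermediateField.mem_toSubalgebra,
      IntermediateField.adjoin_simple_toSubalgebra_of_isAlgebraic
      (Algebra.IsAlgebraic.isAlgebraic ζ), Algebra.adjoin_singleton_eq_range_aeval] at h1
    obtain ⟨w, hw⟩ := h1
    refine ⟨w, ?_⟩
    have := congrArg (algebraMap Z Y) hw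
    change algebraMap Z Y (Polynomial.aeval ζ w) = _ at this
    rw [← Polynomial.aeval_algebraMap_apply] at this
    exact this
  choose w hw using hw
  refine ⟨ζ, ∑ σ, Polynomial.C (b σ) * (w σ).map (algebraMap F E), (hZ _).1 ζ.2, fun g => ?_⟩
  rw [← hz', Polynomial.map_sum, Polynomial.eval₂_finsetSum]
  refine Finset.sum_congr rfl fun σ _ => ?_
  rw [Polynomial.map_mul, Polynomial.map_C, Polynomial.eval₂_mul, Polynomial.eval₂_C,
    Polynomial.map_map, Polynomial.eval₂_map, ← hw σ]
  congr 1
  rw [Polynomial.aeval_def]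
  congr 1
  ext x
  simp

/-- If `K` is algebraically closed in `E` and `Y/E` has degree at most `[ℓ : K]`, then every
element of `Y` algebraic over `K` lies in the image of `ℓ`. -/
theorem IsIntegrallyClosedIn.mem_fieldRange_of_isIntegral {K E C Y : Type*} [Field K] [CharZero K]
    [Field E] [Field C] [Field Y] [Algebra K E] [Algebra K C] [Algebra K Y] [Algebra E Y]
    [IsScalarTower K E Y] [IsIntegrallyClosedIn K E] [FiniteDimensional K C]
    [FiniteDimensional E Y] (h : Module.finrank E Y ≤ Module.finrank K C) (i : C →ₐ[K] Y) {y : Y}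
    (hy : IsIntegral K y) : y ∈ i.fieldRange := by
  have := IntermediateField.adjoin.finiteDimensional hy
  have : FiniteDimensional K i.fieldRange :=
    LinearEquiv.finiteDimensional (AlgEquiv.ofInjectiveField i).toLinearEquiv
  let D : IntermediateField K Y := i.fieldRange ⊔ IntermediateField.adjoin K {y}
  have hD : FiniteDimensional K D := IntermediateField.finiteDimensional_sup _ _
  have hdis := (IsIntegrallyClosedIn.linearDisjoint (IsScalarTower.toAlgHom K E Y) D.val).symm
  have hdis' : D.LinearDisjoint E := by
    rw [IntermediateField.linearDisjoint_iff']  at hdis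
    rw [IntermediateField.linearDisjoint_iff]
    convert hdis using 1
    · ext z; simp
    · rfl
  let b := Module.finBasis K D
  have hli := hdis'.linearIndependent_left b.linearIndependent
  have hcard := hli.fintype_card_le_finrank
  rw [Fintype.card_fin] at hcard
  have heq : i.fieldRange = D := IntermediateField.eq_of_le_of_finrank_le le_sup_left (by
    exact (hcard.trans h).trans_eq (AlgEquiv.ofInjectiveField i).toLinearEquiv.finrank_eq)
  rw [heq]
  exact (le_sup_right : _ ≤ D) (IntermediateField.mem_adjoin_simple_self K y)

/-- The compositum of a regular extension `E` and a finite extension `C` of `K`, with the induced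
action of pairs of automorphisms. -/
theorem IsIntegrallyClosedIn.exists_compositum (K F E C : Type) [Field K] [CharZero K] [Field F]
    [Field E] [Field C] [Algebra K F] [Algebra F E] [Algebra K E] [IsScalarTower K F E]
    [Algebra K C] [IsIntegrallyClosedIn K E] [FiniteDimensional K C] :
    ∃ (Y : Type) (_ : Field Y) (_ : Algebra E Y) (_ : Algebra F Y) (_ : Algebra K Y)
      (_ : IsScalarTower F E Y) (_ : IsScalarTower K E Y) (_ : IsScalarTower K F Y)
      (_ : FiniteDimensional E Y) (i : C →ₐ[K] Y), Module.finrank E Y = Module.finrank K C ∧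
      ∀ (σ : E ≃ₐ[F] E) (τ : C →ₐ[K] C), ∃ ρ : Y →ₐ[F] Y,
        (∀ x, ρ (algebraMap E Y x) = algebraMap E Y (σ x)) ∧ ∀ x, ρ (i x) = i (τ x) := by
  let : Field (E ⊗[K] C) := (IsIntegrallyClosedIn.isField_tensorProduct K E C).toField
  refine ⟨E ⊗[K] C, inferInstance, inferInstance, inferInstance, inferInstance, inferInstance,
    inferInstance, inferInstance, inferInstance, Algebra.TensorProduct.includeRight,
    Module.finrank_baseChange, fun σ τ => ⟨Algebra.TensorProduct.map σ.toAlgHom τ, ?_, ?_⟩⟩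
  · intro x
    simp [Algebra.TensorProduct.algebraMap_apply]
  · intro x
    simp

/-- An equivariant family in `C ⊆ L` is the family of conjugates of one polynomial over `E` at a
point `ζ` of the twist of `E/F` by `L/k`; elements of `F(ζ)` algebraic over `K` come from `k`. -/
theorem IsIntegrallyClosedIn.exists_twist {K F E k L : Type} [Field K] [CharZero K] [Field F]
    [Field E] [Field k] [Field L] [Algebra K F] [Algebra F E] [Algebra K E] [IsScalarTower K F E]
    [Algebra K k] [Algebra k L] [Algebra K L] [IsScalarTower K k L] [IsIntegrallyClosedIn K E]
    [FiniteDimensional F E] [IsGalois F E] [FiniteDimensional k L] [IsGalois k L]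
    (f : (L ≃ₐ[k] L) →* (E ≃ₐ[F] E)) (C : IntermediateField K L) [FiniteDimensional K C]
    (hC : ∀ h : L ≃ₐ[k] L, ∀ x ∈ C, h x ∈ C) (η : (E ≃ₐ[F] E) → L) (hη : ∀ g, η g ∈ C)
    (hfη : ∀ h g, h (η g) = η (f h * g)) :
    ∃ (Y : Type) (_ : Field Y) (_ : Algebra F Y) (_ : Algebra K Y) (_ : IsScalarTower K F Y)
      (i₁ : E →ₐ[F] Y) (i₂ : C →ₐ[K] Y) (ζ : Y) (θ : Polynomial E), IsIntegral F ζ ∧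
      (∀ g : E ≃ₐ[F] E, (θ.map (g : E →+* E)).eval₂ (i₁ : E →+* Y) ζ = i₂ ⟨η g, hη g⟩) ∧
      ∀ z ∈ IntermediateField.adjoin F {ζ}, IsIntegral K z →
        ∃ (c : k) (hc : algebraMap k L c ∈ C), i₂ ⟨algebraMap k L c, hc⟩ = z := by
  obtain ⟨Y, _, _, _, _, _, _, _, _, i₂, hfin, hρ⟩ :=
    IsIntegrallyClosedIn.exists_compositum K F E C
  have : CharZero F := charZero_of_injective_algebraMap (algebraMap K F).injective
  have : FiniteDimensional F Y := FiniteDimensional.trans F E Y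
  let τ : (L ≃ₐ[k] L) → (C →ₐ[K] C) := fun h =>
    { toFun := fun x => ⟨h x, hC h x x.2⟩
      map_one' := by ext; simp
      map_mul' := fun x y => by ext; simp
      map_zero' := by ext; simp
      map_add' := fun x y => by ext; simp
      commutes' := fun c => by
        ext
        change h (algebraMap K L c) = algebraMap K L c
        rw [IsScalarTower.algebraMap_apply K k L, h.commutes] }
  choose ρ hρ₁ hρ₂ using fun h => hρ (f h) (τ h)
  obtain ⟨ζ, θ, hζ, hθ⟩ := exists_polynomial_eval_eq_equivariant (IsScalarTower.toAlgHom F E Y)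
    (fun h => f h) ρ (fun h x => hρ₁ h x) (fun g => i₂ ⟨η g, hη g⟩) (fun h g => by
      rw [hρ₂]
      congr 1
      exact Subtype.ext (hfη h g))
  refine ⟨Y, inferInstance, inferInstance, inferInstance, inferInstance,
    IsScalarTower.toAlgHom F E Y, i₂, ζ, θ, Algebra.IsIntegral.isIntegral ζ, hθ, ?_⟩
  intro z hz hzK
  obtain ⟨x, rfl⟩ := IsIntegrallyClosedIn.mem_fieldRange_of_isIntegral hfin.le i₂ hzK
  have hfix : ∀ h, ρ h (i₂ x) = i₂ x := by
    intro h
    have hle : IntermediateField.adjoin F {ζ} ≤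
        ((ρ h).equalizer (AlgHom.id F Y)).toIntermediateField'
          (Subalgebra.isField_of_algebraic _) := by
      rw [IntermediateField.adjoin_simple_le_iff]
      exact hζ h
    exact hle hz
  have hx : (x : L) ∈ Set.range (algebraMap k L) := by
    rw [IsGalois.mem_range_algebraMap_iff_fixed]
    intro h
    have := hfix h
    rw [hρ₂] at this
    exact congrArg Subtype.val (i₂.injective this)
  obtain ⟨c, hc⟩ := hx
  exact ⟨c, hc ▸ x.2, congrArg i₂ (Subtype.ext hc)⟩

/-- A finite Galois extension `E/F` induces one of the same group on rational function fields. -/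
theorem IsGalois.exists_fractionRing_polynomial (F E : Type) [Field F] [Field E] [Algebra F E]
    [FiniteDimensional F E] [IsGalois F E] :
    ∃ (E' : Type) (_ : Field E') (_ : Algebra (FractionRing (Polynomial F)) E')
      (_ : FiniteDimensional (FractionRing (Polynomial F)) E')
      (_ : IsGalois (FractionRing (Polynomial F)) E') (j : Polynomial E →+* E')
      (e : (E ≃ₐ[F] E) ≃* (E' ≃ₐ[FractionRing (Polynomial F)] E')),
      Function.Injective j ∧
      (∀ p : Polynomial F, j (p.map (algebraMap F E)) =
        algebraMap (FractionRing (Polynomial F)) E' (algebraMap (Polynomial F) _ p)) ∧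
      ∀ g p, e g (j p) = j (p.map (g : E →+* E)) := by
  let : Algebra (Polynomial F) (Polynomial E) := Polynomial.algebra F E
  have halg : ∀ p : Polynomial F, algebraMap (Polynomial F) (Polynomial E) p =
    p.map (algebraMap F E) := fun p => rfl
  have hsmul : ∀ (g : E ≃ₐ[F] E) (p : Polynomial E), g • p = p.map (g : E →+* E) := fun g p => by
    ext; simp
  have hinj : Function.Injective (algebraMap (Polynomial F) (Polynomial E)) := fun p q h =>
    Polynomial.map_injective _ (algebraMap F E).injective h
  have : FaithfulSMul (Polynomial F) (Polynomial E) :=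
    (faithfulSMul_iff_algebraMap_injective _ _).2 hinj
  have hG : IsGaloisGroup (E ≃ₐ[F] E) (Polynomial F) (Polynomial E) := by
    refine ⟨⟨fun {g g'} h => ?_⟩, ⟨fun g p q => ?_⟩, ⟨fun p h => ?_⟩⟩
    · ext x
      have := h (Polynomial.C x)
      simpa using this
    · rw [Algebra.smul_def, Algebra.smul_def, smul_mul']
      congr 1
      rw [halg, hsmul, Polynomial.map_map]
      congr 1
      ext; simp
    · have : p ∈ Polynomial.lifts (algebraMap F E) := by
        rw [Polynomial.lifts_iff_coeff_lifts]
        intro n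
        rw [IsGalois.mem_range_algebraMap_iff_fixed]
        intro g
        conv_rhs => rw [← h g]
        simp
      exact (Polynomial.mem_lifts _).1 this
  let : Algebra (FractionRing (Polynomial F)) (FractionRing (Polynomial E)) :=
    FractionRing.liftAlgebra _ _
  let := IsFractionRing.mulSemiringAction (E ≃ₐ[F] E) (Polynomial E) (FractionRing (Polynomial E))
  have hG' : IsGaloisGroup (E ≃ₐ[F] E) (FractionRing (Polynomial F)) (FractionRing (Polynomial
      E)) :=
    IsGaloisGroup.toFractionRing _ _ _
  have hfin : FiniteDimensional (FractionRing (Polynomial F)) (FractionRing (Polynomial E)) :=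
    hG'.finiteDimensional
  have hgal : IsGalois (FractionRing (Polynomial F)) (FractionRing (Polynomial E)) :=
    IsGaloisGroup.isGalois (E ≃ₐ[F] E) _ _
  refine ⟨FractionRing (Polynomial E), inferInstance, inferInstance, hfin, hgal,
    algebraMap _ _, IsGaloisGroup.mulEquivAlgEquiv _ _ _, IsFractionRing.injective _ _, ?_, ?_⟩
  · intro p
    rw [← halg, ← IsScalarTower.algebraMap_apply, ← IsScalarTower.algebraMap_apply]
  · intro g p
    rw [IsGaloisGroup.mulEquivAlgEquiv_apply_apply, ← hsmul]
    exact (algebraMap.smul' _ _ _).symm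

/-- The polynomial with roots the conjugates of `θ ∈ E[X]` has coefficients in `F[X]`. -/
theorem IsGalois.exists_monic_map_eq_prod_X_sub_C {F E : Type*} [Field F] [Field E] [Algebra F E]
    [FiniteDimensional F E] [IsGalois F E] (θ : Polynomial E) :
    ∃ q : Polynomial (Polynomial F), q.Monic ∧
      q.map (Polynomial.mapRingHom (algebraMap F E)) =
        ∏ g : E ≃ₐ[F] E, (Polynomial.X - Polynomial.C (θ.map (g : E →+* E))) := by
  have hsmul : ∀ (g : E ≃ₐ[F] E) (p : Polynomial E), g • p = p.map (g : E →+* E) := fun g p => by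
    ext; simp
  have h : MulSemiringAction.charpoly (E ≃ₐ[F] E) θ ∈
      Polynomial.lifts (Polynomial.mapRingHom (algebraMap F E)) := by
    rw [Polynomial.lifts_iff_coeff_lifts]
    intro n
    have : (MulSemiringAction.charpoly (E ≃ₐ[F] E) θ).coeff n ∈
        Polynomial.lifts (algebraMap F E) := by
      rw [Polynomial.lifts_iff_coeff_lifts]
      intro m
      rw [IsGalois.mem_range_algebraMap_iff_fixed]
      intro g
      conv_rhs => rw [← MulSemiringAction.smul_coeff_charpoly θ n g]
      simp
    exact (Polynomial.mem_lifts _).1 this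
  obtain ⟨q, hq, -, hmon⟩ := Polynomial.lifts_and_natDegree_eq_and_monic h
    (MulSemiringAction.monic_charpoly _ _)
  refine ⟨q, hmon, hq.trans ?_⟩
  simp only [MulSemiringAction.charpoly_eq, hsmul]

/-- The elements of an integrally closed local ring whose residue class is algebraic over `K` form
an integrally closed local ring. -/
theorem exists_subalgebra_algHom_of_residue {K O F Z k : Type*} [Field K] [CommRing O] [IsDomain O]
    [IsIntegrallyClosed O] [Field F] [Field Z] [Field k] [Algebra K O] [Algebra K F] [Algebra O F]
    [IsScalarTower K O F] [IsFractionRing O F] [Algebra K Z] [Algebra K k] (e : O →ₐ[K] Z)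
    (he : ∀ o, e o ≠ 0 → IsUnit o) (j : integralClosure K Z →ₐ[K] k) :
    ∃ (R : Subalgebra K F) (φ : R →ₐ[K] k), (∀ x : F, IsIntegral R x → x ∈ R) ∧
      (∀ r, φ r ≠ 0 → IsUnit r) ∧
      ∀ (o : O) (h : IsIntegral K (e o)), ∃ hr : algebraMap O F o ∈ R,
        φ ⟨algebraMap O F o, hr⟩ = j ⟨e o, h⟩ := by
  let i : O →ₐ[K] F := IsScalarTower.toAlgHom K O F
  have hi : Function.Injective i := IsFractionRing.injective O F
  let R' : Subalgebra K O := (integralClosure K Z).comap e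
  let eq : R' ≃ₐ[K] R'.map i := R'.equivMapOfInjective i hi
  let e' : R' →ₐ[K] integralClosure K Z := (e.comp R'.val).codRestrict _ fun r => r.2
  have heq : ∀ (o : O) (h : o ∈ R') (h' : i o ∈ R'.map i), eq.symm ⟨i o, h'⟩ = ⟨o, h⟩ := by
    intro o h h'
    rw [AlgEquiv.symm_apply_eq]
    rfl
  refine ⟨R'.map i, (j.comp e').comp eq.symm.toAlgHom, ?_, ?_, ?_⟩
  · intro x hx
    have hxO : IsIntegral O x := by
      obtain ⟨p, hp, hpx⟩ := hx
      refine ⟨p.map (R'.val.toRingHom.comp eq.symm.toAlgHom.toRingHom), hp.map _, ?_⟩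
      rw [Polynomial.eval₂_map]
      rw [← hpx]
      congr 1
      ext r
      obtain ⟨r, rfl⟩ := eq.surjective r
      simp
      rfl
    obtain ⟨o, rfl⟩ := IsIntegrallyClosed.isIntegral_iff.1 hxO
    refine ⟨o, ?_, rfl⟩
    have ho : IsIntegral R' o := by
      obtain ⟨p, hp, hpx⟩ := hx
      refine ⟨p.map eq.symm.toAlgHom.toRingHom, hp.map _, hi ?_⟩
      rw [Polynomial.eval₂_map, map_zero, ← hpx]
      change i.toRingHom _ = _
      rw [Polynomial.hom_eval₂]
      congr 1
      ext r
      obtain ⟨r, rfl⟩ := eq.surjective r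
      simp
      rfl
    have h1 : IsIntegral (integralClosure K Z) (e o) := by
      obtain ⟨p, hp, hpx⟩ := ho
      refine ⟨p.map e'.toRingHom, hp.map _, ?_⟩
      rw [Polynomial.eval₂_map]
      have := congrArg e.toRingHom hpx
      rw [Polynomial.hom_eval₂, map_zero] at this
      exact this
    exact isIntegral_trans (R := K) (A := integralClosure K Z) _ h1
  · intro r hr
    obtain ⟨⟨o, ho⟩, rfl⟩ := eq.surjective r
    have h0 : e o ≠ 0 := by
      intro h
      apply hr
      have : e' ⟨o, ho⟩ = 0 := Subtype.ext h
      simp [this]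
    obtain ⟨u, rfl⟩ := he o h0
    have hu : e ↑u⁻¹ = (e (u : O))⁻¹ := by
      refine eq_inv_of_mul_eq_one_left ?_
      rw [← map_mul, Units.inv_mul, map_one]
    have hmem : (↑u⁻¹ : O) ∈ R' := by
      change IsIntegral K (e ↑u⁻¹)
      rw [hu]
      exact IsIntegral.inv ho
    refine IsUnit.map eq (IsUnit.of_mul_eq_one ⟨_, hmem⟩ ?_)
    exact Subtype.ext (Units.mul_inv u)
  · intro o h
    have hr : i o ∈ R'.map i := ⟨o, h, rfl⟩
    exact ⟨hr, congrArg (fun r => j (e' r)) (heq o h hr)⟩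

/-- Localizing an integrally closed domain at the kernel of a homomorphism to a field, then
restricting to residue classes algebraic over `K`. -/
theorem exists_subalgebra_algHom_of_evaluation {K S F Z k : Type*} [Field K] [CommRing S]
    [IsDomain S] [IsIntegrallyClosed S] [Field F] [Field Z] [Field k] [Algebra K S] [Algebra K F]
    [Algebra S F] [IsScalarTower K S F] [IsFractionRing S F] [Algebra K Z] [Algebra K k]
    (ev : S →ₐ[K] Z) (j : integralClosure K Z →ₐ[K] k) :
    ∃ (R : Subalgebra K F) (φ : R →ₐ[K] k), (∀ x : F, IsIntegral R x → x ∈ R) ∧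
      (∀ r, φ r ≠ 0 → IsUnit r) ∧
      ∀ (s : S) (h : IsIntegral K (ev s)), ∃ hr : algebraMap S F s ∈ R,
        φ ⟨algebraMap S F s, hr⟩ = j ⟨ev s, h⟩ := by
  let p : Ideal S := RingHom.ker ev
  have hp : p.IsPrime := RingHom.ker_isPrime _
  have hle : p.primeCompl ≤ nonZeroDivisors S := p.primeCompl_le_nonZeroDivisors
  let O := Localization.subalgebra.ofField F p.primeCompl hle
  have hloc : IsLocalization.AtPrime O p := Localization.subalgebra.isLocalization_ofField F _ hle
  have hfrac : IsFractionRing O F := Localization.subalgebra.isFractionRing_ofField F _ hle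
  have hic : IsIntegrallyClosed O := isIntegrallyClosed_of_isLocalization O p.primeCompl hle
  have hunit : ∀ y : p.primeCompl, IsUnit ((ev : S →ₐ[K] Z) y) := fun y =>
    isUnit_iff_ne_zero.2 y.2
  let e : O →ₐ[K] Z := IsLocalization.liftAlgHom (M := p.primeCompl) (f := ev) hunit
  have hes : ∀ s, e (algebraMap S O s) = ev s := fun s => IsLocalization.lift_eq hunit s
  have he : ∀ o, e o ≠ 0 → IsUnit o := by
    intro o ho
    obtain ⟨s, t, rfl⟩ := IsLocalization.exists_mk'_eq p.primeCompl o
    rw [IsLocalization.AtPrime.isUnit_mk'_iff O p]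
    intro hs
    apply ho
    change IsLocalization.lift hunit _ = _
    rw [IsLocalization.lift_mk'_spec]
    rw [mul_zero]
    exact hs
  obtain ⟨R, φ, h1, h2, h3⟩ := exists_subalgebra_algHom_of_residue (F := F) e he j
  refine ⟨R, φ, h1, h2, fun s h => ?_⟩
  obtain ⟨hr, hφ⟩ := h3 (algebraMap S O s) (by rw [hes]; exact h)
  rw [← IsScalarTower.algebraMap_apply] at hr
  refine ⟨hr, ?_⟩
  have h4 : (⟨e (algebraMap S O s), by rw [hes]; exact h⟩ : integralClosure K Z) = ⟨ev s, h⟩ :=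
    Subtype.ext (hes s)
  rw [← h4, ← hφ]
  congr 1

theorem AlgHom.exists_comp_eq_of_forall_mem_range {K A B Y : Type*} [Field K] [CommRing A]
    [CommRing B] [CommRing Y] [Algebra K A] [Algebra K B] [Algebra K Y] (u : A →ₐ[K] Y)
    (m : B →ₐ[K] Y) (hm : Function.Injective m) (h : ∀ a, ∃ b, m b = u a) :
    ∃ w : A →ₐ[K] B, ∀ a, m (w a) = u a := by
  refine ⟨(AlgEquiv.ofInjective m hm).symm.toAlgHom.comp (u.codRestrict m.range h), fun a => ?_⟩
  exact congrArg Subtype.val ((AlgEquiv.ofInjective m hm).apply_symm_apply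
    (⟨u a, h a⟩ : m.range))

theorem IntermediateField.adjoin_fractionRing_polynomial_eq_top {K F : Type*} [Field K] [Field F]
    [Algebra K F] {b : F} (hb : IntermediateField.adjoin K {b} = ⊤)
    (W : IntermediateField K (FractionRing (Polynomial F)))
    (hbW : algebraMap (Polynomial F) (FractionRing (Polynomial F)) (Polynomial.C b) ∈ W)
    (hX : algebraMap (Polynomial F) (FractionRing (Polynomial F)) Polynomial.X ∈ W) : W = ⊤ := by
  have hF : ∀ c : F, algebraMap F (FractionRing (Polynomial F)) c ∈ W := by
    have hle : IntermediateField.adjoin K {b} ≤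
        W.comap (IsScalarTower.toAlgHom K F (FractionRing (Polynomial F))) := by
      rw [IntermediateField.adjoin_simple_le_iff]
      exact hbW
    rw [hb] at hle
    exact fun c => hle (IntermediateField.mem_top (x := c))
  have hP : ∀ p : Polynomial F, algebraMap (Polynomial F) (FractionRing (Polynomial F)) p ∈ W := by
    intro p
    induction p using Polynomial.induction_on' with
    | add p q hp hq => rw [map_add]; exact add_mem hp hq
    | monomial n a =>
      rw [← Polynomial.C_mul_X_pow_eq_monomial, map_mul, map_pow]
      exact mul_mem (hF a) (pow_mem hX n)
  rw [eq_top_iff]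
  rintro x -
  obtain ⟨p, q, -, rfl⟩ := IsFractionRing.div_surjective (Polynomial F) x
  exact div_mem (hP p) (hP q)

/-- The rational function field over a regular Galois extension specializes to every Galois
extension with a smaller group and a generator algebraic over `K`. -/
theorem IsSpecialization.fractionRing_polynomial {K F E E' k L : Type} [Field K] [CharZero K]
    [Field F] [Field E] [Field E'] [Field k] [Field L] [Algebra K F] [Algebra F E] [Algebra K E]
    [IsScalarTower K F E] [IsIntegrallyClosedIn K E] [FiniteDimensional F E] [IsGalois F E]
    {b : F} (hb : IntermediateField.adjoin K {b} = ⊤)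
    [Algebra (FractionRing (Polynomial F)) E'] [FiniteDimensional (FractionRing (Polynomial F)) E']
    [IsGalois (FractionRing (Polynomial F)) E'] (j : Polynomial E →+* E')
    (e : (E ≃ₐ[F] E) ≃* (E' ≃ₐ[FractionRing (Polynomial F)] E')) (hj : Function.Injective j)
    (hjF : ∀ p : Polynomial F, j (p.map (algebraMap F E)) =
      algebraMap (FractionRing (Polynomial F)) E' (algebraMap (Polynomial F) _ p))
    (hje : ∀ g p, e g (j p) = j (p.map (g : E →+* E)))
    [Algebra K k] [Algebra k L] [Algebra K L] [IsScalarTower K k L] [FiniteDimensional k L]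
    [IsGalois k L] (f : (L ≃ₐ[k] L) →* (E ≃ₐ[F] E)) (hf : Function.Injective f) (α : L)
    (hα : IsIntegral K α) (hgen : IntermediateField.adjoin k {α} = ⊤) :
    IsSpecialization K (FractionRing (Polynomial F)) E' k L := by
  classical
  obtain ⟨C, _, hC, η, hηC, hfη, hηinj, hηgen⟩ := exists_equivariant_family f hf α hα hgen
  obtain ⟨Y, _, _, _, _, i₁, i₂, ζ, θ, hζ, hθ, hres⟩ :=
    IsIntegrallyClosedIn.exists_twist f C hC η hηC hfη
  let Z := IntermediateField.adjoin F {ζ}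
  let ζ' : Z := ⟨ζ, IntermediateField.mem_adjoin_simple_self F ζ⟩
  let ev : Polynomial F →ₐ[K] Z := (Polynomial.aeval ζ').restrictScalars K
  have hev : ∀ p, (ev p : Y) = Polynomial.aeval ζ p := fun p =>
    (Polynomial.aeval_algebraMap_apply Y ζ' p).symm
  let m : (C.toSubalgebra.comap (IsScalarTower.toAlgHom K k L)) →ₐ[K] Y :=
    i₂.comp (((IsScalarTower.toAlgHom K k L).comp (Subalgebra.val _)).codRestrict C.toSubalgebra
      fun c => c.2)
  have hm : Function.Injective m := fun c d h =>
    Subtype.ext ((algebraMap k L).injective (congrArg Subtype.val (i₂.injective h)))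
  let u : integralClosure K Z →ₐ[K] Y :=
    (Z.val.restrictScalars K).comp (Subalgebra.val _)
  obtain ⟨w, hw⟩ := AlgHom.exists_comp_eq_of_forall_mem_range u m hm (by
    intro z
    obtain ⟨c, hc, h⟩ := hres z.1 z.1.2 (z.2.map (Z.val.restrictScalars K))
    exact ⟨⟨c, hc⟩, h⟩)
  obtain ⟨R, φ, hR, hφ, hRφ⟩ := exists_subalgebra_algHom_of_evaluation
    (F := FractionRing (Polynomial F)) ev ((Subalgebra.val _).comp w)
  -- the polynomial of `θ`
  obtain ⟨q₀, hq₀, hq₀E⟩ := IsGalois.exists_monic_map_eq_prod_X_sub_C (F := F) θ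
  let P : Polynomial C := ∏ g : E ≃ₐ[F] E, (Polynomial.X - Polynomial.C ⟨η g, hηC g⟩)
  have hP₂ : P.map (i₂ : C →+* Y) = q₀.map (Polynomial.aeval ζ).toRingHom := by
    have h1 : (Polynomial.aeval ζ).toRingHom =
        (Polynomial.eval₂RingHom (i₁ : E →+* Y) ζ).comp
          (Polynomial.mapRingHom (algebraMap F E)) := by
      ext <;> simp
    rw [h1, ← Polynomial.map_map, hq₀E, Polynomial.map_prod, Polynomial.map_prod]
    refine Finset.prod_congr rfl fun g _ => ?_
    rw [Polynomial.map_sub, Polynomial.map_sub, Polynomial.map_X, Polynomial.map_X,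
      Polynomial.map_C, Polynomial.map_C]
    congr 2
    exact (hθ g).symm
  have hcoeff : ∀ n, (ev (q₀.coeff n) : Y) = i₂ (P.coeff n) := fun n => by
    rw [hev]
    have := congrArg (fun p => p.coeff n) hP₂
    simp only [Polynomial.coeff_map] at this
    exact this.symm
  have hθint : ∀ n, IsIntegral K (ev (q₀.coeff n)) := fun n => by
    rw [← isIntegral_algHom_iff (Z.val.restrictScalars K) Z.val.injective]
    change IsIntegral K (ev (q₀.coeff n) : Y)
    rw [hcoeff]
    exact (Algebra.IsIntegral.isIntegral (R := K) (P.coeff n)).map i₂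
  obtain ⟨q, hq, hqdeg, hqmon⟩ := Polynomial.lifts_and_natDegree_eq_and_monic
    (f := algebraMap R (FractionRing (Polynomial F)))
    (p := q₀.map (algebraMap (Polynomial F) (FractionRing (Polynomial F)))) (by
      rw [Polynomial.lifts_iff_coeff_lifts]
      intro n
      rw [Polynomial.coeff_map]
      obtain ⟨hr, -⟩ := hRφ _ (hθint n)
      exact ⟨⟨_, hr⟩, rfl⟩) (hq₀.map _)
  have hqL : (q.map φ.toRingHom).map (algebraMap k L) = P.map C.val.toRingHom := by
    ext n
    obtain ⟨hr, h⟩ := hRφ _ (hθint n)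
    have h1 : q.coeff n = ⟨_, hr⟩ := Subtype.ext (by
      have := congrArg (fun p => p.coeff n) hq
      simp only [Polynomial.coeff_map] at this
      exact this)
    rw [Polynomial.coeff_map, Polynomial.coeff_map, Polynomial.coeff_map, h1]
    change algebraMap k L (φ _) = (P.coeff n : L)
    rw [h]
    have h2 := hw ⟨ev (q₀.coeff n), hθint n⟩
    change m _ = (ev (q₀.coeff n) : Y) at h2
    rw [hcoeff] at h2
    exact congrArg Subtype.val (i₂.injective h2)
  have hPL : P.map C.val.toRingHom =
      ∏ g : E ≃ₐ[F] E, (Polynomial.X - Polynomial.C (η g)) := by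
    rw [Polynomial.map_prod]
    refine Finset.prod_congr rfl fun g _ => ?_
    rw [Polynomial.map_sub, Polynomial.map_X, Polynomial.map_C]
    rfl
  -- generators of the base field
  let s : Polynomial F := minpoly F ζ
  have hs : algebraMap (Polynomial F) (FractionRing (Polynomial F)) s ≠ 0 := by
    rw [Ne, IsFractionRing.to_map_eq_zero_iff]
    exact minpoly.ne_zero hζ
  have hsR : ∀ t, algebraMap (Polynomial F) (FractionRing (Polynomial F)) (s * t) ∈ R := by
    intro t
    have : ev (s * t) = 0 := by
      apply Subtype.ext
      rw [hev, map_mul, minpoly.aeval, zero_mul]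
      rfl
    exact (hRφ (s * t) (by rw [this]; exact isIntegral_zero)).1
  let S : Finset (FractionRing (Polynomial F)) :=
    {algebraMap _ _ (s * 1), algebraMap _ _ (s * Polynomial.C b),
      algebraMap _ _ (s * Polynomial.X)}
  have hSR : (S : Set (FractionRing (Polynomial F))) ⊆ R := by
    intro x hx
    simp only [S, Finset.coe_insert, Finset.coe_singleton, Set.mem_insert_iff,
      Set.mem_singleton_iff] at hx
    rcases hx with rfl | rfl | rfl <;> exact hsR _
  have htop : IntermediateField.adjoin K (S : Set (FractionRing (Polynomial F))) = ⊤ := by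
    have h1 : ∀ t, algebraMap (Polynomial F) (FractionRing (Polynomial F)) (s * t) ∈
        (S : Set (FractionRing (Polynomial F))) →
        algebraMap (Polynomial F) (FractionRing (Polynomial F)) t ∈
          IntermediateField.adjoin K (S : Set (FractionRing (Polynomial F))) := by
      intro t ht
      have h2 := IntermediateField.subset_adjoin K _ ht
      have h3 : algebraMap (Polynomial F) (FractionRing (Polynomial F)) (s * 1) ∈
          IntermediateField.adjoin K (S : Set (FractionRing (Polynomial F))) :=
        IntermediateField.subset_adjoin K _ (by simp [S])
      have h4 := div_mem h2 h3
      rwa [map_mul, map_mul, map_one, mul_one, mul_div_cancel_left₀ _ hs] at h4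
    exact IntermediateField.adjoin_fractionRing_polynomial_eq_top hb _
      (h1 _ (by simp [S])) (h1 _ (by simp [S]))
  have hcard : q.natDegree = Module.finrank (FractionRing (Polynomial F)) E' := by
    rw [hqdeg, hq₀.natDegree_map, ← IsGalois.card_aut_eq_finrank, ← Nat.card_congr e.toEquiv,
      ← hq₀.natDegree_map (Polynomial.mapRingHom (algebraMap F E)), hq₀E,
      Polynomial.natDegree_finsetProd_X_sub_C_eq_card, Finset.card_univ, Nat.card_eq_fintype_card]
  refine IsSpecialization.of_root R hR φ hφ S hSR htop (j θ) ?_ q hqmon hcard ?_ ?_ (η 1) ?_ ?_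
  · rw [IsGalois.adjoin_simple_eq_top_iff_injective]
    intro h h' hh
    obtain ⟨g, rfl⟩ := e.surjective h
    obtain ⟨g', rfl⟩ := e.surjective h'
    simp only [hje] at hh
    have h1 := hθ g
    rw [hj hh, hθ g'] at h1
    exact congrArg e (hηinj (congrArg Subtype.val (i₂.injective h1))).symm
  · rw [← Polynomial.eval₂_map, hq, Polynomial.eval₂_map]
    have h1 : (algebraMap (FractionRing (Polynomial F)) E').comp
        (algebraMap (Polynomial F) (FractionRing (Polynomial F))) =
        j.comp (Polynomial.mapRingHom (algebraMap F E)) := RingHom.ext fun p => (hjF p).symm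
    rw [h1, ← Polynomial.eval₂_map, hq₀E, Polynomial.eval₂_at_apply, Polynomial.eval_prod,
      Finset.prod_eq_zero (Finset.mem_univ 1), map_zero]
    rw [show ((1 : E ≃ₐ[F] E) : E →+* E) = RingHom.id E from rfl, Polynomial.map_id]
    simp
  · rw [← Polynomial.separable_map (algebraMap k L), hqL, hPL]
    exact Polynomial.separable_prod_X_sub_C_iff.2 hηinj
  · rw [Polynomial.aeval_def, ← Polynomial.eval_map, hqL, hPL, Polynomial.eval_prod,
      Finset.prod_eq_zero (Finset.mem_univ 1)]
    simp
  · rw [← IntermediateField.adjoin_simple_toSubalgebra_of_isAlgebraic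
      (Algebra.IsAlgebraic.isAlgebraic (η 1)), hηgen, IntermediateField.top_toSubalgebra]

theorem algebraicIndependent_fractionRing_polynomial {K F : Type*} [Field K] [Field F]
    [Algebra K F] {b : F} (hb : Transcendental K b) :
    AlgebraicIndependent K ![algebraMap F (FractionRing (Polynomial F)) b,
      algebraMap (Polynomial F) (FractionRing (Polynomial F)) Polynomial.X] := by
  have hX : Transcendental F
      (algebraMap (Polynomial F) (FractionRing (Polynomial F)) Polynomial.X) :=
    (transcendental_algebraMap_iff (IsFractionRing.injective (Polynomial F) _)).2
      (Polynomial.transcendental_X F)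
  have hx : AlgebraicIndependent K fun _ : Unit => b := algebraicIndependent_unique_type_iff.2 hb
  have hy : AlgebraicIndependent F fun _ : Unit =>
      algebraMap (Polynomial F) (FractionRing (Polynomial F)) Polynomial.X :=
    algebraicIndependent_unique_type_iff.2 hX
  have h := (hx.sumElim_comp hy).comp ![Sum.inr (), Sum.inl ()] (by
    intro i i' h
    fin_cases i <;> fin_cases i' <;> simp at h ⊢)
  convert h using 1
  ext i
  fin_cases i <;> rfl

/-- Part (2a) of the Main Theorem: if `G` admits a generic extension over the number field
`K` (a finite Galois extension of a rational function field `K(x₁,…,x_m)` with group `G`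
specializing to every finite Galois extension, with group embedding into `G`, of every
overfield of `K`), then the base field `F` of part (1) may be taken to be the rational
function field `K(x,y)` in two variables. -/
theorem local_dimension_le_two_rational (K : Type) [Field K] [NumberField K]
    (G : Type) [Group G] [Finite G]
    (hgen : ∃ (m : ℕ) (F₀ : Type) (_ : Field F₀) (_ : Algebra K F₀) (x : Fin m → F₀),
      AlgebraicIndependent K x ∧ IntermediateField.adjoin K (Set.range x) = ⊤ ∧
      ∃ (E₀ : Type) (_ : Field E₀) (_ : Algebra F₀ E₀),
        FiniteDimensional F₀ E₀ ∧ IsGalois F₀ E₀ ∧ Nonempty ((E₀ ≃ₐ[F₀] E₀) ≃* G) ∧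
        ∀ (Ω : Type) (_ : Field Ω) (_ : Algebra K Ω) (M : Type) (_ : Field M)
          (_ : Algebra Ω M),
          FiniteDimensional Ω M → IsGalois Ω M →
          (∃ f : (M ≃ₐ[Ω] M) →* G, Function.Injective f) →
          IsSpecialization K F₀ E₀ Ω M) :
    ∃ (F : Type) (_ : Field F) (_ : Algebra K F) (x y : F),
      AlgebraicIndependent K ![x, y] ∧ IntermediateField.adjoin K {x, y} = ⊤ ∧
      ∃ (E : Type) (_ : Field E) (_ : Algebra F E),
        FiniteDimensional F E ∧ IsGalois F E ∧ Nonempty ((E ≃ₐ[F] E) ≃* G) ∧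
        ∃ T : Finset (HeightOneSpectrum (𝓞 K)),
          ∀ v : HeightOneSpectrum (𝓞 K), v ∉ T →
            ∀ (L : Type) (_ : Field L) (_ : Algebra (v.adicCompletion K) L),
              FiniteDimensional (v.adicCompletion K) L →
              IsGalois (v.adicCompletion K) L →
              (∃ f : (L ≃ₐ[v.adicCompletion K] L) →* G, Function.Injective f) →
              IsSpecialization K F E (v.adicCompletion K) L := by
  obtain ⟨m, F₀, _, _, x, hx, hxtop, E₀, _, _, _, _, ⟨ε₀⟩, hspec⟩ := hgen
  let : Algebra K E₀ := ((algebraMap F₀ E₀).comp (algebraMap K F₀)).toAlgebra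
  have : IsScalarTower K F₀ E₀ := IsScalarTower.of_algebraMap_eq fun _ => rfl
  have : IsIntegrallyClosedIn K E₀ := by
    obtain ⟨M, _, _, Ω, hfin, hgal, ⟨ε⟩, _⟩ := exists_isGalois_mulEquiv_isIntegrallyClosedIn K G
    exact (hspec Ω inferInstance inferInstance M inferInstance inferInstance hfin hgal
      ⟨ε.toMonoidHom, ε.injective⟩).isIntegrallyClosedIn
  obtain ⟨E₁, _, _, _, _, _, _, ⟨ε₁⟩, _⟩ :=
    exists_isGalois_isIntegrallyClosedIn_fractionRing (E₀ := E₀) x hx hxtop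
  obtain ⟨E, _, _, _, _, j, e, hj, hjF, hje⟩ :=
    IsGalois.exists_fractionRing_polynomial (FractionRing (Polynomial K)) E₁
  let b : FractionRing (Polynomial K) := algebraMap (Polynomial K) _ Polynomial.X
  have hb : IntermediateField.adjoin K {b} = ⊤ :=
    IntermediateField.adjoin_fractionRing_polynomial_eq_top (b := (0 : K)) (Subsingleton.elim _ _) _
      (by rw [map_zero, map_zero]; exact zero_mem _)
      (IntermediateField.mem_adjoin_simple_self K b)
  have hbt : Transcendental K b :=
    (transcendental_algebraMap_iff (IsFractionRing.injective (Polynomial K) _)).2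
      (Polynomial.transcendental_X K)
  refine ⟨FractionRing (Polynomial (FractionRing (Polynomial K))), inferInstance, inferInstance,
    _, _, algebraicIndependent_fractionRing_polynomial hbt,
    IntermediateField.adjoin_fractionRing_polynomial_eq_top hb _
      (IntermediateField.subset_adjoin K _ (Set.mem_insert _ _))
      (IntermediateField.subset_adjoin K _ (Set.mem_insert_of_mem _ rfl)),
    E, inferInstance, inferInstance, inferInstance, inferInstance,
    ⟨(e.symm.trans ε₁).trans ε₀⟩, ∅, ?_⟩
  rintro v - L _ _ _ _ ⟨f, hf⟩
  obtain ⟨α, ⟨g, hg, hgα⟩, hα⟩ := HeightOneSpectrum.exists_adjoin_eq_top_adicCompletion v L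
  let : Algebra K L := ((algebraMap (v.adicCompletion K) L).comp (algebraMap K _)).toAlgebra
  have : IsScalarTower K (v.adicCompletion K) L := IsScalarTower.of_algebraMap_eq fun _ => rfl
  refine IsSpecialization.fractionRing_polynomial hb j e hj hjF hje
    ((ε₁.trans ε₀).symm.toMonoidHom.comp f) ((ε₁.trans ε₀).symm.injective.comp hf) α
    ⟨g, hg, ?_⟩ hα
  rw [Polynomial.aeval_map_algebraMap] at hgα
  exact hgα
end

section
/- Let K be a number field, G a finite group, v a prime of K, and L₀ a finite Galois field extension of the completion K_v whose Galois group is isomorphic to a subgroup of G. Then there exist a finite field extension K' of K, a prime v' of K' lying over v such that the natural embedding of K_v into the completion K'_{v'} is an isomorphism, and a finite Galois field extension L of K' with Galois group isomorphic to G, together with a prime w of L lying over v', such that the completion L_w of L at w is isomorphic to L₀ as a K_v-algebra (where L_w is regarded as a K_v-algebra via the isomorphism K_v ≅ K'_{v'}). -/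
open IsDedekindDomain NumberField

section

open Polynomial

theorem exists_injective_equivariant_map {F M ι : Type*} [Field F] [Infinite F] [Field M]
    [Algebra F M] [FiniteDimensional F M] [Finite ι] (ρ : (M ≃ₐ[F] M) →* Equiv.Perm ι) :
    ∃ x : ι → M, Function.Injective x ∧ ∀ σ i, σ (x i) = x (ρ σ i) := by
  classical
  have := Fintype.ofFinite ι
  let V : Submodule F (ι → M) :=
    { carrier := {x | ∀ σ i, σ (x i) = x (ρ σ i)}
      add_mem' := fun hx hy σ i => by simp [hx σ i, hy σ i]
      zero_mem' := fun σ i => by simp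
      smul_mem' := fun c x hx σ i => by simp [hx σ i] }
  let D : ι × ι → Submodule F V := fun p =>
    LinearMap.ker (((LinearMap.proj p.1 : (ι → M) →ₗ[F] M) - LinearMap.proj p.2) ∘ₗ V.subtype)
  let s : Finset (Submodule F V) := (Finset.univ.filter fun p : ι × ι => p.1 ≠ p.2).image D
  have hs : ⊤ ∉ s := by
    intro h
    obtain ⟨⟨i, j⟩, hij, hD⟩ := Finset.mem_image.mp h
    have hij : i ≠ j := by simpa using hij
    have key : ∀ y : M, ∑ σ : M ≃ₐ[F] M, ((if ρ σ i = i then (1 : M) else 0) -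
        (if ρ σ i = j then 1 else 0)) * σ y = 0 := by
      intro y
      let x : ι → M := fun k => ∑ σ : M ≃ₐ[F] M, if ρ σ i = k then σ y else 0
      have hx : x ∈ V := by
        intro τ k
        simp only [x, map_sum]
        refine Fintype.sum_equiv (Equiv.mulLeft τ) _ _ fun σ => ?_
        simp [apply_ite τ]
      have : (⟨x, hx⟩ : V) ∈ D (i, j) := hD ▸ Submodule.mem_top
      simpa [D, x, sub_mul, Finset.sum_sub_distrib] using this
    have hli := linearIndependent_monoidHom M M
    have hli' : LinearIndependent M (fun σ : M ≃ₐ[F] M => ((σ : M →* M) : M → M)) :=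
      hli.comp (fun σ : M ≃ₐ[F] M => (σ : M →* M)) fun σ τ h => by
        ext y; exact DFunLike.congr_fun h y
    have h0 := Fintype.linearIndependent_iff.mp hli' _ (by
      ext y
      simpa using key y) 1
    simp [hij] at h0
  obtain ⟨x, hx⟩ := (Set.ne_univ_iff_exists_notMem _).mp
    (Subspace.biUnion_ne_univ_of_top_notMem hs)
  refine ⟨x.1, fun i j hij => ?_, x.2⟩
  by_contra hne
  refine hx (Set.mem_biUnion (x := D (i, j)) (Finset.mem_image_of_mem _ (by simpa using hne)) ?_)
  simp [D, hij]

theorem exists_map_eq_prod_X_sub_C_of_permuted {F M ι : Type*} [Field F] [Field M] [Algebra F M]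
    [IsGalois F M] [Fintype ι] (x : ι → M)
    (hx : ∀ σ : M ≃ₐ[F] M, ∃ π : Equiv.Perm ι, ∀ i, σ (x i) = x (π i)) :
    ∃ f : F[X], f.map (algebraMap F M) = ∏ i, (X - C (x i)) := by
  suffices h : (∏ i, (X - C (x i))) ∈ lifts (algebraMap F M) from (mem_lifts _).mp h
  rw [lifts_iff_coeff_lifts]
  intro n
  have hfix : ((∏ i, (X - C (x i))).coeff n) ∈ (⊥ : IntermediateField F M) := by
    rw [InfiniteGalois.mem_bot_iff_fixed]
    intro σ
    obtain ⟨π, hπ⟩ := hx σ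
    have : (∏ i, (X - C (x i))).map (σ : M →+* M) = ∏ i, (X - C (x i)) := by
      rw [Polynomial.map_prod, ← Equiv.prod_comp π fun i => X - C (x i)]
      simp [hπ]
    conv_rhs => rw [← this]
    simp [coeff_map]
  exact IntermediateField.mem_bot.mp hfix

/-- **Krasner's lemma for polynomials.** -/
theorem exists_pos_forall_exists_roots {F M ι : Type*} [NontriviallyNormedField F]
    [CompleteSpace F] [IsUltrametricDist F] [CharZero F] [Field M] [Algebra F M] [IsGalois F M]
    [Fintype ι] (x : ι → M) (hx : Function.Injective x) (f : F[X])
    (hf : f.map (algebraMap F M) = ∏ i, (X - C (x i))) :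
    ∃ ε > 0, ∀ g : F[X], g.Monic → g.natDegree = f.natDegree →
      (∀ n, ‖g.coeff n - f.coeff n‖ < ε) →
      ∃ z : ι → M, Function.Injective z ∧ g.map (algebraMap F M) = ∏ i, (X - C (z i)) ∧
        ∀ (σ : M ≃ₐ[F] M) (i j : ι), σ (x i) = x j → σ (z i) = z j := by
  classical
  have : CharZero M := charZero_of_injective_algebraMap (algebraMap F M).injective
  let Ω := AlgebraicClosure M
  have : Algebra.IsAlgebraic F Ω := Algebra.IsAlgebraic.trans F M Ω
  let : NormedField Ω := spectralNorm.normedField F Ω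
  let : NormedAlgebra F Ω := spectralNorm.normedAlgebra F Ω
  have : IsUltrametricDist Ω := IsUltrametricDist.of_normedAlgebra F
  have hiso : ∀ (σ : Ω ≃ₐ[F] Ω) (y : Ω), ‖σ y‖ = ‖y‖ := fun σ y => by
    rw [NormedAlgebra.norm_eq_spectralNorm F, NormedAlgebra.norm_eq_spectralNorm F]
    exact (spectralNorm_eq_of_equiv σ y).symm
  let X₀ : ι → Ω := fun i => algebraMap M Ω (x i)
  have hX : Function.Injective X₀ := (algebraMap M Ω).injective.comp hx
  have hfm : f.Monic := by
    rw [(algebraMap F M).injective.monic_map_iff, hf]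
    exact monic_prod_of_monic _ _ fun i _ => monic_X_sub_C _
  have hfd : f.natDegree = Fintype.card ι := by
    rw [← natDegree_map (algebraMap F M), hf,
      natDegree_prod_of_monic _ _ fun i _ => monic_X_sub_C _]
    simp
  obtain ⟨δ, hδ, hδx⟩ : ∃ δ > 0, ∀ i j, ‖X₀ i - X₀ j‖ < δ → i = j := by
    have : ∀ᶠ δ in nhdsWithin (0 : ℝ) (Set.Ioi 0), ∀ i j, ‖X₀ i - X₀ j‖ < δ → i = j := by
      rw [Filter.eventually_all]; intro i
      rw [Filter.eventually_all]; intro j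
      by_cases hij : i = j
      · simp [hij]
      · have : 0 < ‖X₀ i - X₀ j‖ := norm_pos_iff.mpr (sub_ne_zero.mpr (hX.ne hij))
        filter_upwards [nhdsWithin_le_nhds (Iio_mem_nhds this)] with d hd h
        exact absurd h (not_lt.mpr (le_of_lt hd))
    obtain ⟨δ, h1, h2⟩ := (this.and self_mem_nhdsWithin).exists
    exact ⟨δ, h2, h1⟩
  obtain ⟨ε, hε, hεx⟩ : ∃ ε > 0, ∀ i,
      ((f.natDegree + 1) * ε) ^ (f.natDegree : ℝ)⁻¹ * max ‖X₀ i‖ 1 < δ := by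
    have : ∀ᶠ ε in nhdsWithin (0 : ℝ) (Set.Ioi 0), ∀ i,
      ((f.natDegree + 1) * ε) ^ (f.natDegree : ℝ)⁻¹ * max ‖X₀ i‖ 1 < δ := by
      rw [Filter.eventually_all]; intro i
      have hpos : (0 : ℝ) < (f.natDegree : ℝ)⁻¹ := by
        rw [hfd]; have : 0 < Fintype.card ι := Fintype.card_pos_iff.mpr ⟨i⟩
        positivity
      have hc : Filter.Tendsto (fun ε : ℝ => ((f.natDegree + 1) * ε) ^ (f.natDegree : ℝ)⁻¹ *
          max ‖X₀ i‖ 1) (nhds 0) (nhds (((f.natDegree + 1) * 0) ^ (f.natDegree : ℝ)⁻¹ *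
          max ‖X₀ i‖ 1)) := by
        refine Filter.Tendsto.mul_const _ (Filter.Tendsto.rpow_const ?_ (Or.inr hpos.le))
        exact Filter.Tendsto.const_mul _ Filter.tendsto_id
      rw [mul_zero, Real.zero_rpow hpos.ne', zero_mul] at hc
      exact nhdsWithin_le_nhds (hc.eventually (gt_mem_nhds hδ))
    obtain ⟨ε, h1, h2⟩ := (this.and self_mem_nhdsWithin).exists
    exact ⟨ε, h2, h1⟩
  refine ⟨ε, hε, fun g hgm hgd hgf => ?_⟩
  have hroot : ∀ i, ∃ b ∈ g.aroots Ω, ‖X₀ i - b‖ < δ := by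
    intro i
    have ha : f.aeval (X₀ i) = 0 := by
      have : f.aeval (x i) = 0 := by
        rw [← eval_map_algebraMap, hf, eval_prod]
        exact Finset.prod_eq_zero (Finset.mem_univ i) (by simp)
      rw [aeval_algebraMap_apply, this, map_zero]
    obtain ⟨b, hb, hb'⟩ := exists_aroots_norm_sub_lt_of_norm_coeff_sub_lt hε ha hfm hgm hgd hgf
      (IsAlgClosed.splits _)
    exact ⟨b, hb, hb'.trans (hεx i)⟩
  choose w hw hwx using hroot
  have hnear : ∀ (a b c : Ω), ‖a - b‖ < δ → ‖c - b‖ < δ → ‖a - c‖ < δ := by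
    intro a b c h1 h2
    have : a - c = (a - b) + (b - c) := by ring
    rw [this]
    exact (IsUltrametricDist.norm_add_le_max _ _).trans_lt
      (max_lt h1 (by rwa [norm_sub_rev]))
  have hwi : Function.Injective w := fun i j hij =>
    hδx i j (hnear _ (w i) _ (hwx i) (hij ▸ hwx j))
  have hgprod : g.map (algebraMap F Ω) = ∏ i, (X - C (w i)) := by
    have hdvd : (∏ i, (X - C (w i))) ∣ g.map (algebraMap F Ω) := by
      refine Finset.prod_dvd_of_coprime (fun i _ j _ hij => ?_) fun i _ => ?_
      · exact pairwise_coprime_X_sub_C hwi hij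
      · exact dvd_iff_isRoot.mpr (isRoot_of_mem_roots (hw i))
    refine (eq_of_monic_of_dvd_of_natDegree_le (monic_prod_of_monic _ _ fun i _ => monic_X_sub_C _)
      (hgm.map _) hdvd ?_)
    rw [natDegree_map, natDegree_prod_of_monic _ _ fun i _ => monic_X_sub_C _, hgd, hfd]
    simp
  have hequiv : ∀ (σ : Ω ≃ₐ[F] Ω) (i j : ι), σ (X₀ i) = X₀ j → σ (w i) = w j := by
    intro σ i j hij
    have h0 : (g.map (algebraMap F Ω)).eval (σ (w i)) = 0 := by
      have : g.aeval (w i) = 0 := (mem_aroots.mp (hw i)).2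
      rw [eval_map_algebraMap, ← AlgEquiv.coe_toAlgHom, aeval_algHom_apply, this, map_zero]
    rw [hgprod, eval_prod, Finset.prod_eq_zero_iff] at h0
    obtain ⟨k, -, hk⟩ := h0
    have hk : σ (w i) = w k := by simpa [sub_eq_zero] using hk
    have : ‖X₀ j - w k‖ < δ := by rw [← hk, ← hij, ← map_sub, hiso]; exact hwx i
    rw [hk, hδx j k (hnear _ (w k) _ this (hwx k))]
  have hdesc : ∀ i, ∃ z : M, algebraMap M Ω z = w i := by
    intro i
    have : w i ∈ (⊥ : IntermediateField M Ω) := by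
      rw [InfiniteGalois.mem_bot_iff_fixed]
      intro σ
      exact hequiv (σ.restrictScalars F) i i (by simp [X₀])
    exact IntermediateField.mem_bot.mp this
  choose z hz using hdesc
  refine ⟨z, fun i j hij => hwi (by rw [← hz, ← hz, hij]), ?_, fun σ i j hij => ?_⟩
  · apply Polynomial.map_injective _ (algebraMap M Ω).injective
    rw [Polynomial.map_map, ← IsScalarTower.algebraMap_eq, hgprod, Polynomial.map_prod]
    simp [hz]
  · apply (algebraMap M Ω).injective
    have := hequiv (σ.liftNormal Ω) i j (by simp [X₀, AlgEquiv.liftNormal_commutes, hij])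
    rwa [← hz, ← hz, AlgEquiv.liftNormal_commutes] at this

theorem exists_algHom_apply_roots {K T ι : Type*} [Field K] [Field T] [Algebra K T] [Fintype ι]
    (g : K[X]) (z : ι → T) (hg : g.map (algebraMap K T) = ∏ i, (X - C (z i))) :
    ∃ (φ : g.SplittingField →ₐ[K] T) (y : ι → g.SplittingField), (∀ i, φ (y i) = z i) ∧
      g.map (algebraMap K g.SplittingField) = ∏ i, (X - C (y i)) := by
  have hs : (g.map (algebraMap K T)).Splits := by
    rw [hg]
    exact Splits.prod fun i _ => Splits.X_sub_C _
  let φ : g.SplittingField →ₐ[K] T := SplittingField.lift g hs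
  have hg0 : g ≠ 0 := by
    rintro rfl
    rw [Polynomial.map_zero] at hg
    exact (monic_prod_of_monic _ _ fun i _ => monic_X_sub_C (z i)).ne_zero hg.symm
  have hy : ∀ i, ∃ y, φ y = z i := by
    intro i
    have h1 : z i ∈ g.rootSet T := by
      rw [mem_rootSet_of_ne hg0, ← eval_map_algebraMap, hg, eval_prod]
      exact Finset.prod_eq_zero (Finset.mem_univ i) (by simp)
    rw [← (SplittingField.splits g).image_rootSet φ] at h1
    obtain ⟨y, -, hy⟩ := h1
    exact ⟨y, hy⟩
  choose y hy using hy
  refine ⟨φ, y, hy, ?_⟩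
  apply Polynomial.map_injective (φ : g.SplittingField →+* T) φ.toRingHom.injective
  rw [Polynomial.map_map, AlgHom.comp_algebraMap, hg, Polynomial.map_prod]
  simp [hy]

theorem exists_algEquiv_apply_algHom {K E T : Type*} [Field K] [Field E] [Field T] [Algebra K E]
    [Algebra K T] [Normal K E] (φ : E →ₐ[K] T) (σ : T ≃ₐ[K] T) :
    ∃ τ : E ≃ₐ[K] E, ∀ y, φ (τ y) = σ (φ y) := by
  let : Algebra E T := φ.toAlgebra
  have : IsScalarTower K E T := .of_algebraMap_eq fun k => (φ.commutes k).symm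
  exact ⟨σ.restrictNormal E, fun y => σ.restrictNormal_commutes E y⟩

theorem forall_perm_exists_algEquiv_of_transitive_of_swap {K E ι : Type*} [Field K] [Field E]
    [Algebra K E] [Fintype ι] [DecidableEq ι] (hp : (Fintype.card ι).Prime) (y : ι → E)
    (htrans : ∀ i j, ∃ τ : E ≃ₐ[K] E, (∀ k, ∃ l, τ (y k) = y l) ∧ τ (y i) = y j)
    (hy : Function.Injective y) {a b : ι} (hab : a ≠ b)
    (hswap : ∃ τ : E ≃ₐ[K] E, ∀ i, τ (y i) = y (Equiv.swap a b i)) (π : Equiv.Perm ι) :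
    ∃ τ : E ≃ₐ[K] E, ∀ i, τ (y i) = y (π i) := by
  classical
  let P : Subgroup (Equiv.Perm ι) :=
    { carrier := {π | ∃ τ : E ≃ₐ[K] E, ∀ i, τ (y i) = y (π i)}
      mul_mem' := by
        rintro π₁ π₂ ⟨τ₁, h₁⟩ ⟨τ₂, h₂⟩
        exact ⟨τ₁ * τ₂, fun i => by simp [h₁, h₂]⟩
      one_mem' := ⟨1, fun i => by simp⟩
      inv_mem' := by
        rintro π ⟨τ, h⟩
        refine ⟨τ⁻¹, fun i => ?_⟩
        rw [AlgEquiv.aut_inv, AlgEquiv.symm_apply_eq, h]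
        exact congrArg y (π.apply_symm_apply i).symm }
  suffices hP : P = ⊤ by
    have : π ∈ P := hP ▸ Subgroup.mem_top π
    exact this
  have : MulAction.IsPretransitive P ι := by
    refine ⟨fun i j => ?_⟩
    obtain ⟨τ, hτ, hij⟩ := htrans i j
    choose f hf using hτ
    have hfi : Function.Injective f := fun k l h => hy (τ.injective (by rw [hf, hf, h]))
    refine ⟨⟨Equiv.ofBijective f (Finite.injective_iff_bijective.mp hfi), τ, fun k => hf k⟩, ?_⟩
    exact hy (by rw [← hij, hf]; rfl)
  refine Equiv.Perm.subgroup_eq_top_of_swap_mem hp ?_ (τ := Equiv.swap a b) hswap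
    ⟨a, b, hab, rfl⟩
  rw [← Nat.card_eq_fintype_card, ← Nat.card_eq_fintype_card,
    ← MulAction.index_stabilizer_of_transitive P a]
  exact Subgroup.index_dvd_card _

theorem algHom_ext_of_adjoin_range_eq_top {K E T ι : Type*} [Field K] [Field E] [Field T]
    [Algebra K E] [Algebra K T] (y : ι → E) (hy : IntermediateField.adjoin K (Set.range y) = ⊤)
    {φ ψ : E →ₐ[K] T} (h : ∀ i, φ (y i) = ψ (y i)) : φ = ψ := by
  ext x
  have hx : x ∈ IntermediateField.adjoin K (Set.range y) := hy ▸ IntermediateField.mem_top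
  induction hx using IntermediateField.adjoin_induction with
  | mem x hx => obtain ⟨i, rfl⟩ := hx; exact h i
  | algebraMap x => simp
  | add x z _ _ hx hz => simp [hx, hz]
  | inv x _ hx => simp [hx]
  | mul x z _ _ hx hz => simp [hx, hz]

theorem exists_monoidHom_algEquiv_of_forall_perm {K E ι : Type*} [Field K] [Field E] [Algebra K E]
    (y : ι → E) (hy : IntermediateField.adjoin K (Set.range y) = ⊤)
    (h : ∀ π : Equiv.Perm ι, ∃ τ : E ≃ₐ[K] E, ∀ i, τ (y i) = y (π i)) :
    ∃ Φ : Equiv.Perm ι →* (E ≃ₐ[K] E), ∀ π i, Φ π (y i) = y (π i) := by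
  choose Φ hΦ using h
  refine ⟨MonoidHom.mk' Φ fun π₁ π₂ => ?_, hΦ⟩
  have : ((Φ (π₁ * π₂) : E ≃ₐ[K] E) : E →ₐ[K] E) = ((Φ π₁ * Φ π₂ : E ≃ₐ[K] E) : E →ₐ[K] E) := by
    exact algHom_ext_of_adjoin_range_eq_top y hy fun i => by simp [hΦ]
  exact AlgEquiv.ext fun x => DFunLike.congr_fun this x

theorem exists_roots_X_pow_sub_C_of_prime {F Ω : Type*} [Field F] [CharZero F] [Field Ω]
    [Algebra F Ω] [IsAlgClosure F Ω] {p : ℕ} (hp : p.Prime) (a : F) (ha : ∀ b, b ^ p ≠ a) :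
    ∃ x : Fin p → Ω, Function.Injective x ∧
      (X ^ p - C a : F[X]).map (algebraMap F Ω) = ∏ i, (X - C (x i)) ∧
      ∀ i j, ∃ σ : Ω ≃ₐ[F] Ω, σ (x i) = x j := by
  classical
  have hirr := X_pow_sub_C_irreducible_of_prime hp ha
  have hm : (X ^ p - C a : F[X]).Monic := monic_X_pow_sub_C a hp.ne_zero
  have : IsAlgClosed Ω := IsAlgClosure.isAlgClosed F
  have : Algebra.IsAlgebraic F Ω := IsAlgClosure.isAlgebraic
  have : Normal F Ω := IsAlgClosure.normal F Ω
  set f := (X ^ p - C a : F[X]) with hf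
  have hsep : (f.map (algebraMap F Ω)).Separable := hirr.separable.map
  have hsplit : (f.map (algebraMap F Ω)).Splits := IsAlgClosed.splits _
  have hnd : (f.aroots Ω).Nodup := nodup_roots hsep
  have hcard : (f.aroots Ω).toFinset.card = p := by
    rw [Multiset.toFinset_card_of_nodup hnd, aroots_def, ← hsplit.natDegree_eq_card_roots,
      natDegree_map, hf, natDegree_X_pow_sub_C]
  let e := ((f.aroots Ω).toFinset.equivFinOfCardEq hcard).symm
  have hroot : ∀ i, f.aeval (e i : Ω) = 0 := fun i =>
    (mem_aroots.mp (Multiset.mem_toFinset.mp (e i).2)).2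
  refine ⟨fun i => e i, Subtype.val_injective.comp e.injective, ?_, fun i j => ?_⟩
  · rw [hsplit.eq_prod_roots_of_monic (hm.map _)]
    rw [Equiv.prod_comp e fun b => (X - C (b : Ω))]
    rw [Finset.prod_coe_sort (f.aroots Ω).toFinset fun b => X - C b, Finset.prod,
      Multiset.toFinset_val, Multiset.dedup_eq_self.mpr hnd]
  · have hc : IsConjRoot F (e i : Ω) (e j) := by
      rw [IsConjRoot, ← minpoly.eq_of_irreducible_of_monic hirr (hroot i) hm,
        ← minpoly.eq_of_irreducible_of_monic hirr (hroot j) hm]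
    obtain ⟨σ, hσ⟩ := isConjRoot_iff_exists_algEquiv.mp hc.symm
    exact ⟨σ, hσ⟩

theorem exists_roots_with_swap {F Ω : Type*} [Field F] [CharZero F] [Field Ω] [Algebra F Ω]
    [IsAlgClosure F Ω] (m : ℕ) (a : F) (ha : ∀ b, b ^ 2 ≠ a) :
    ∃ (x : Fin (m + 2) → Ω) (f : F[X]), Function.Injective x ∧
      f.map (algebraMap F Ω) = ∏ i, (X - C (x i)) ∧
      ∃ σ : Ω ≃ₐ[F] Ω, ∀ i, σ (x i) = x (Equiv.swap 0 1 i) := by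
  obtain ⟨s, hs, hprod, htr⟩ := exists_roots_X_pow_sub_C_of_prime (Ω := Ω) Nat.prime_two a ha
  obtain ⟨σ, hσ⟩ := htr 0 1
  have : CharZero Ω := charZero_of_injective_algebraMap (algebraMap F Ω).injective
  have hroot : ∀ i, s i ^ 2 = algebraMap F Ω a := by
    intro i
    have h : ((X ^ 2 - C a : F[X]).map (algebraMap F Ω)).eval (s i) = 0 := by
      rw [hprod, eval_prod]
      exact Finset.prod_eq_zero (Finset.mem_univ i) (by simp)
    simpa [sub_eq_zero] using h
  have hne : ∀ (i : Fin 2) (c : F), s i ≠ algebraMap F Ω c := by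
    intro i c h
    refine ha c ((algebraMap F Ω).injective ?_)
    rw [map_pow, ← h, hroot]
  have hσ1 : σ (s 1) = s 0 := by
    have h01 : s 0 ≠ s 1 := hs.ne (by decide)
    have h1 : s 0 = - s 1 := by
      rcases sq_eq_sq_iff_eq_or_eq_neg.mp ((hroot 0).trans (hroot 1).symm) with h | h
      · exact absurd h h01
      · exact h
    rw [← neg_eq_iff_eq_neg.mpr h1, map_neg, hσ, h1]
  refine ⟨Fin.cons (s 0) (Fin.cons (s 1) fun i : Fin m => algebraMap F Ω (i : ℕ)),
    (X ^ 2 - C a) * ∏ i : Fin m, (X - C ((i : ℕ) : F)), ?_, ?_, σ, ?_⟩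
  · rw [Fin.cons_injective_iff, Fin.cons_injective_iff]
    refine ⟨?_, ?_, fun i j h => ?_⟩
    · rintro ⟨i, hi⟩
      induction i using Fin.cases with
      | zero => exact hs.ne (by decide : (1 : Fin 2) ≠ 0) hi
      | succ i => exact hne 0 _ hi.symm
    · rintro ⟨i, hi⟩
      exact hne 1 _ hi.symm
    · simpa [Fin.val_inj] using h
  · rw [Polynomial.map_mul, hprod, Polynomial.map_prod, Fin.prod_univ_two, mul_assoc]
    conv_rhs => rw [Fin.prod_univ_succ, Fin.prod_univ_succ]
    simp
  · intro i
    induction i using Fin.cases with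
    | zero => simpa using hσ
    | succ i =>
      induction i using Fin.cases with
      | zero => simpa using hσ1
      | succ i =>
        rw [Equiv.swap_apply_of_ne_of_ne (by simp) (by simp [Fin.ext_iff])]
        simp

section

variable {R E T : Type*} [CommRing R] [IsDedekindDomain R] [Field E] [Algebra R E]
  [IsFractionRing R E] [NormedField T]

theorem norm_map_le_one_of_valuation_le_one (w : HeightOneSpectrum R) (f : E →+* T)
    (hf : ∀ a : R, ‖f (algebraMap R E a)‖ ≤ 1)
    (hw : ∀ a : R, a ∈ w.asIdeal ↔ ‖f (algebraMap R E a)‖ < 1) {x : E}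
    (hx : w.valuation E x ≤ 1) : ‖f x‖ ≤ 1 := by
  obtain ⟨n, d, h⟩ := w.exists_primeCompl_mul_eq_of_integer x hx
  have hd : ‖f (algebraMap R E d)‖ = 1 :=
    le_antisymm (hf _) (not_lt.mp fun h => d.2 ((hw _).mpr h))
  have := hf n
  rwa [← h, map_mul, norm_mul, hd, mul_one] at this

theorem continuous_of_mem_iff_norm_lt_one (w : HeightOneSpectrum R) (f : E →+* T)
    (hf : ∀ a : R, ‖f (algebraMap R E a)‖ ≤ 1)
    (hw : ∀ a : R, a ∈ w.asIdeal ↔ ‖f (algebraMap R E a)‖ < 1) :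
    Continuous (f.comp (WithVal.equiv (w.valuation E)).toRingHom) := by
  refine continuous_of_continuousAt_zero
    (f.comp (WithVal.equiv (w.valuation E)).toRingHom) ?_
  rw [ContinuousAt, map_zero, Metric.tendsto_nhds]
  intro ε hε
  obtain ⟨π, hπw, hπ0⟩ := Submodule.exists_mem_ne_zero_of_ne_bot w.ne_bot
  have hπE : algebraMap R E π ≠ 0 := by simpa using hπ0
  obtain ⟨N, hN⟩ := exists_pow_lt_of_lt_one hε ((hw π).mp hπw)
  set p : E := algebraMap R E π ^ N with hp
  have hpE : p ≠ 0 := pow_ne_zero _ hπE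
  have hv : (Valued.v (R := WithVal (w.valuation E))).restrict (WithVal.toVal _ p) ≠ 0 := by
    simpa using hpE
  refine Valued.mem_nhds_zero.mpr ⟨Units.mk0 _ hv, fun x hx => ?_⟩
  have hx : w.valuation E x.ofVal < w.valuation E p := by
    exact (Valuation.restrict_lt_iff (Valued.v (R := WithVal (w.valuation E)))).mp hx
  have h1 : ‖f (x.ofVal / p)‖ ≤ 1 := by
    refine norm_map_le_one_of_valuation_le_one w f hf hw ?_
    rw [map_div₀]
    exact div_le_one_of_le₀ hx.le zero_le
  have h2 : ‖f x.ofVal‖ ≤ ‖f p‖ := by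
    rwa [map_div₀, norm_div, div_le_one (by simpa using hpE)] at h1
  have h3 : ‖f p‖ < ε := by rwa [hp, map_pow, norm_pow]
  simpa [dist_zero_right] using h2.trans_lt h3

/-- A ring homomorphism to a complete field extends to the completion at the prime that it cuts
out. -/
theorem exists_continuous_extension_adicCompletion [CompleteSpace T] (w : HeightOneSpectrum R)
    (f : E →+* T) (hf : ∀ a : R, ‖f (algebraMap R E a)‖ ≤ 1)
    (hw : ∀ a : R, a ∈ w.asIdeal ↔ ‖f (algebraMap R E a)‖ < 1) :
    ∃ F : w.adicCompletion E →+* T, Continuous F ∧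
      ∀ a, F (algebraMap E (w.adicCompletion E) a) = f a := by
  have hc := continuous_of_mem_iff_norm_lt_one w f hf hw
  refine ⟨(UniformSpace.Completion.extensionHom _ hc).comp
    (HeightOneSpectrum.adicCompletion.equiv E w).toRingHom, ?_, fun a => ?_⟩
  · exact UniformSpace.Completion.continuous_extension.comp
      (HeightOneSpectrum.adicCompletion.continuous_toCompletion E w)
  · exact UniformSpace.Completion.extensionHom_coe _ hc (WithVal.toVal _ a)

end

section

theorem spectralNorm_map_le_one_of_isIntegral {F M : Type*} [NontriviallyNormedField F]
    [CompleteSpace F] [IsUltrametricDist F] [Field M] [Algebra F M] [Algebra.IsAlgebraic F M]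
    {x : M} (hx : IsIntegral ℤ x) : spectralNorm F M x ≤ 1 := by
  let : NormedField M := spectralNorm.normedField F M
  let : NormedAlgebra F M := spectralNorm.normedAlgebra F M
  have : IsUltrametricDist M := IsUltrametricDist.of_normedAlgebra F
  have hx' : IsIntegral (NormedField.valuation (K := M)).integer x := hx.tower_top
  exact (Valuation.integer.integers (NormedField.valuation (K := M))).mem_of_integral hx'

theorem exists_heightOneSpectrum_mem_iff_spectralNorm_lt_one {F M K E : Type*}
    [NontriviallyNormedField F] [CompleteSpace F] [IsUltrametricDist F] [Field M] [Algebra F M]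
    [Algebra.IsAlgebraic F M] [Field K] [NumberField K] [Field E] [NumberField E] [Algebra K E]
    (v : HeightOneSpectrum (𝓞 K)) (j : K →+* F)
    (hv : ∀ a : 𝓞 K, a ∈ v.asIdeal ↔ ‖j (algebraMap (𝓞 K) K a)‖ < 1)
    (ι : E →+* M) (hι : ∀ a, ι (algebraMap K E a) = algebraMap F M (j a)) :
    ∃ w : HeightOneSpectrum (𝓞 E), w.asIdeal.comap (algebraMap (𝓞 K) (𝓞 E)) = v.asIdeal ∧
      ∀ a : 𝓞 E, a ∈ w.asIdeal ↔ spectralNorm F M (ι (algebraMap (𝓞 E) E a)) < 1 := by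
  let : NormedField M := spectralNorm.normedField F M
  let : NormedAlgebra F M := spectralNorm.normedAlgebra F M
  have : IsUltrametricDist M := IsUltrametricDist.of_normedAlgebra F
  have hn : ∀ x : M, spectralNorm F M x = ‖x‖ := fun _ => rfl
  have hle : ∀ a : 𝓞 E, ‖ι (algebraMap (𝓞 E) E a)‖ ≤ 1 := fun a =>
    spectralNorm_map_le_one_of_isIntegral ((RingOfIntegers.isIntegral_coe a).map ι.toIntAlgHom)
  have hK : ∀ a : 𝓞 K, ‖ι (algebraMap (𝓞 E) E (algebraMap (𝓞 K) (𝓞 E) a))‖ =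
      ‖j (algebraMap (𝓞 K) K a)‖ := by
    intro a
    have : algebraMap (𝓞 E) E (algebraMap (𝓞 K) (𝓞 E) a) =
      algebraMap K E (algebraMap (𝓞 K) K a) := rfl
    rw [this, hι, norm_algebraMap']
  let I : Ideal (𝓞 E) :=
    { carrier := {a | ‖ι (algebraMap (𝓞 E) E a)‖ < 1}
      add_mem' := fun {a b} ha hb => by
        simp only [Set.mem_ofPred_eq, map_add] at *
        exact (IsUltrametricDist.norm_add_le_max _ _).trans_lt (max_lt ha hb)
      zero_mem' := by simp
      smul_mem' := fun c a ha => by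
        simp only [Set.mem_ofPred_eq, smul_eq_mul, map_mul, norm_mul] at *
        exact (mul_le_of_le_one_left (norm_nonneg _) (hle c)).trans_lt ha }
  have hI : ∀ a, a ∈ I ↔ ‖ι (algebraMap (𝓞 E) E a)‖ < 1 := fun a => Iff.rfl
  have hIp : I.IsPrime := by
    refine ⟨?_, ?_⟩
    · rw [Ideal.ne_top_iff_one, hI]
      simp
    · intro a b hab
      by_contra! h
      rw [hI, hI, not_lt, not_lt] at h
      rw [hI, map_mul, map_mul, norm_mul] at hab
      exact absurd hab (not_lt.mpr (one_le_mul_of_one_le_of_one_le h.1 h.2))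
  have hcomap : I.comap (algebraMap (𝓞 K) (𝓞 E)) = v.asIdeal := by
    ext a
    rw [Ideal.mem_comap, hI, hK, hv]
  refine ⟨⟨I, hIp, ?_⟩, hcomap, fun a => Iff.rfl⟩
  intro hbot
  obtain ⟨π, hπv, hπ0⟩ := Submodule.exists_mem_ne_zero_of_ne_bot v.ne_bot
  rw [← hcomap, Ideal.mem_comap, hbot, Ideal.mem_bot] at hπv
  exact hπ0 ((FaithfulSMul.algebraMap_injective (𝓞 K) (𝓞 E)) (by rw [hπv, map_zero]))

@[reducible]
noncomputable def adicCompletionNontriviallyNormedField {K : Type*} [Field K] [NumberField K]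
    (v : HeightOneSpectrum (𝓞 K)) : NontriviallyNormedField (v.adicCompletion K) :=
  { HeightOneSpectrum.instNormedFieldValuedAdicCompletion K v with
    non_trivial := by
      obtain ⟨π, hπv, hπ0⟩ := Submodule.exists_mem_ne_zero_of_ne_bot v.ne_bot
      refine ⟨(FinitePlace.embedding v (algebraMap (𝓞 K) K π))⁻¹, ?_⟩
      have h := (FinitePlace.norm_lt_one_iff_mem K v π).mpr hπv
      rw [norm_inv]
      refine (one_lt_inv₀ (norm_pos_iff.mpr ?_)).mpr h
      simpa using hπ0 }

attribute [local instance] adicCompletionNontriviallyNormedField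

theorem exists_adicCompletion_embeddings {K E M : Type*} [Field K] [NumberField K] [Field E]
    [NumberField E] [Algebra K E] (v : HeightOneSpectrum (𝓞 K)) [Field M]
    [Algebra (v.adicCompletion K) M] [FiniteDimensional (v.adicCompletion K) M] (ι : E →+* M)
    (hι : ∀ a, ι (algebraMap K E a) =
      algebraMap (v.adicCompletion K) M (algebraMap K (v.adicCompletion K) a)) :
    ∃ w : HeightOneSpectrum (𝓞 E), w.asIdeal.comap (algebraMap (𝓞 K) (𝓞 E)) = v.asIdeal ∧
      (∀ a : 𝓞 E, a ∈ w.asIdeal ↔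
        spectralNorm (v.adicCompletion K) M (ι (algebraMap (𝓞 E) E a)) < 1) ∧
      ∃ (ψ : v.adicCompletion K →+* w.adicCompletion E) (ε : w.adicCompletion E →+* M),
        Continuous ψ ∧
        (∀ a, ψ (algebraMap K (v.adicCompletion K) a) =
          algebraMap E (w.adicCompletion E) (algebraMap K E a)) ∧
        (∀ a, ε (algebraMap E (w.adicCompletion E) a) = ι a) ∧
        ∀ x, ε (ψ x) = algebraMap (v.adicCompletion K) M x := by
  obtain ⟨w, hwv, hw⟩ := exists_heightOneSpectrum_mem_iff_spectralNorm_lt_one v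
    (algebraMap K (v.adicCompletion K))
    (fun a => (FinitePlace.norm_lt_one_iff_mem K v a).symm) ι hι
  obtain ⟨ψ, hψc, hψ⟩ := exists_continuous_extension_adicCompletion v
    ((algebraMap E (w.adicCompletion E)).comp (algebraMap K E))
    (fun a => FinitePlace.norm_le_one E w (algebraMap (𝓞 K) (𝓞 E) a))
    (fun a => by
      rw [← hwv, Ideal.mem_comap]
      exact (FinitePlace.norm_lt_one_iff_mem E w (algebraMap (𝓞 K) (𝓞 E) a)).symm)
  let : NormedField M := spectralNorm.normedField (v.adicCompletion K) M
  let : NormedAlgebra (v.adicCompletion K) M := spectralNorm.normedAlgebra (v.adicCompletion K) M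
  have : CompleteSpace M := spectralNorm.completeSpace (v.adicCompletion K) M
  obtain ⟨ε, hεc, hε⟩ := exists_continuous_extension_adicCompletion w ι
    (fun a => spectralNorm_map_le_one_of_isIntegral
      ((RingOfIntegers.isIntegral_coe a).map ι.toIntAlgHom)) hw
  refine ⟨w, hwv, hw, ψ, ε, hψc, hψ, hε, fun x => ?_⟩
  refine congr_fun ((v.denseRange_algebraMap K).equalizer (hεc.comp hψc)
    (continuous_algebraMap (v.adicCompletion K) M) ?_) x
  ext a
  simp only [Function.comp_apply]
  rw [hψ, ← hι]
  exact hε _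

end

theorem infinite_heightOneSpectrum_ringOfIntegers (K : Type*) [Field K] [NumberField K] :
    Infinite (HeightOneSpectrum (𝓞 K)) := by
  have h : ∀ p : Nat.Primes, ∃ v : HeightOneSpectrum (𝓞 K), ((p : ℕ) : 𝓞 K) ∈ v.asIdeal := by
    intro p
    have hp : ¬ IsUnit ((p : ℕ) : 𝓞 K) := by
      intro h
      have := (NumberField.isUnit_iff_norm).mp h
      have h2 : Algebra.norm ℚ (algebraMap (𝓞 K) K ((p : ℕ) : 𝓞 K)) =
          (p : ℕ) ^ Module.finrank ℚ K := by
        rw [map_natCast, ← map_natCast (algebraMap ℚ K), Algebra.norm_algebraMap]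
      rw [RingOfIntegers.coe_norm] at this
      change |Algebra.norm ℚ (algebraMap (𝓞 K) K ((p : ℕ) : 𝓞 K))| = 1 at this
      rw [h2, abs_pow, pow_eq_one_iff_of_nonneg (abs_nonneg _) Module.finrank_pos.ne'] at this
      exact p.2.one_lt.ne' (by simpa using this)
    obtain ⟨I, hI, hle⟩ := Ideal.exists_le_maximal _ (mt Ideal.span_singleton_eq_top.mp hp)
    have hpI : ((p : ℕ) : 𝓞 K) ∈ I := hle (Ideal.mem_span_singleton_self _)
    refine ⟨⟨I, hI.isPrime, ?_⟩, hpI⟩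
    rintro rfl
    exact p.2.ne_zero (by simpa using hpI)
  choose f hf using h
  refine Infinite.of_injective f fun p q hpq => ?_
  by_contra hne
  have hc : IsCoprime ((p : ℕ) : ℤ) ((q : ℕ) : ℤ) :=
    Nat.isCoprime_iff_coprime.mpr ((Nat.coprime_primes p.2 q.2).mpr fun h => hne (Subtype.ext h))
  obtain ⟨a, b, hab⟩ := hc
  have hab' : (a : 𝓞 K) * ((p : ℕ) : 𝓞 K) + (b : 𝓞 K) * ((q : ℕ) : 𝓞 K) = 1 := by
    exact_mod_cast congrArg (Int.cast : ℤ → 𝓞 K) hab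
  refine (f p).isPrime.ne_top ((Ideal.eq_top_iff_one _).mpr ?_)
  rw [← hab']
  exact Ideal.add_mem _ (Ideal.mul_mem_left _ _ (hf p)) (Ideal.mul_mem_left _ _ (hpq ▸ hf q))

theorem exists_forall_adicAbv_sub_lt {K ι : Type*} [Field K] [NumberField K] [Finite ι]
    (u : ι → HeightOneSpectrum (𝓞 K)) (hu : Function.Injective u) (b : ι → K) {ε : ℝ}
    (hε : 0 < ε) :
    ∃ a : K, ∀ i, HeightOneSpectrum.adicAbv K (u i) (a - b i) < ε := by
  have := Fintype.ofFinite ι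
  have hlt : ∀ (w : HeightOneSpectrum (𝓞 K)) (a : 𝓞 K),
      HeightOneSpectrum.adicAbv K w (algebraMap (𝓞 K) K a) < 1 ↔ a ∈ w.asIdeal := by
    intro w a
    rw [← FinitePlace.norm_embedding, FinitePlace.norm_lt_one_iff_mem]
  have hd := AbsoluteValue.denseRange_algebraMap_pi (F := K)
    (v := fun i => HeightOneSpectrum.adicAbv K (u i)) (fun i => ?_) (fun i j hij h => ?_)
  · obtain ⟨a, ha⟩ := Metric.denseRange_iff.mp hd (fun i => WithAbs.toAbs _ (b i)) ε hε
    refine ⟨a, fun i => ?_⟩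
    have := (dist_pi_lt_iff hε).mp ha i
    rw [dist_comm, dist_eq_norm] at this
    exact this
  · obtain ⟨π, hπw, hπ0⟩ := Submodule.exists_mem_ne_zero_of_ne_bot (u i).ne_bot
    exact ⟨algebraMap (𝓞 K) K π, by simpa using hπ0, ((hlt _ _).mpr hπw).ne⟩
  · refine hij (hu (HeightOneSpectrum.ext (Ideal.ext fun a => ?_)))
    rw [← hlt, ← hlt]
    exact h.lt_one_iff

theorem exists_monic_forall_coeff_sub_lt {K : Type*} [Field K] [NumberField K]
    {v q r : HeightOneSpectrum (𝓞 K)} (hvq : v ≠ q) (hvr : v ≠ r) (hqr : q ≠ r) {n : ℕ}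
    {f₁ : (v.adicCompletion K)[X]} {f₂ : (q.adicCompletion K)[X]} {f₃ : (r.adicCompletion K)[X]}
    (h₁ : f₁.IsMonicOfDegree n) (h₂ : f₂.IsMonicOfDegree n) (h₃ : f₃.IsMonicOfDegree n)
    {ε : ℝ} (hε : 0 < ε) :
    ∃ g : K[X], g.IsMonicOfDegree n ∧
      (∀ k, ‖(g.map (algebraMap K (v.adicCompletion K))).coeff k - f₁.coeff k‖ < ε) ∧
      (∀ k, ‖(g.map (algebraMap K (q.adicCompletion K))).coeff k - f₂.coeff k‖ < ε) ∧
      (∀ k, ‖(g.map (algebraMap K (r.adicCompletion K))).coeff k - f₃.coeff k‖ < ε) := by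
  have happ : ∀ (w : HeightOneSpectrum (𝓞 K)) (x : w.adicCompletion K),
      ∃ a : K, ‖algebraMap K (w.adicCompletion K) a - x‖ < ε / 2 := by
    intro w x
    obtain ⟨a, ha⟩ := Metric.denseRange_iff.mp (w.denseRange_algebraMap K) x (ε / 2) (half_pos hε)
    exact ⟨a, by rwa [← dist_eq_norm, dist_comm]⟩
  have hcoef : ∀ k, ∃ a : K, ‖algebraMap K (v.adicCompletion K) a - f₁.coeff k‖ < ε ∧
      ‖algebraMap K (q.adicCompletion K) a - f₂.coeff k‖ < ε ∧
      ‖algebraMap K (r.adicCompletion K) a - f₃.coeff k‖ < ε := by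
    intro k
    obtain ⟨a₁, ha₁⟩ := happ v (f₁.coeff k)
    obtain ⟨a₂, ha₂⟩ := happ q (f₂.coeff k)
    obtain ⟨a₃, ha₃⟩ := happ r (f₃.coeff k)
    obtain ⟨a, ha⟩ := exists_forall_adicAbv_sub_lt ![v, q, r]
      (by
        intro i j
        fin_cases i <;> fin_cases j <;> simp [hvq, hvr, hqr, hvq.symm, hvr.symm, hqr.symm])
      ![a₁, a₂, a₃] (half_pos hε)
    have hcomb : ∀ (w : HeightOneSpectrum (𝓞 K)) (x : w.adicCompletion K) (b : K),
        HeightOneSpectrum.adicAbv K w (a - b) < ε / 2 →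
        ‖algebraMap K (w.adicCompletion K) b - x‖ < ε / 2 →
        ‖algebraMap K (w.adicCompletion K) a - x‖ < ε := by
      intro w x b hb hx
      rw [← FinitePlace.norm_embedding, map_sub] at hb
      have := (norm_add_le _ _).trans_lt (add_lt_add hb hx)
      rw [add_halves] at this
      refine lt_of_eq_of_lt (congrArg _ ?_) this
      exact (sub_add_sub_cancel _ _ _).symm
    exact ⟨a, hcomb v _ _ (ha 0) ha₁, hcomb q _ _ (ha 1) ha₂, hcomb r _ _ (ha 2) ha₃⟩
  choose a ha using hcoef
  have hdeg : (∑ k ∈ Finset.range n, C (a k) * X ^ k).degree < (n : WithBot ℕ) := by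
    rw [Finset.sum_range]
    exact degree_sum_fin_lt fun k : Fin n => a k
  have hg : (X ^ n + ∑ k ∈ Finset.range n, C (a k) * X ^ k).IsMonicOfDegree n :=
    ⟨by
      rw [add_comm]
      exact natDegree_eq_of_degree_eq_some
        (by rw [degree_add_eq_right_of_degree_lt] <;> simp [hdeg]),
      monic_X_pow_add hdeg⟩
  have hco : ∀ (w : HeightOneSpectrum (𝓞 K)) (f : (w.adicCompletion K)[X]), f.IsMonicOfDegree n →
      (∀ k, ‖algebraMap K (w.adicCompletion K) (a k) - f.coeff k‖ < ε) → ∀ k,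
      ‖((X ^ n + ∑ k ∈ Finset.range n, C (a k) * X ^ k).map
        (algebraMap K (w.adicCompletion K))).coeff k - f.coeff k‖ < ε := by
    intro w f hf h k
    rw [coeff_map]
    rcases lt_trichotomy k n with hk | rfl | hk
    · have : (X ^ n + ∑ k ∈ Finset.range n, C (a k) * X ^ k).coeff k = a k := by
        simp [coeff_X_pow, hk.ne, hk]
      rw [this]; exact h k
    · have h1 := hg.monic.coeff_natDegree
      have h2 := hf.monic.coeff_natDegree
      rw [hg.natDegree_eq] at h1
      rw [hf.natDegree_eq] at h2
      rw [h1, h2]; simpa using hε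
    · rw [coeff_eq_zero_of_natDegree_lt (by rwa [hg.natDegree_eq]),
        coeff_eq_zero_of_natDegree_lt (by rwa [hf.natDegree_eq])]
      simpa using hε
  exact ⟨_, hg, hco v f₁ h₁ fun k => (ha k).1, hco q f₂ h₂ fun k => (ha k).2.1,
    hco r f₃ h₃ fun k => (ha k).2.2⟩

theorem exists_adicCompletion_forall_pow_ne {K : Type*} [Field K] [NumberField K]
    (v : HeightOneSpectrum (𝓞 K)) :
    ∃ a : v.adicCompletion K, ∀ p, p.Prime → ∀ b, b ^ p ≠ a := by
  obtain ⟨π, hπ⟩ := v.valuation_exists_uniformizer K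
  refine ⟨(π : v.adicCompletion K), fun p hp b hb => ?_⟩
  have h := congrArg Valued.v hb
  rw [HeightOneSpectrum.adicCompletion.valued_coe, hπ, map_pow] at h
  have hlog := congrArg WithZero.log h
  rw [WithZero.log_pow, WithZero.log_exp, nsmul_eq_mul] at hlog
  have : ((p : ℕ) : ℤ) ∣ 1 := by
    rw [← dvd_neg, ← hlog]; exact dvd_mul_right _ _
  exact hp.one_lt.ne' (by
    exact_mod_cast Int.natCast_dvd_natCast.mp (by exact_mod_cast this) |> Nat.dvd_one.mp)

theorem mem_range_of_map_eq_prod_X_sub_C {K E ι : Type*} [Field K] [Field E] [Algebra K E]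
    [Fintype ι] {g : K[X]} {y : ι → E} (hg : g.map (algebraMap K E) = ∏ i, (X - C (y i))) {x : E}
    (hx : g.aeval x = 0) : ∃ i, y i = x := by
  rw [← eval_map_algebraMap, hg, eval_prod, Finset.prod_eq_zero_iff] at hx
  obtain ⟨i, -, hi⟩ := hx
  exact ⟨i, by simpa [sub_eq_zero, eq_comm] using hi⟩

theorem aeval_eq_zero_of_map_eq_prod_X_sub_C {K E ι : Type*} [Field K] [Field E] [Algebra K E]
    [Fintype ι] {g : K[X]} {y : ι → E} (hg : g.map (algebraMap K E) = ∏ i, (X - C (y i))) (i : ι) :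
    g.aeval (y i) = 0 := by
  rw [← eval_map_algebraMap, hg, eval_prod]
  exact Finset.prod_eq_zero (Finset.mem_univ i) (by simp)

theorem exists_bijective_comp_eq_of_map_eq_prod_X_sub_C {K E ι : Type*} [Field K] [Field E]
    [Algebra K E] [Fintype ι] {g : K[X]} {y z : ι → E}
    (hy : g.map (algebraMap K E) = ∏ i, (X - C (y i)))
    (hz : g.map (algebraMap K E) = ∏ i, (X - C (z i))) (hzi : Function.Injective z) :
    ∃ b : ι → ι, Function.Bijective b ∧ ∀ i, y (b i) = z i := by
  choose b hb using fun i => mem_range_of_map_eq_prod_X_sub_C hy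
    (aeval_eq_zero_of_map_eq_prod_X_sub_C hz i)
  refine ⟨b, Finite.injective_iff_bijective.mp fun i j h => hzi ?_, hb⟩
  rw [← hb, ← hb, h]

theorem forall_perm_exists_algEquiv_of_map_eq_prod {K E ι : Type*} [Field K] [Field E]
    [Algebra K E] [Fintype ι] [DecidableEq ι] (hp : (Fintype.card ι).Prime) {g : K[X]}
    {y y₁ y₂ : ι → E} (hy : g.map (algebraMap K E) = ∏ i, (X - C (y i)))
    (hy₁ : g.map (algebraMap K E) = ∏ i, (X - C (y₁ i)))
    (hy₂ : g.map (algebraMap K E) = ∏ i, (X - C (y₂ i))) (hi : Function.Injective y)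
    (hi₁ : Function.Injective y₁) (hi₂ : Function.Injective y₂)
    (htrans : ∀ i j, ∃ τ : E ≃ₐ[K] E, τ (y₁ i) = y₁ j) {a b : ι} (hab : a ≠ b)
    (hswap : ∃ τ : E ≃ₐ[K] E, ∀ i, τ (y₂ i) = y₂ (Equiv.swap a b i)) (π : Equiv.Perm ι) :
    ∃ τ : E ≃ₐ[K] E, ∀ i, τ (y i) = y (π i) := by
  obtain ⟨b₁, hb₁, h₁⟩ := exists_bijective_comp_eq_of_map_eq_prod_X_sub_C hy hy₁ hi₁
  obtain ⟨b₂, hb₂, h₂⟩ := exists_bijective_comp_eq_of_map_eq_prod_X_sub_C hy hy₂ hi₂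
  refine forall_perm_exists_algEquiv_of_transitive_of_swap hp y (fun i j => ?_) hi
    (hb₂.injective.ne hab) ?_ π
  · obtain ⟨i, rfl⟩ := hb₁.surjective i
    obtain ⟨j, rfl⟩ := hb₁.surjective j
    obtain ⟨τ, hτ⟩ := htrans i j
    refine ⟨τ, fun k => ?_, by rw [h₁, h₁, hτ]⟩
    obtain ⟨l, hl⟩ := mem_range_of_map_eq_prod_X_sub_C hy (x := τ (y k)) (by
      rw [← AlgEquiv.coe_toAlgHom, aeval_algHom_apply,
        aeval_eq_zero_of_map_eq_prod_X_sub_C hy, map_zero])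
    exact ⟨l, hl.symm⟩
  · obtain ⟨τ, hτ⟩ := hswap
    refine ⟨τ, fun i => ?_⟩
    obtain ⟨i, rfl⟩ := hb₂.surjective i
    rw [h₂, hτ, ← h₂, hb₂.injective.map_swap]

theorem adjoin_range_eq_top_of_map_eq_prod {K ι : Type*} [Field K] [Fintype ι] {g : K[X]}
    {y : ι → g.SplittingField}
    (hy : g.map (algebraMap K g.SplittingField) = ∏ i, (X - C (y i))) :
    IntermediateField.adjoin K (Set.range y) = ⊤ := by
  refine eq_top_iff.mpr ((IntermediateField.adjoin_eq_top_of_algebra K _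
    (SplittingField.adjoin_rootSet g)).ge.trans (IntermediateField.adjoin.mono K _ _ ?_))
  intro x hx
  exact mem_range_of_map_eq_prod_X_sub_C hy (aeval_eq_zero_of_mem_rootSet hx)

theorem isMonicOfDegree_of_map_eq_prod {F M ι : Type*} [Field F] [Field M] [Algebra F M] [Fintype ι]
    {f : F[X]} {x : ι → M} (hf : f.map (algebraMap F M) = ∏ i, (X - C (x i))) :
    f.IsMonicOfDegree (Fintype.card ι) := by
  refine ⟨?_, ?_⟩
  · rw [← natDegree_map (algebraMap F M), hf,
      natDegree_prod_of_monic _ _ fun i _ => monic_X_sub_C _]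
    simp
  · rw [(algebraMap F M).injective.monic_map_iff, hf]
    exact monic_prod_of_monic _ _ fun i _ => monic_X_sub_C _

theorem exists_splittingField_data {K F M ι : Type*} [Field K] [Field F] [Field M] [Algebra K F]
    [Algebra F M] [Algebra K M] [IsScalarTower K F M] [Fintype ι] {g : K[X]} {z : ι → M}
    (hg : (g.map (algebraMap K F)).map (algebraMap F M) = ∏ i, (X - C (z i))) :
    ∃ (φ : g.SplittingField →ₐ[K] M) (y : ι → g.SplittingField), (∀ i, φ (y i) = z i) ∧
      g.map (algebraMap K g.SplittingField) = ∏ i, (X - C (y i)) ∧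
      ∀ σ : M ≃ₐ[F] M, ∃ τ : g.SplittingField ≃ₐ[K] g.SplittingField,
        ∀ e, φ (τ e) = σ (φ e) := by
  rw [Polynomial.map_map, ← IsScalarTower.algebraMap_eq] at hg
  obtain ⟨φ, y, hφ, hy⟩ := exists_algHom_apply_roots g z hg
  exact ⟨φ, y, hφ, hy, fun σ => exists_algEquiv_apply_algHom φ (σ.restrictScalars K)⟩

section

attribute [local instance] adicCompletionNontriviallyNormedField

theorem exists_global_field_with_symmetric_action {K : Type} [Field K] [NumberField K] {m : ℕ}
    (hm : (m + 2).Prime) (v : HeightOneSpectrum (𝓞 K)) {M : Type*} [Field M]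
    [Algebra (v.adicCompletion K) M] [FiniteDimensional (v.adicCompletion K) M]
    [IsGalois (v.adicCompletion K) M]
    (ρ : (M ≃ₐ[v.adicCompletion K] M) →* Equiv.Perm (Fin (m + 2))) :
    ∃ (E : Type) (_ : Field E) (_ : NumberField E) (_ : Algebra K E)
      (y : Fin (m + 2) → E) (Φ : Equiv.Perm (Fin (m + 2)) →* (E ≃ₐ[K] E)) (ι : E →+* M),
      IsGalois K E ∧ Function.Injective y ∧ (∀ π i, Φ π (y i) = y (π i)) ∧
      (∀ a, ι (algebraMap K E a) =
        algebraMap (v.adicCompletion K) M (algebraMap K (v.adicCompletion K) a)) ∧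
      ∀ σ e, σ (ι e) = ι (Φ (ρ σ) e) := by
  have := infinite_heightOneSpectrum_ringOfIntegers K
  obtain ⟨q, hq⟩ := Infinite.exists_notMem_finset ({v} : Finset (HeightOneSpectrum (𝓞 K)))
  obtain ⟨r, hr⟩ :=
    Infinite.exists_notMem_finset ({v, q} : Set (HeightOneSpectrum (𝓞 K))).toFinite.toFinset
  have hvq : v ≠ q := by simpa [eq_comm] using hq
  have hvr : v ≠ r := fun h => hr (by simp [h])
  have hqr : q ≠ r := fun h => hr (by simp [h])
  have hc : ∀ w : HeightOneSpectrum (𝓞 K), CharZero (w.adicCompletion K) := fun w =>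
    charZero_of_injective_algebraMap (algebraMap K (w.adicCompletion K)).injective
  let : Algebra K M := ((algebraMap (v.adicCompletion K) M).comp
    (algebraMap K (v.adicCompletion K))).toAlgebra
  have : IsScalarTower K (v.adicCompletion K) M := .of_algebraMap_eq fun _ => rfl
  have hcard : Fintype.card (Fin (m + 2)) = m + 2 := Fintype.card_fin _
  obtain ⟨x₀, hx₀, hρ⟩ := exists_injective_equivariant_map ρ
  obtain ⟨f₀, hf₀⟩ := exists_map_eq_prod_X_sub_C_of_permuted x₀ fun σ => ⟨ρ σ, hρ σ⟩
  obtain ⟨a₁, ha₁⟩ := exists_adicCompletion_forall_pow_ne q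
  obtain ⟨x₁, hx₁, hf₁, htr⟩ := exists_roots_X_pow_sub_C_of_prime
    (Ω := AlgebraicClosure (q.adicCompletion K)) hm a₁ (ha₁ _ hm)
  obtain ⟨a₂, ha₂⟩ := exists_adicCompletion_forall_pow_ne r
  obtain ⟨x₂, f₂, hx₂, hf₂, σ₂, hσ₂⟩ := exists_roots_with_swap
    (Ω := AlgebraicClosure (r.adicCompletion K)) m a₂ (ha₂ _ Nat.prime_two)
  have hd₀ := isMonicOfDegree_of_map_eq_prod hf₀
  have hd₁ := isMonicOfDegree_of_map_eq_prod hf₁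
  have hd₂ := isMonicOfDegree_of_map_eq_prod hf₂
  obtain ⟨ε₀, hε₀, H₀⟩ := exists_pos_forall_exists_roots x₀ hx₀ _ hf₀
  obtain ⟨ε₁, hε₁, H₁⟩ := exists_pos_forall_exists_roots x₁ hx₁ _ hf₁
  obtain ⟨ε₂, hε₂, H₂⟩ := exists_pos_forall_exists_roots x₂ hx₂ _ hf₂
  obtain ⟨g, hg, hg₀, hg₁, hg₂⟩ := exists_monic_forall_coeff_sub_lt hvq hvr hqr hd₀ hd₁ hd₂
    (lt_min hε₀ (lt_min hε₁ hε₂))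
  obtain ⟨z₀, hz₀, hgz₀, hσz₀⟩ := H₀ _ (hg.monic.map _)
    (by rw [natDegree_map, hg.natDegree_eq, hd₀.natDegree_eq])
    fun n => (hg₀ n).trans_le (min_le_left _ _)
  obtain ⟨z₁, hz₁, hgz₁, hσz₁⟩ := H₁ _ (hg.monic.map _)
    (by rw [natDegree_map, hg.natDegree_eq, hd₁.natDegree_eq])
    fun n => (hg₁ n).trans_le ((min_le_right _ _).trans (min_le_left _ _))
  obtain ⟨z₂, hz₂, hgz₂, hσz₂⟩ := H₂ _ (hg.monic.map _)
    (by rw [natDegree_map, hg.natDegree_eq, hd₂.natDegree_eq])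
    fun n => (hg₂ n).trans_le ((min_le_right _ _).trans (min_le_right _ _))
  obtain ⟨φ₀, y₀, hφ₀, hy₀, -⟩ := exists_splittingField_data hgz₀
  obtain ⟨φ₁, y₁, hφ₁, hy₁, hτ₁⟩ := exists_splittingField_data hgz₁
  obtain ⟨φ₂, y₂, hφ₂, hy₂, hτ₂⟩ := exists_splittingField_data hgz₂
  have hi₀ : Function.Injective y₀ := fun i j h => hz₀ (by rw [← hφ₀, h, hφ₀])
  have hi₁ : Function.Injective y₁ := fun i j h => hz₁ (by rw [← hφ₁, h, hφ₁])
  have hi₂ : Function.Injective y₂ := fun i j h => hz₂ (by rw [← hφ₂, h, hφ₂])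
  have hperm := forall_perm_exists_algEquiv_of_map_eq_prod (by rwa [hcard]) hy₀ hy₁ hy₂ hi₀ hi₁ hi₂
    (fun i j => by
      obtain ⟨σ, hσ⟩ := htr i j
      obtain ⟨τ, hτ⟩ := hτ₁ σ
      exact ⟨τ, φ₁.toRingHom.injective (by simp [hτ, hφ₁, hσz₁ σ i j hσ])⟩)
    (zero_ne_one : (0 : Fin (m + 2)) ≠ 1)
    (by
      obtain ⟨τ, hτ⟩ := hτ₂ σ₂
      exact ⟨τ, fun i => φ₂.toRingHom.injective (by simp [hτ, hφ₂, hσz₂ σ₂ i _ (hσ₂ i)])⟩)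
  have hadj := adjoin_range_eq_top_of_map_eq_prod hy₀
  obtain ⟨Φ, hΦ⟩ := exists_monoidHom_algEquiv_of_forall_perm y₀ hadj hperm
  have : NumberField g.SplittingField := NumberField.of_module_finite K g.SplittingField
  refine ⟨g.SplittingField, inferInstance, this, inferInstance, y₀, Φ, φ₀, ⟨⟩, hi₀, hΦ,
    fun a => φ₀.commutes a, fun σ e => ?_⟩
  · have := algHom_ext_of_adjoin_range_eq_top y₀ hadj
      (φ := (σ.restrictScalars K : M ≃ₐ[K] M).toAlgHom.comp φ₀)
      (ψ := φ₀.comp (Φ (ρ σ) : _ ≃ₐ[K] _).toAlgHom) fun i => by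
        simp [hφ₀, hΦ, hσz₀ σ i _ (hρ σ i)]
    exact DFunLike.congr_fun this e

end

theorem exists_prime_monoidHom_perm_injective (G : Type*) [Group G] [Finite G] :
    ∃ m, (m + 2).Prime ∧ ∃ j : G →* Equiv.Perm (Fin (m + 2)), Function.Injective j := by
  have := Fintype.ofFinite G
  obtain ⟨p, hle, hp⟩ := Nat.exists_infinite_primes (Fintype.card G)
  obtain ⟨m, rfl⟩ := Nat.exists_eq_add_of_le' hp.two_le
  refine ⟨m, hp, ?_⟩
  have e : G ↪ Fin (m + 2) := (Function.Embedding.nonempty_of_card_le (by simpa using hle)).some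
  refine ⟨(Equiv.Perm.viaEmbeddingHom e).comp (MulAction.toPermHom G G), ?_⟩
  exact (Equiv.Perm.viaEmbeddingHom_injective e).comp MulAction.toPerm_injective

theorem RingHom.exists_lift_of_forall_mem_range {A B C : Type*} [Ring A] [Ring B] [Ring C]
    (i : A →+* C) (j : B →+* C) (hj : Function.Injective j) (h : ∀ a, ∃ b, j b = i a) :
    ∃ k : A →+* B, ∀ a, j (k a) = i a := by
  choose k hk using h
  exact ⟨{ toFun := k
           map_one' := hj (by simp [hk])
           map_mul' := fun a b => hj (by simp [hk])
           map_zero' := hj (by simp [hk])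
           map_add' := fun a b => hj (by simp [hk]) }, hk⟩

theorem surjective_of_fixing_trivial {F M A ι : Type*} [Field F] [Field M] [Field A] [Algebra F M]
    [FiniteDimensional F M] [IsGalois F M] (ε : A →+* M) (hF : ∀ x : F, ∃ a, ε a = algebraMap F M x)
    (z : ι → M) (hz : ∀ i, ∃ a, ε a = z i)
    (h : ∀ σ : M ≃ₐ[F] M, (∀ i, σ (z i) = z i) → σ = 1) : Function.Surjective ε := by
  have htop : IntermediateField.adjoin F (Set.range z) = ⊤ := by
    rw [← IsGalois.fixedField_fixingSubgroup (IntermediateField.adjoin F (Set.range z))]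
    have : (IntermediateField.adjoin F (Set.range z)).fixingSubgroup = ⊥ := by
      refine eq_bot_iff.mpr fun σ hσ => Subgroup.mem_bot.mpr (h σ fun i => ?_)
      exact (IntermediateField.mem_fixingSubgroup_iff _ σ).mp hσ _
        (IntermediateField.subset_adjoin _ _ ⟨i, rfl⟩)
    rw [this, IntermediateField.fixedField_bot]
  intro x
  have hx : x ∈ IntermediateField.adjoin F (Set.range z) := htop ▸ IntermediateField.mem_top
  change x ∈ ε.fieldRange
  induction hx using IntermediateField.adjoin_induction with
  | mem x hx => obtain ⟨i, rfl⟩ := hx; exact hz i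
  | algebraMap x => exact hF x
  | add x z _ _ hx hz => exact add_mem hx hz
  | inv x _ hx => exact inv_mem hx
  | mul x z _ _ hx hz => exact mul_mem hx hz

end

set_option synthInstance.maxHeartbeats 1000000
set_option maxHeartbeats 2000000

/-- The key claim in the proof of Corollary 4.5: every finite Galois extension `L₀` of a
completion `K_v` of a number field `K`, with Galois group embedding into the finite group
`G`, is the completion of a global Galois extension `L/K'` with group `G`, where `K'/K` is a
finite extension having a prime `v'` over `v` at which the natural embedding `K_v → K'_{v'}`
is a (continuous, `K`-compatible) isomorphism. -/
theorem local_extension_is_completion_of_global_after_base_change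
    (K : Type) [Field K] [NumberField K] (G : Type) [Group G] [Finite G]
    (v : HeightOneSpectrum (𝓞 K))
    (L₀ : Type) [Field L₀] [Algebra (v.adicCompletion K) L₀]
    [FiniteDimensional (v.adicCompletion K) L₀] [IsGalois (v.adicCompletion K) L₀]
    (hsub : ∃ f : (L₀ ≃ₐ[v.adicCompletion K] L₀) →* G, Function.Injective f) :
    ∃ (K' : Type) (_ : Field K') (_ : Algebra K K') (_ : NumberField K'),
      FiniteDimensional K K' ∧
      ∃ v' : HeightOneSpectrum (𝓞 K'),
        v'.asIdeal.comap (algebraMap (𝓞 K) (𝓞 K')) = v.asIdeal ∧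
        ∃ φ : (v.adicCompletion K) ≃+* (v'.adicCompletion K'),
          Continuous (φ : v.adicCompletion K → v'.adicCompletion K') ∧
          (∀ a : K, φ (algebraMap K (v.adicCompletion K) a) =
            algebraMap K' (v'.adicCompletion K') (algebraMap K K' a)) ∧
          ∃ (L : Type) (_ : Field L) (_ : Algebra K' L) (_ : NumberField L),
            FiniteDimensional K' L ∧ IsGalois K' L ∧
            Nonempty ((L ≃ₐ[K'] L) ≃* G) ∧
            ∃ w : HeightOneSpectrum (𝓞 L),
              w.asIdeal.comap (algebraMap (𝓞 K') (𝓞 L)) = v'.asIdeal ∧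
              ∃ ρ : (w.adicCompletion L) ≃+* L₀,
                ∀ a : K', ρ (algebraMap L (w.adicCompletion L) (algebraMap K' L a)) =
                  algebraMap (v.adicCompletion K) L₀
                    (φ.symm (algebraMap K' (v'.adicCompletion K') a)) := by
  obtain ⟨f, hf⟩ := hsub
  obtain ⟨m, hm, j, hj⟩ := exists_prime_monoidHom_perm_injective G
  obtain ⟨E, _, _, _, y, Φ, ι, hE, hy, hΦ, hι, hισ⟩ :=
    exists_global_field_with_symmetric_action hm v (j.comp f)
  have : FiniteDimensional K E := Module.Finite.of_restrictScalars_finite ℚ K E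
  have hΦi : Function.Injective Φ := by
    intro π₁ π₂ h
    ext i
    rw [hy (by rw [← hΦ, ← hΦ, h] : y (π₁ i) = y (π₂ i))]
  let S : Subgroup (E ≃ₐ[K] E) := (Φ.comp j).range
  let K' : IntermediateField K E := IntermediateField.fixedField S
  have hK' : ∀ a : K', ∃ b, algebraMap (v.adicCompletion K) L₀ b = ι.comp (algebraMap K' E) a := by
    intro a
    refine IntermediateField.mem_bot.mp ((IsGalois.mem_bot_iff_fixed _).mpr fun σ => ?_)
    rw [RingHom.comp_apply, hισ]
    exact congrArg ι ((IntermediateField.mem_fixedField_iff S _).mp a.2 _ ⟨f σ, rfl⟩)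
  obtain ⟨ι', hι'⟩ := RingHom.exists_lift_of_forall_mem_range _ _
    (algebraMap (v.adicCompletion K) L₀).injective hK'
  have : NumberField K' := NumberField.of_module_finite K K'
  obtain ⟨v', hv'v, hv', ψ', ε', hψ'c, hψ', hε', hεψ'⟩ :=
    exists_adicCompletion_embeddings v (M := v.adicCompletion K) ι' fun a =>
      (algebraMap (v.adicCompletion K) L₀).injective (by
        rw [hι']
        exact hι a)
  obtain ⟨w, -, hw, ψ, ε, -, -, hε, hεψ⟩ := exists_adicCompletion_embeddings v ι hι
  have hψ'b : Function.Bijective ψ' :=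
    ⟨ψ'.injective, fun x => ⟨ε' x, ε'.injective (hεψ' _)⟩⟩
  have hεb : Function.Bijective ε := by
    refine ⟨ε.injective, surjective_of_fixing_trivial ε (fun x => ⟨_, hεψ x⟩) (fun i => ι (y i))
      (fun i => ⟨_, hε (y i)⟩) fun σ hσ => ?_⟩
    refine hf (hj ?_)
    rw [map_one, map_one]
    ext i
    have h := hσ i
    rw [hισ, hΦ] at h
    exact congrArg Fin.val (hy (ι.injective h))
  refine ⟨K', inferInstance, inferInstance, inferInstance, inferInstance, v', hv'v,
    RingEquiv.ofBijective ψ' hψ'b, hψ'c, hψ', E, inferInstance, inferInstance, inferInstance,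
    inferInstance, inferInstance, ?_, w, ?_, RingEquiv.ofBijective ε hεb, fun a => ?_⟩
  · exact ⟨(IntermediateField.subgroupEquivAlgEquiv S).symm.trans
      (MonoidHom.ofInjective (hΦi.comp hj : Function.Injective (Φ.comp j))).symm⟩
  · ext a
    rw [Ideal.mem_comap, hw, hv']
    have : ι (algebraMap (𝓞 E) E (algebraMap (𝓞 K') (𝓞 E) a)) =
        algebraMap (v.adicCompletion K) L₀ (ι' (algebraMap (𝓞 K') K' a)) := (hι' _).symm
    rw [this, spectralNorm_extends]
    exact (iff_of_eq (congrArg (· < 1) (spectralNorm_extends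
      (ι' (algebraMap (𝓞 K') K' a))))).symm
  · have : (RingEquiv.ofBijective ψ' hψ'b).symm (algebraMap K' (v'.adicCompletion K') a) =
        ι' a := by
      rw [RingEquiv.symm_apply_eq]
      refine ε'.injective ?_
      rw [hε']
      exact (hεψ' _).symm
    rw [this, hι']
    exact hε _
end
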